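/- arXiv:2309.10970 — 4 statements merged into one kernel-verified Lean document; each statement's English description precedes it below -/
import Mathlib

section
/- Let p and q be real polynomials, both of degree exactly n ≥ 2, all of whose roots are real and strictly positive. Then lmesh(p ⊠_n q) ≥ lmesh(p). -/
open Polynomial

/-- Generalized hypergeometric polynomial in standard normalization:
`₍i+1₎𝓕_j(-n, a; b; x) = Σ_{k=0}^n (-n)_k (a)_k (b+k)_{n-k} x^k / k!`. -/
noncomputable def hyp (n : ℕ) {i j : ℕ} (a : Fin i → ℝ) (b : Fin j → ℝ) : Polynomial ℝ :=
  ∑ k ∈ Finset.range (n + 1),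
    Polynomial.C (((ascPochhammer ℝ k).eval (-(n : ℝ)) *
        (∏ s, (ascPochhammer ℝ k).eval (a s)) *
        (∏ s, (ascPochhammer ℝ (n - k)).eval (b s + (k : ℝ)))) / (Nat.factorial k : ℝ)) *
      Polynomial.X ^ k

/-- The coefficient `e_k(p)` in the representation `p(x) = Σ_{k=0}^n (-1)^k e_k(p) x^{n-k}`. -/
def eCoeff (n k : ℕ) (p : Polynomial ℝ) : ℝ := (-1 : ℝ) ^ k * p.coeff (n - k)

/-- Finite free multiplicative convolution `p ⊠_n q`. -/
noncomputable def ffMul (n : ℕ) (p q : Polynomial ℝ) : Polynomial ℝ :=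
  ∑ k ∈ Finset.range (n + 1),
    Polynomial.C ((-1 : ℝ) ^ k * ((n.choose k : ℝ))⁻¹ * eCoeff n k p * eCoeff n k q) *
      Polynomial.X ^ (n - k)

/-- Finite free additive convolution `p ⊞_n q`. -/
noncomputable def ffAdd (n : ℕ) (p q : Polynomial ℝ) : Polynomial ℝ :=
  ∑ k ∈ Finset.range (n + 1),
    Polynomial.C ((-1 : ℝ) ^ k *
      ∑ l ∈ Finset.range (k + 1),
        (((n - l).factorial : ℝ) * ((n - (k - l)).factorial : ℝ)) /
            ((n.factorial : ℝ) * ((n - k).factorial : ℝ)) *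
          eCoeff n l p * eCoeff n (k - l) q) *
      Polynomial.X ^ (n - k)

/-- A real polynomial is real-rooted if all of its complex roots are real, i.e. the number of
real roots counted with multiplicity equals the degree. -/
def RealRooted (p : Polynomial ℝ) : Prop := p.roots.card = p.natDegree

/-- The real roots of `p`, with multiplicity, sorted in increasing order. -/
noncomputable def sroots (p : Polynomial ℝ) : List ℝ := p.roots.sort (· ≤ ·)

/-- `p ⪯ q`: `p` and `q` are real-rooted of degree `n` and
`λ_1(p) ≤ λ_1(q) ≤ λ_2(p) ≤ … ≤ λ_n(p) ≤ λ_n(q)` (roots in increasing order). -/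
noncomputable def Interlaces (n : ℕ) (p q : Polynomial ℝ) : Prop :=
  RealRooted p ∧ RealRooted q ∧ p.natDegree = n ∧ q.natDegree = n ∧
  (∀ k, k < n → (sroots p).getD k 0 ≤ (sroots q).getD k 0) ∧
  (∀ k, k + 1 < n → (sroots q).getD k 0 ≤ (sroots p).getD (k + 1) 0)

/-- `p ≺ q`: strict interlacing. -/
noncomputable def StrictInterlaces (n : ℕ) (p q : Polynomial ℝ) : Prop :=
  RealRooted p ∧ RealRooted q ∧ p.natDegree = n ∧ q.natDegree = n ∧
  (∀ k, k < n → (sroots p).getD k 0 < (sroots q).getD k 0) ∧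
  (∀ k, k + 1 < n → (sroots q).getD k 0 < (sroots p).getD (k + 1) 0)

/-- The mesh (minimal distance between roots) of a real-rooted polynomial with `n` roots. -/
noncomputable def mesh (n : ℕ) (p : Polynomial ℝ) : ℝ :=
  sInf {d : ℝ | ∃ k l : ℕ, k < l ∧ l < n ∧
    d = |(sroots p).getD k 0 - (sroots p).getD l 0|}

/-- The logarithmic mesh (minimal ratio between consecutive decreasingly ordered roots) of a
polynomial with `n` positive roots. -/
noncomputable def lmesh (n : ℕ) (p : Polynomial ℝ) : ℝ :=
  sInf {d : ℝ | ∃ k : ℕ, k + 1 < n ∧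
    d = (sroots p).getD (k + 1) 0 / (sroots p).getD k 0}

/-- Generalized Laguerre polynomial `L_n^{(α)}`. -/
noncomputable def Laguerre (n : ℕ) (α : ℝ) : Polynomial ℝ :=
  ∑ k ∈ Finset.range (n + 1),
    Polynomial.C ((descPochhammer ℝ (n - k)).eval ((n : ℝ) + α) /
        ((k.factorial : ℝ) * ((n - k).factorial : ℝ)) * (-1 : ℝ) ^ k) *
      Polynomial.X ^ k


/-- The value of the convolution at a point, over the complex numbers. -/
noncomputable def convVal (n : ℕ) (f q : Polynomial ℂ) (z : ℂ) : ℂ :=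
  ∑ j ∈ Finset.range (n + 1), (-1) ^ (n - j) * ((n.choose j : ℂ))⁻¹ * f.coeff j * q.coeff j * z ^ j

theorem convVal_step (m : ℕ) (f r : Polynomial ℂ) (hr : r.natDegree ≤ m) (b z : ℂ) :
    ((m : ℂ) + 1) * convVal (m + 1) f ((X - C b) * r) z =
      convVal m (C ((m + 1) * b) * f + (C z - C b * X) * derivative f) r z := by
  have h1 : ∀ j, (C (((m : ℂ) + 1) * b) * f + (C z - C b * X) * derivative f).coeff j =
      b * (m + 1 - j) * f.coeff j + z * (j + 1) * f.coeff (j + 1) := by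
    intro j
    rw [sub_mul, coeff_add, coeff_sub, coeff_C_mul, coeff_C_mul, mul_assoc (C b), coeff_C_mul,
      coeff_derivative]
    cases j with
    | zero => rw [mul_coeff_zero, coeff_X_zero]; push_cast; ring
    | succ j => rw [coeff_X_mul, coeff_derivative]; push_cast; ring
  have h2 : ∀ j, ((X - C b) * r).coeff (j + 1) = r.coeff j - b * r.coeff (j + 1) := by
    intro j
    rw [sub_mul, coeff_sub, coeff_C_mul, coeff_X_mul]
  have h0 : ((X - C b) * r).coeff 0 = - b * r.coeff 0 := by
    rw [sub_mul, coeff_sub, coeff_C_mul]; simp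
  -- first part
  set A : ℕ → ℂ := fun j => ((m : ℂ) + 1) * ((-1) ^ (m + 1 - j) * (((m + 1).choose j : ℂ))⁻¹ *
    f.coeff j * (- b * r.coeff j) * z ^ j) with hA
  set B : ℕ → ℂ := fun j => ((m : ℂ) + 1) * ((-1) ^ (m - j) * (((m + 1).choose (j + 1) : ℂ))⁻¹ *
    f.coeff (j + 1) * (r.coeff j) * z ^ (j + 1)) with hB
  have hl : ((m : ℂ) + 1) * convVal (m + 1) f ((X - C b) * r) z =
      ∑ j ∈ Finset.range (m + 1), A j + ∑ j ∈ Finset.range (m + 1), B j := by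
    have : ∑ j ∈ Finset.range (m + 1), A j = ∑ j ∈ Finset.range (m + 1), A (j + 1) + A 0 := by
      rw [← Finset.sum_range_succ', Finset.sum_range_succ _ (m + 1)]
      simp [hA, coeff_eq_zero_of_natDegree_lt (Nat.lt_succ_of_le hr)]
    rw [this, convVal, Finset.sum_range_succ', mul_add, Finset.mul_sum, add_right_comm,
      ← Finset.sum_add_distrib]
    congr 1
    · refine Finset.sum_congr rfl fun j _ => ?_
      rw [h2]
      simp only [hA, hB, Nat.add_sub_add_right]
      ring
    · rw [h0]
  rw [hl, ← Finset.sum_add_distrib, convVal]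
  refine Finset.sum_congr rfl fun j hj => ?_
  have hj' : j ≤ m := by simpa [Nat.lt_succ_iff] using hj
  rw [h1]
  have c0 : (m.choose j : ℂ) ≠ 0 := by exact_mod_cast (Nat.choose_pos hj').ne'
  have c1 : ((m + 1).choose j : ℂ) ≠ 0 := by exact_mod_cast (Nat.choose_pos (by omega)).ne'
  have c2 : ((m + 1).choose (j + 1) : ℂ) ≠ 0 := by exact_mod_cast (Nat.choose_pos (by omega)).ne'
  have e1 : ((m : ℂ) + 1) * (((m + 1).choose j : ℂ))⁻¹ = (m + 1 - j) * ((m.choose j : ℂ))⁻¹ := by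
    have := Nat.choose_mul_succ_eq m j
    have h : (m.choose j : ℂ) * (m + 1) = (m + 1).choose j * (m + 1 - j) := by
      have h' := congrArg (Nat.cast : ℕ → ℂ) this
      push_cast [Nat.cast_sub (show j ≤ m + 1 by omega)] at h'
      exact h'
    field_simp
    linear_combination h
  have e2 : ((m : ℂ) + 1) * (((m + 1).choose (j + 1) : ℂ))⁻¹ = (j + 1) * ((m.choose j : ℂ))⁻¹ := by
    have := Nat.add_one_mul_choose_eq m j
    have h : ((m : ℂ) + 1) * m.choose j = (m + 1).choose (j + 1) * (j + 1) := by
      exact_mod_cast this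
    field_simp
    linear_combination h
  simp only [hA, hB]
  rw [show m + 1 - j = (m - j) + 1 by omega, pow_succ]
  linear_combination ((-1) ^ (m - j) * f.coeff j * b * r.coeff j * z ^ j) * e1 +
    ((-1) ^ (m - j) * f.coeff (j + 1) * r.coeff j * z ^ (j + 1)) * e2

theorem half_plane_term (x ζ α : ℂ) (hx : 0 ≤ x.im) (hζ : 0 ≤ ζ.im) (hα : α.im < 0) (h : x ≠ ζ) :
    0 < (Complex.I * ((starRingEnd ℂ) ζ - x) * ((ζ - α) / (x - α))).re := by
  have hxa : x - α ≠ 0 := by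
    intro h0
    have := congrArg Complex.im h0
    simp at this
    linarith
  have hpos : 0 < Complex.normSq (x - α) := Complex.normSq_pos.mpr hxa
  have hd : 0 < (x.re - ζ.re) ^ 2 + (x.im - ζ.im) ^ 2 := by
    by_contra hc
    apply h
    apply Complex.ext <;> nlinarith [sq_nonneg (x.re - ζ.re), sq_nonneg (x.im - ζ.im)]
  have key : (Complex.I * ((starRingEnd ℂ) ζ - x) * ((ζ - α) / (x - α))).re =
      (((ζ.re - α.re) ^ 2 + (ζ.im - α.im) ^ 2) * x.im + ((x.re - α.re) ^ 2 + (x.im - α.im) ^ 2) * ζ.im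
        + (- α.im) * ((x.re - ζ.re) ^ 2 + (x.im - ζ.im) ^ 2)) / Complex.normSq (x - α) := by
    rw [div_eq_inv_mul, Complex.inv_def]
    simp [Complex.mul_re, Complex.mul_im]
    field_simp
    ring
  rw [key]
  apply div_pos _ hpos
  have : 0 < (- α.im) * ((x.re - ζ.re) ^ 2 + (x.im - ζ.im) ^ 2) := mul_pos (by linarith) hd
  positivity

theorem half_plane_sum (s : Multiset ℂ) (hs : s ≠ 0) (u x ζ : ℂ) (hx : 0 ≤ (u * x).im)
    (hζ : 0 ≤ (u * ζ).im) (hα : ∀ α ∈ s, (u * α).im < 0) :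
    (s.map (fun α => (ζ - α) / (x - α))).sum ≠ 0 := by
  have hne : ∀ α ∈ s, x - α ≠ 0 := by
    intro α h h0
    rw [sub_eq_zero.mp h0] at hx
    linarith [hα α h]
  by_cases h : x = ζ
  · subst h
    rw [Multiset.map_congr rfl (fun α h => div_self (hne α h))]
    simpa using hs
  · obtain ⟨a, ha⟩ := Multiset.exists_mem_of_ne_zero hs
    have hu : u ≠ 0 := by
      rintro rfl
      simpa using hα a ha
    have hne' : u * x ≠ u * ζ := fun h' => h (mul_left_cancel₀ hu h')
    intro h0
    have h1 : (s.map (fun α => (Complex.I * ((starRingEnd ℂ) (u * ζ) - u * x) *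
        ((u * ζ - u * α) / (u * x - u * α))).re)).sum = 0 := by
      have : (s.map (fun α => Complex.I * ((starRingEnd ℂ) (u * ζ) - u * x) *
        ((u * ζ - u * α) / (u * x - u * α)))).sum = 0 := by
        rw [Multiset.sum_map_mul_left]
        simp_rw [← mul_sub, mul_div_mul_left _ _ hu]
        rw [h0, mul_zero]
      have h2 := congrArg Complex.reAddGroupHom this
      rw [map_multiset_sum, Multiset.map_map] at h2
      simpa using h2
    obtain ⟨t, rfl⟩ := Multiset.exists_cons_of_mem ha
    rw [Multiset.map_cons, Multiset.sum_cons] at h1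
    have h3 := half_plane_term _ _ _ hx hζ (hα a ha) hne'
    have h4 : 0 ≤ (t.map (fun α => (Complex.I * ((starRingEnd ℂ) (u * ζ) - u * x) *
        ((u * ζ - u * α) / (u * x - u * α))).re)).sum := by
      apply Multiset.sum_nonneg
      intro y hy
      obtain ⟨α, hα', rfl⟩ := Multiset.mem_map.mp hy
      exact (half_plane_term _ _ _ hx hζ (hα α (Multiset.mem_cons_of_mem hα')) hne').le
    linarith

theorem polar_props (m : ℕ) (f : Polynomial ℂ) (hf : f.natDegree = m + 1) (u b z : ℂ)
    (hb : b ≠ 0) (hz : 0 ≤ (u * (z / b)).im) (hα : ∀ α ∈ f.roots, (u * α).im < 0) :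
    (C ((m + 1) * b) * f + (C z - C b * X) * derivative f).natDegree = m ∧
    C ((m + 1) * b) * f + (C z - C b * X) * derivative f ≠ 0 ∧
    ∀ α ∈ (C ((m + 1) * b) * f + (C z - C b * X) * derivative f).roots, (u * α).im < 0 := by
  have hsp : f.Splits := IsAlgClosed.splits f
  have hcard : f.roots.card = m + 1 := by rw [← hsp.natDegree_eq_card_roots, hf]
  have hs0 : f.roots ≠ 0 := by
    intro h; rw [h] at hcard; simp at hcard
  set g := (C ((m + 1) * b) * f + (C z - C b * X) * derivative f) with hg
  have h1 : ∀ j, g.coeff j =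
      b * (m + 1 - j) * f.coeff j + z * (j + 1) * f.coeff (j + 1) := by
    intro j
    rw [hg, sub_mul, coeff_add, coeff_sub, coeff_C_mul, coeff_C_mul, mul_assoc (C b), coeff_C_mul,
      coeff_derivative]
    cases j with
    | zero => rw [mul_coeff_zero, coeff_X_zero]; push_cast; ring
    | succ j => rw [coeff_X_mul, coeff_derivative]; push_cast; ring
  have hf0 : f ≠ 0 := by rintro rfl; simp at hf
  have hlc : f.coeff (m + 1) ≠ 0 := by
    rw [← hf]; exact leadingCoeff_ne_zero.mpr hf0
  have hsum : (f.roots.map (fun α => z / b - α)).sum ≠ 0 := by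
    intro h
    have h2 : (f.roots.map (fun α => (u * (z / b) - u * α).im)).sum = 0 := by
      have h3 := congrArg (fun w => Complex.imAddGroupHom (u * w)) h
      simp only [← Multiset.sum_map_mul_left] at h3
      rw [map_multiset_sum, Multiset.map_map] at h3
      simpa [mul_sub] using h3
    obtain ⟨a, ha⟩ := Multiset.exists_mem_of_ne_zero hs0
    obtain ⟨t, ht⟩ := Multiset.exists_cons_of_mem ha
    rw [ht, Multiset.map_cons, Multiset.sum_cons] at h2
    have h4 : 0 ≤ (t.map (fun α => (u * (z / b) - u * α).im)).sum := by
      apply Multiset.sum_nonneg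
      intro y hy
      obtain ⟨α, hα', rfl⟩ := Multiset.mem_map.mp hy
      have := hα α (by rw [ht]; exact Multiset.mem_cons_of_mem hα')
      rw [Complex.sub_im]; linarith
    have := hα a ha
    rw [Complex.sub_im] at h2; linarith
  have hcm : g.coeff m ≠ 0 := by
    have h5 := hsp.nextCoeff_eq_neg_sum_roots_mul_leadingCoeff
    rw [nextCoeff_of_natDegree_pos (by omega), leadingCoeff, hf, Nat.add_sub_cancel] at h5
    rw [h1, h5]
    have h6 : (f.roots.map (fun α => z / b - α)).sum = (m + 1) * (z / b) - f.roots.sum := by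
      rw [Multiset.sum_map_sub]; simp [hcard]; ring
    have : b * (m + 1 - m) * (-f.coeff (m + 1) * f.roots.sum) + z * (m + 1) * f.coeff (m + 1)
        = b * f.coeff (m + 1) * (f.roots.map (fun α => z / b - α)).sum := by
      rw [h6]; field_simp; ring
    rw [this]
    exact mul_ne_zero (mul_ne_zero hb hlc) hsum
  refine ⟨?_, fun h => hcm (by rw [h]; simp), ?_⟩
  · apply natDegree_eq_of_le_of_coeff_ne_zero _ hcm
    rw [natDegree_le_iff_coeff_eq_zero]
    intro j hj
    rw [h1, coeff_eq_zero_of_natDegree_lt (n := j + 1) (by omega)]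
    rcases Nat.eq_or_lt_of_le (Nat.succ_le_of_lt hj) with h | h
    · rw [← h]; push_cast; ring
    · rw [coeff_eq_zero_of_natDegree_lt (n := j) (by omega)]; ring
  · intro x hx
    by_contra hc
    push Not at hc
    have hfx : f.eval x ≠ 0 := by
      intro h
      have := hα x ((mem_roots hf0).mpr h)
      linarith
    have hgx : g.eval x = 0 := (mem_roots'.mp hx).2
    have h2 := hsp.eval_derivative_eq_eval_mul_sum hfx
    have h3 := half_plane_sum f.roots hs0 u x (z / b) hc hz hα
    apply h3
    have h4 : (f.roots.map (fun α => (z / b - α) / (x - α))).sum =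
        (m + 1) + (z / b - x) * (f.roots.map (fun α => 1 / (x - α))).sum := by
      rw [← Multiset.sum_map_mul_left]
      have : ((m : ℂ) + 1) = (f.roots.map (fun _ => (1 : ℂ))).sum := by simp [hcard, add_comm]
      rw [this, ← Multiset.sum_map_add]
      congr 1
      apply Multiset.map_congr rfl
      intro α ha
      have : x - α ≠ 0 := by
        intro h0
        rw [sub_eq_zero.mp h0] at hc
        linarith [hα α ha]
      field_simp
      ring
    rw [h4]
    rw [hg] at hgx
    simp only [eval_add, eval_mul, eval_sub, eval_C, eval_X] at hgx
    rw [h2] at hgx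
    apply mul_left_cancel₀ (mul_ne_zero hb hfx)
    rw [mul_zero, ← hgx]
    field_simp

theorem convVal_ne_zero (u : ℂ) (z : ℂ) (hz : 0 ≤ (u * z).im) (s : Multiset ℝ) :
    ∀ (f : Polynomial ℂ), (∀ b ∈ s, 0 < b) → f.natDegree = s.card → f ≠ 0 →
    (∀ α ∈ f.roots, (u * α).im < 0) →
    convVal s.card f ((s.map (fun b : ℝ => X - C (b : ℂ))).prod) z ≠ 0 := by
  induction s using Multiset.induction_on with
  | empty =>
    intro f _ hd hf _
    simp only [Multiset.card_zero] at hd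
    obtain ⟨c, rfl⟩ := natDegree_eq_zero.mp hd
    simpa [convVal] using hf
  | cons b s ih =>
    intro f hb hd hf hα
    rw [Multiset.card_cons] at hd ⊢
    rw [Multiset.map_cons, Multiset.prod_cons]
    have hb0 : 0 < b := hb b (Multiset.mem_cons_self _ _)
    have hr : ((s.map (fun b : ℝ => X - C (b : ℂ))).prod).natDegree ≤ s.card := by
      have := natDegree_multiset_prod_X_sub_C_eq_card (s.map (fun b : ℝ => (b : ℂ)))
      rw [Multiset.map_map, Multiset.card_map] at this
      exact this.le
    have hz' : 0 ≤ (u * (z / (b : ℂ))).im := by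
      rw [← mul_div_assoc, Complex.div_ofReal_im]
      positivity
    have hP := polar_props s.card f hd u b z (by exact_mod_cast hb0.ne') hz' hα
    intro h0
    have hst := convVal_step s.card f _ hr (b : ℂ) z
    rw [h0, mul_zero] at hst
    refine ih _ (fun b' h' => hb b' (Multiset.mem_cons_of_mem h')) hP.1 hP.2.1 hP.2.2 hst.symm

theorem coeff_ffMul (n : ℕ) (p q : Polynomial ℝ) (j : ℕ) : (ffMul n p q).coeff j =
    if j ≤ n then (-1) ^ (n - j) * ((n.choose j : ℝ))⁻¹ * p.coeff j * q.coeff j else 0 := by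
  have h : ffMul n p q = ∑ j ∈ Finset.range (n + 1),
      C ((-1) ^ (n - j) * ((n.choose j : ℝ))⁻¹ * p.coeff j * q.coeff j) * X ^ j := by
    rw [ffMul, ← Finset.sum_range_reflect]
    refine Finset.sum_congr rfl fun j hj => ?_
    have hj' : j ≤ n := by simpa [Nat.lt_succ_iff] using hj
    have e : n + 1 - 1 - j = n - j := by omega
    rw [e, Nat.sub_sub_self hj', Nat.choose_symm hj']
    congr 2
    unfold eCoeff
    rw [Nat.sub_sub_self hj']
    have : ((-1 : ℝ) ^ (n - j)) * (-1) ^ (n - j) = 1 := by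
      rw [← mul_pow]; simp
    linear_combination ((-1) ^ (n - j) * ((n.choose j : ℝ))⁻¹ * p.coeff j * q.coeff j) * this
  rw [h, finsetSum_coeff]
  simp only [coeff_C_mul_X_pow]
  rw [Finset.sum_ite_eq]
  simp

theorem natDegree_ffMul_le (n : ℕ) (p q : Polynomial ℝ) : (ffMul n p q).natDegree ≤ n := by
  rw [natDegree_le_iff_coeff_eq_zero]
  intro j hj
  rw [coeff_ffMul, if_neg (by omega)]

theorem convVal_map (n : ℕ) (p q : Polynomial ℝ) (z : ℂ) :
    convVal n (p.map Complex.ofRealHom) (q.map Complex.ofRealHom) z =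
      ((ffMul n p q).map Complex.ofRealHom).eval z := by
  rw [eval_eq_sum_range' (n := n + 1)
    (Nat.lt_succ_of_le (natDegree_map_le.trans (natDegree_ffMul_le n p q)))]
  unfold convVal
  refine Finset.sum_congr rfl fun j hj => ?_
  have hj' : j ≤ n := by simpa [Nat.lt_succ_iff] using hj
  simp only [coeff_map, coeff_ffMul, if_pos hj']
  simp

theorem convVal_add (n : ℕ) (f g q : Polynomial ℂ) (c z : ℂ) :
    convVal n (f + C c * g) q z = convVal n f q z + c * convVal n g q z := by
  unfold convVal
  rw [Finset.mul_sum, ← Finset.sum_add_distrib]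
  refine Finset.sum_congr rfl fun j _ => ?_
  rw [coeff_add, coeff_C_mul]; ring

/-- Monic polynomial with given roots. -/
noncomputable def mprod (s : Multiset ℝ) : Polynomial ℝ := (s.map (fun b => X - C b)).prod

theorem mprod_map (s : Multiset ℝ) : (mprod s).map Complex.ofRealHom =
    (s.map (fun b : ℝ => X - C (b : ℂ))).prod := by
  rw [mprod, Polynomial.map_multiset_prod, Multiset.map_map]
  simp

theorem mprod_monic (s : Multiset ℝ) : (mprod s).Monic := monic_multisetProd_X_sub_C s

theorem mprod_natDegree (s : Multiset ℝ) : (mprod s).natDegree = s.card :=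
  natDegree_multiset_prod_X_sub_C_eq_card s

theorem mprod_roots (s : Multiset ℝ) : (mprod s).roots = s := roots_multiset_prod_X_sub_C s

theorem mprod_splits (s : Multiset ℝ) : (mprod s).Splits := by
  rw [splits_iff_card_roots, mprod_roots, mprod_natDegree]

theorem ffMul_pos_roots (n : ℕ) (s t : Multiset ℝ) (hs : s.card = n) (ht : t.card = n)
    (hs0 : ∀ x ∈ s, 0 < x) (ht0 : ∀ x ∈ t, 0 < x) :
    (ffMul n (mprod s) (mprod t)).roots.card = n ∧
    ∀ x ∈ (ffMul n (mprod s) (mprod t)).roots, 0 < x := by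
  set P := ffMul n (mprod s) (mprod t) with hP
  have hcn : P.coeff n = 1 := by
    rw [hP, coeff_ffMul, if_pos le_rfl]
    have h1 : (mprod s).coeff n = 1 := by
      have := (mprod_monic s).coeff_natDegree
      rwa [mprod_natDegree, hs] at this
    have h2 : (mprod t).coeff n = 1 := by
      have := (mprod_monic t).coeff_natDegree
      rwa [mprod_natDegree, ht] at this
    simp [h1, h2]
  have hdeg : P.natDegree = n :=
    natDegree_eq_of_le_of_coeff_ne_zero (natDegree_ffMul_le _ _ _) (by rw [hcn]; simp)
  have key : ∀ z : ℂ, (P.map Complex.ofRealHom).eval z = 0 → z.im = 0 ∧ 0 < z.re := by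
    intro z hz
    by_contra hc
    set u : ℂ := ⟨z.re / z.im, -1⟩ with hu
    rw [hP, ← convVal_map, mprod_map t] at hz
    have hroots : ((mprod s).map Complex.ofRealHom).roots = s.map Complex.ofRealHom := by
      rw [(mprod_splits s).roots_map, mprod_roots]
    have := convVal_ne_zero u z ?_ t ((mprod s).map Complex.ofRealHom) ht0 ?_ ?_ ?_
    · rw [ht] at this
      exact this hz
    · simp only [hu, Complex.mul_im]
      by_cases hi : z.im = 0
      · have : z.re ≤ 0 := by
          by_contra h; exact hc ⟨hi, not_le.mp h⟩
        rw [hi]; simp; linarith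
      · rw [div_mul_cancel₀ _ hi]; simp
    · rw [natDegree_map, mprod_natDegree, hs, ht]
    · exact ((mprod_monic s).map _).ne_zero
    · rw [hroots]
      intro α hα
      obtain ⟨a, ha, rfl⟩ := Multiset.mem_map.mp hα
      have := hs0 a ha
      simp [hu, Complex.mul_im, this]
  have hP0 : P ≠ 0 := by rintro h; rw [h] at hcn; simp at hcn
  refine ⟨?_, ?_⟩
  · rw [← hdeg, ← splits_iff_card_roots]
    apply Splits.of_splits_map Complex.ofRealHom (IsAlgClosed.splits _)
    intro z hz
    have := key z (mem_roots'.mp hz).2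
    exact ⟨z.re, Complex.ext (by simp) (by simp [this.1])⟩
  · intro x hx
    have h1 : P.eval x = 0 := (mem_roots'.mp hx).2
    have := key (x : ℂ) (by
      have h2 : (x : ℂ) = Complex.ofRealHom x := rfl
      rw [h2, eval_map_apply, h1]; simp)
    simpa using this.2

theorem hb_lemma (S : Finset ℝ) (G : Polynomial ℝ) (hG : G.natDegree ≤ S.card)
    (hpos : ∀ α ∈ S, 0 < G.eval α / ∏ β ∈ S.erase α, (α - β)) (z : ℂ) (hz : 0 ≤ z.im) :
    ((mprod S.val).map Complex.ofRealHom + C Complex.I * G.map Complex.ofRealHom).eval z ≠ 0 := by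
  have hpS : mprod S.val = ∏ α ∈ S, (X - C α) := rfl
  have hpe : ((mprod S.val).map Complex.ofRealHom).eval z = ∏ α ∈ S, (z - (α : ℂ)) := by
    rw [hpS, Polynomial.map_prod, eval_prod]
    simp
  by_cases hex : ∃ α ∈ S, z = (α : ℂ)
  · obtain ⟨α, hα, rfl⟩ := hex
    have h0 : ∏ β ∈ S, ((α : ℂ) - (β : ℂ)) = 0 := Finset.prod_eq_zero hα (sub_self _)
    rw [eval_add, eval_mul, eval_C, hpe, h0, zero_add]
    have h2 : (α : ℂ) = Complex.ofRealHom α := rfl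
    rw [h2, eval_map_apply]
    apply mul_ne_zero Complex.I_ne_zero
    intro h
    have h3 : G.eval α = 0 := by simpa using h
    have := hpos α hα
    rw [h3] at this; simp at this
  · push Not at hex
    have hne : ∀ α ∈ S, z - (α : ℂ) ≠ 0 := fun α hα => sub_ne_zero.mpr (hex α hα)
    set g := G.coeff S.card with hg
    have hdeg : (G - C g * mprod S.val).degree < S.card := by
      rw [degree_lt_iff_coeff_zero]
      intro m hm
      have hmd : (mprod S.val).natDegree = S.card := mprod_natDegree _
      rcases Nat.eq_or_lt_of_le hm with h | h
      · rw [← h, coeff_sub, coeff_C_mul]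
        have := (mprod_monic S.val).coeff_natDegree
        rw [hmd] at this
        rw [this, ← hg]; ring
      · rw [coeff_sub, coeff_C_mul, coeff_eq_zero_of_natDegree_lt (lt_of_le_of_lt hG h),
          coeff_eq_zero_of_natDegree_lt (by omega)]
        ring
    have hint := Lagrange.eq_interpolate (s := S) (v := id) (Function.injective_id.injOn) hdeg
    rw [Lagrange.interpolate_eq_sum] at hint
    have hev : ∀ α ∈ S, (G - C g * mprod S.val).eval α = G.eval α := by
      intro α hα
      have : (mprod S.val).eval α = 0 := by
        rw [hpS, eval_prod]
        exact Finset.prod_eq_zero hα (by simp)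
      rw [eval_sub, eval_mul, this]; ring
    have hGz : (G.map Complex.ofRealHom).eval z = (∏ α ∈ S, (z - (α : ℂ))) *
        ((g : ℂ) + ∑ α ∈ S, ((G.eval α / ∏ β ∈ S.erase α, (α - β) : ℝ) : ℂ) / (z - α)) := by
      have h1 : G = C g * mprod S.val + ∑ α ∈ S,
          C (G.eval α / ∏ β ∈ S.erase α, (α - β)) * ∏ β ∈ S.erase α, (X - C β) := by
        rw [← sub_eq_iff_eq_add']
        rw [hint]
        refine Finset.sum_congr rfl fun α hα => ?_
        simp only [id]
        rw [hev α hα]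
      conv_lhs => rw [h1]
      rw [Polynomial.map_add, eval_add, Polynomial.map_mul, eval_mul, hpe, mul_add,
        Polynomial.map_sum, eval_finsetSum, Finset.mul_sum]
      congr 1
      · simp [mul_comm]
      · refine Finset.sum_congr rfl fun α hα => ?_
        rw [Polynomial.map_mul, eval_mul, Polynomial.map_prod, eval_prod, ← Finset.mul_prod_erase S _ hα]
        have := hne α hα
        simp only [Polynomial.map_sub, map_X, map_C, eval_sub, eval_X, eval_C]
        simp only [Complex.ofRealHom_eq_coe]
        field_simp
    rw [eval_add, eval_mul, eval_C, hpe, hGz]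
    set W : ℂ := ((g : ℂ) + ∑ α ∈ S, ((G.eval α / ∏ β ∈ S.erase α, (α - β) : ℝ) : ℂ) / (z - α)) with hW
    have hWim : W.im ≤ 0 := by
      rw [hW, Complex.add_im, Complex.ofReal_im, zero_add, Complex.im_sum]
      apply Finset.sum_nonpos
      intro α hα
      rw [Complex.div_im]
      have h1 := hpos α hα
      set w := G.eval α / ∏ β ∈ S.erase α, (α - β)
      rw [Complex.ofReal_im, Complex.ofReal_re, Complex.sub_im, Complex.ofReal_im, sub_zero,
        zero_mul, zero_div, zero_sub, neg_nonpos]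
      exact div_nonneg (mul_nonneg h1.le hz) (Complex.normSq_nonneg _)
    have : (∏ α ∈ S, (z - (α : ℂ))) + Complex.I * ((∏ α ∈ S, (z - (α : ℂ))) * W) =
        (∏ α ∈ S, (z - (α : ℂ))) * (1 + Complex.I * W) := by ring
    rw [this]
    apply mul_ne_zero (Finset.prod_ne_zero_iff.mpr hne)
    intro h
    have := congrArg Complex.re h
    simp at this
    linarith

theorem no_common (n : ℕ) (S : Finset ℝ) (t : Multiset ℝ) (hS : S.card = n) (ht : t.card = n)
    (ht0 : ∀ x ∈ t, 0 < x) (G : Polynomial ℝ) (hG : G.natDegree ≤ n)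
    (hpos : ∀ α ∈ S, 0 < G.eval α / ∏ β ∈ S.erase α, (α - β)) (x : ℝ)
    (h1 : (ffMul n (mprod S.val) (mprod t)).eval x = 0) : (ffMul n G (mprod t)).eval x ≠ 0 := by
  intro h2
  set f := (mprod S.val).map Complex.ofRealHom + C Complex.I * G.map Complex.ofRealHom with hf
  have hmd : (mprod S.val).natDegree = n := by rw [mprod_natDegree]; exact hS
  have hcn : f.coeff n ≠ 0 := by
    have := (mprod_monic S.val).coeff_natDegree
    rw [hmd] at this
    rw [hf, coeff_add, coeff_C_mul, coeff_map, coeff_map, this]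
    intro h
    have := congrArg Complex.re h
    simp at this
  have hfd : f.natDegree = n := by
    apply natDegree_eq_of_le_of_coeff_ne_zero _ hcn
    rw [hf]
    apply natDegree_add_le_of_degree_le
    · rw [natDegree_map, hmd]
    · exact (natDegree_C_mul_le _ _).trans (natDegree_map_le.trans hG)
  have := convVal_ne_zero 1 (x : ℂ) (by simp) t f ht0 (by rw [hfd, ht])
    (by rintro h; rw [h] at hcn; simp at hcn) (by
      intro α hα
      rw [one_mul]
      by_contra hc
      exact hb_lemma S G (by rw [hS]; exact hG) hpos α (not_lt.mp hc) (mem_roots'.mp hα).2)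
  apply this
  rw [ht, ← mprod_map t, hf, convVal_add, convVal_map, convVal_map]
  have e : (x : ℂ) = Complex.ofRealHom x := rfl
  rw [e, eval_map_apply, eval_map_apply, h1, h2]
  simp

/-- the logarithmic mesh does not decrease under the multiplicative finite free
convolution of polynomials with positive roots. -/
theorem ffMul_lmesh (n : ℕ) (hn : 2 ≤ n) (p q : Polynomial ℝ)
    (hpd : p.natDegree = n) (hqd : q.natDegree = n)
    (hp : RealRooted p) (hq : RealRooted q)
    (hp0 : ∀ x ∈ p.roots, 0 < x) (hq0 : ∀ x ∈ q.roots, 0 < x) :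
    lmesh n p ≤ lmesh n (ffMul n p q) := by
  have hp' : p = C p.leadingCoeff * mprod p.roots :=
    (splits_iff_card_roots.mpr hp).eq_prod_roots
  have hq' : q = C q.leadingCoeff * mprod q.roots :=
    (splits_iff_card_roots.mpr hq).eq_prod_roots
  have hp00 : p ≠ 0 := by rintro rfl; simp at hpd; omega
  have hq00 : q ≠ 0 := by rintro rfl; simp at hqd; omega
  have hpa : p.leadingCoeff ≠ 0 := leadingCoeff_ne_zero.mpr hp00
  have hqa : q.leadingCoeff ≠ 0 := leadingCoeff_ne_zero.mpr hq00
  have hps : p.roots.card = n := hp.trans hpd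
  have hqs : q.roots.card = n := hq.trans hqd
  have hroots : (ffMul n p q).roots = (ffMul n (mprod p.roots) (mprod q.roots)).roots := by
    have : ffMul n p q = C (p.leadingCoeff * q.leadingCoeff) *
        ffMul n (mprod p.roots) (mprod q.roots) := by
      ext j
      rw [coeff_C_mul, coeff_ffMul, coeff_ffMul]
      split_ifs
      · conv_lhs => rw [hp', hq']
        rw [coeff_C_mul, coeff_C_mul]; ring
      · simp
    rw [this, roots_C_mul _ (mul_ne_zero hpa hqa)]
  set s := p.roots with hs
  set t := q.roots with ht
  set P := ffMul n (mprod s) (mprod t) with hP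
  obtain ⟨hPc, hP0⟩ := ffMul_pos_roots n s t hps hqs hp0 hq0
  -- work with the sorted lists
  have hLp : (sroots p).length = n := by rw [sroots, Multiset.length_sort, ← hs, hps]
  have hLP : (sroots (ffMul n p q)).length = n := by
    rw [sroots, Multiset.length_sort, hroots, hPc]
  have hmp : ∀ x, x ∈ sroots p ↔ x ∈ s := fun x => by rw [sroots, Multiset.mem_sort]
  have hmP : ∀ x, x ∈ sroots (ffMul n p q) ↔ x ∈ P.roots := fun x => by
    rw [sroots, Multiset.mem_sort, hroots]
  have hsp : (sroots p).Pairwise (· ≤ ·) := Multiset.pairwise_sort _ _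
  have hsP : (sroots (ffMul n p q)).Pairwise (· ≤ ·) := Multiset.pairwise_sort _ _
  have hcoe : ((sroots p : List ℝ) : Multiset ℝ) = s := Multiset.sort_eq _ _
  have hcoeP : ((sroots (ffMul n p q) : List ℝ) : Multiset ℝ) = P.roots := by
    rw [← hroots]; exact Multiset.sort_eq _ _
  unfold lmesh
  set L := sroots p with hL
  set M := sroots (ffMul n p q) with hM
  set c := sInf {d : ℝ | ∃ k : ℕ, k + 1 < n ∧ d = L.getD (k + 1) 0 / L.getD k 0} with hc
  refine le_csInf (Set.nonempty_of_mem ⟨0, by omega, rfl⟩) ?_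
  rintro d ⟨k, hk, rfl⟩
  rw [List.getD_eq_getElem _ _ (by omega), List.getD_eq_getElem _ _ (by omega)]
  have hx0 : 0 < M[k] := hP0 _ ((hmP _).mp (List.getElem_mem _))
  have hxy : M[k] ≤ M[k + 1] := List.pairwise_iff_getElem.mp hsP _ _ _ _ (by omega)
  rcases le_or_gt c 1 with hc1 | hc1
  · exact hc1.trans ((one_le_div hx0).mpr hxy)
  have hstep : ∀ i (hi : i + 1 < L.length), c * L[i] ≤ L[i + 1] := by
    intro i hi
    have hpos : 0 < L[i] := hp0 _ ((hmp _).mp (List.getElem_mem _))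
    rw [← le_div_iff₀ hpos]
    apply csInf_le
    · refine ⟨0, ?_⟩
      rintro d ⟨k, hk, rfl⟩
      rw [List.getD_eq_getElem _ _ (by omega), List.getD_eq_getElem _ _ (by omega)]
      exact div_nonneg (hp0 _ ((hmp _).mp (List.getElem_mem _))).le
        (hp0 _ ((hmp _).mp (List.getElem_mem _))).le
    · refine ⟨i, by omega, ?_⟩
      rw [List.getD_eq_getElem _ _ (by omega), List.getD_eq_getElem _ _ (by omega)]
  have hpair : L.Pairwise (fun a b => c * a ≤ b) := by
    rw [List.pairwise_iff_getElem]
    intro i j hi hj hij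
    refine (hstep i (by omega)).trans ?_
    rcases Nat.eq_or_lt_of_le (Nat.succ_le_of_lt hij) with h | h
    · subst h; exact le_rfl
    · exact List.pairwise_iff_getElem.mp hsp _ _ _ _ h
  have hLpos : ∀ a ∈ L, 0 < a := fun a ha => hp0 a ((hmp a).mp ha)
  have hLlt : L.Pairwise (· < ·) := by
    refine List.Pairwise.imp_of_mem ?_ hpair
    intro a b ha _ h
    nlinarith [hLpos a ha]
  have hnod : s.Nodup := by
    rw [← hcoe, Multiset.coe_nodup]
    exact hLlt.imp (fun h => h.ne)
  have hsep : ∀ a ∈ s, ∀ b ∈ s, a < b → c * a ≤ b := by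
    intro a ha b hb hab
    obtain ⟨i, hi, rfl⟩ := List.mem_iff_getElem.mp ((hmp a).mpr ha)
    obtain ⟨j, hj, rfl⟩ := List.mem_iff_getElem.mp ((hmp b).mpr hb)
    have hij : i < j := by
      by_contra hc
      rcases Nat.eq_or_lt_of_le (not_lt.mp hc) with h | h
      · subst h; exact lt_irrefl _ hab
      · exact absurd (List.pairwise_iff_getElem.mp hLlt _ _ hj hi h) (not_lt.mpr hab.le)
    exact List.pairwise_iff_getElem.mp hpair _ _ _ _ hij
  set S : Finset ℝ := ⟨s, hnod⟩ with hS
  have hScard : S.card = n := hps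
  have hPn0 : P ≠ 0 := by
    intro h; rw [← hP, h] at hPc; simp at hPc; omega
  have hdervanish : ∀ x, P.eval x = 0 → (X * derivative P).eval x ≠ 0 := by
    intro x hx
    have e : X * derivative P = ffMul n (X * derivative (mprod s)) (mprod t) := by
      ext j
      have hco : ∀ (r : Polynomial ℝ), (X * derivative r).coeff j = j * r.coeff j := by
        intro r
        cases j with
        | zero => rw [mul_coeff_zero, coeff_X_zero]; simp
        | succ j => rw [coeff_X_mul, coeff_derivative]; push_cast; ring
      rw [hco, hP, coeff_ffMul, coeff_ffMul, hco]
      split_ifs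
      · ring
      · simp
    rw [e]
    refine no_common n S t hScard hqs hq0 _ ?_ ?_ x hx
    · refine natDegree_mul_le.trans ?_
      have h1 := natDegree_derivative_le (mprod s)
      rw [mprod_natDegree, hps] at h1
      rw [natDegree_X]; omega
    · intro α hα
      have h1 : (derivative (mprod s)).eval α = ∏ β ∈ S.erase α, (α - β) := by
        have := Lagrange.eval_nodal_derivative_eval_node_eq (s := S) (v := id) hα
        rw [Lagrange.eval_nodal] at this
        exact this
      rw [eval_mul, eval_X, h1, mul_div_assoc, div_self, mul_one]
      · exact hp0 α hα
      · rw [Finset.prod_ne_zero_iff]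
        intro β hβ
        exact sub_ne_zero.mpr (Finset.ne_of_mem_erase hβ).symm
  have hPnod : P.roots.Nodup := by
    rw [Multiset.nodup_iff_count_le_one]
    intro x
    by_contra hc
    rw [count_roots] at hc
    have h1 : 1 < P.rootMultiplicity x := not_le.mp hc
    rw [one_lt_rootMultiplicity_iff_isRoot hPn0] at h1
    apply hdervanish x h1.1
    rw [eval_mul, h1.2.eq_zero]
    simp
  have hMnod : M.Nodup := by
    rw [← Multiset.coe_nodup, hcoeP]; exact hPnod
  have hxy' : M[k] < M[k + 1] := by
    refine lt_of_le_of_ne hxy ?_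
    intro h
    have := (List.Nodup.getElem_inj_iff hMnod).mp h
    omega
  by_contra hlt
  push Not at hlt
  set r := M[k + 1] / M[k] with hr
  have hr1 : 1 < r := (one_lt_div hx0).mpr hxy'
  have hrx : r * M[k] = M[k + 1] := div_mul_cancel₀ _ hx0.ne'
  have hev : ∀ i (hi : i < M.length), P.eval M[i] = 0 := fun i hi =>
    (mem_roots'.mp ((hmP _).mp (List.getElem_mem hi))).2
  have e : P.comp (C r * X) = ffMul n ((mprod s).comp (C r * X)) (mprod t) := by
    ext j
    rw [comp_C_mul_X_coeff, hP, coeff_ffMul, coeff_ffMul, comp_C_mul_X_coeff]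
    split_ifs
    · ring
    · simp
  refine no_common n S t hScard hqs hq0 ((mprod s).comp (C r * X)) ?_ ?_ M[k] (hev k (by omega)) ?_
  · refine natDegree_comp_le.trans ?_
    rw [mprod_natDegree, hps]
    have : (C r * X).natDegree ≤ 1 := (natDegree_C_mul_le _ _).trans natDegree_X_le
    nlinarith
  · intro α hα
    have hα0 : 0 < α := hp0 α hα
    have h1 : ((mprod s).comp (C r * X)).eval α = ∏ β ∈ S, (r * α - β) := by
      have h2 : mprod s = ∏ β ∈ S, (X - C β) := rfl
      rw [eval_comp, h2, eval_prod]; simp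
    rw [h1, ← Finset.mul_prod_erase S _ hα, mul_div_assoc, ← Finset.prod_div_distrib]
    apply mul_pos
    · nlinarith
    · apply Finset.prod_pos
      intro β hβ
      have hβS : β ∈ s := Finset.mem_of_mem_erase hβ
      rcases lt_or_gt_of_ne (Finset.ne_of_mem_erase hβ) with h | h
      · apply div_pos <;> nlinarith
      · have := hsep α hα β hβS h
        apply div_pos_of_neg_of_neg <;> nlinarith
  · rw [← e, eval_comp, eval_mul, eval_C, eval_X, hrx]
    exact hev _ (by omega)
end

section
/- Let n be a positive integer, i, j ≥ 0, and let a = (a_1,…,a_i), b = (b_1,…,b_j) be tuples of real parameters with b_1,…,b_j > 0 and a_1,…,a_i < -n+1. Then all roots of p(x) = ₍i+1₎𝓕_j(-n, a; b; x) are real and have the same sign: all roots are positive if i is even, and all roots are negative if i is odd. Furthermore, if 0 ≤ t ≤ 2 and i is even, then ₍i+1₎𝓕_j(-n, a; b_1, b_2, …, b_j; x) ⪯ ₍i+1₎𝓕_j(-n, a; b_1+t, b_2, …, b_j; x) and ₍i+1₎𝓕_j(-n, a_1-t, a_2, …, a_i; b; x) ⪯ ₍i+1₎𝓕_j(-n,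 a_1, …, a_i; b; x); if i is odd, both interlacings are reversed. -/
open Polynomial

section
open Finset
noncomputable def lam (p : ℝ[X]) (k : ℕ) : ℝ := (sroots p).getD k 0

lemma mono_of_step {n : ℕ} {v : ℕ → ℝ} (hv : ∀ k, k + 1 < n → v k ≤ v (k+1)) :
    ∀ a b, a ≤ b → b < n → v a ≤ v b := by
  intro a b hab
  induction b, hab using Nat.le_induction with
  | base => intro _; exact le_rfl
  | succ b hab ih => intro h; exact (ih (by omega)).trans (hv b h)

lemma repr_roots {n : ℕ} {c : ℝ} (hc : c ≠ 0) (v : ℕ → ℝ) :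
    (C c * ∏ k ∈ range n, (X - C (v k))).roots = (range n).val.map v := by
  rw [roots_C_mul _ hc, Polynomial.roots_prod]
  · simp
  · exact Finset.prod_ne_zero_iff.mpr fun k _ => X_sub_C_ne_zero _

lemma repr_natDegree {n : ℕ} {c : ℝ} (hc : c ≠ 0) (v : ℕ → ℝ) :
    (C c * ∏ k ∈ range n, (X - C (v k))).natDegree = n := by
  rw [natDegree_C_mul hc, natDegree_prod_of_monic _ _ (fun k _ => monic_X_sub_C _)]
  simp

lemma repr_leadingCoeff {n : ℕ} {c : ℝ} (v : ℕ → ℝ) :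
    (C c * ∏ k ∈ range n, (X - C (v k))).leadingCoeff = c := by
  rw [leadingCoeff_mul, leadingCoeff_prod]
  simp

lemma repr_lam {n : ℕ} {c : ℝ} (hc : c ≠ 0) (v : ℕ → ℝ)
    (hv : ∀ k, k + 1 < n → v k ≤ v (k+1)) {p : ℝ[X]}
    (hp : p = C c * ∏ k ∈ range n, (X - C (v k))) :
    RealRooted p ∧ p.natDegree = n ∧ ∀ k < n, lam p k = v k := by
  have h2 : p.natDegree = n := by rw [hp, repr_natDegree hc]
  have h1 : p.roots = (range n).val.map v := by rw [hp, repr_roots hc]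
  refine ⟨?_, h2, ?_⟩
  · unfold RealRooted; rw [h2, h1]; simp
  · have : sroots p = (List.range n).map v := by
      unfold sroots
      apply List.Perm.eq_of_pairwise (le := (· ≤ ·))
      · intro a b _ _ h1 h2; exact le_antisymm h1 h2
      · exact Multiset.pairwise_sort _ _
      · rw [List.pairwise_map]
        refine (List.pairwise_lt_range (n := n)).imp_of_mem ?_
        intro a b ha hb hab
        exact mono_of_step hv a b hab.le (by simpa using hb)
      · rw [← Multiset.coe_eq_coe, Multiset.sort_eq, h1]; rfl
    intro k hk
    unfold lam; rw [this]
    simp [hk]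

lemma sroots_length {n : ℕ} {p : ℝ[X]} (hr : RealRooted p) (hn : p.natDegree = n) :
    (sroots p).length = n := by
  unfold sroots; rw [Multiset.length_sort, hr, hn]

lemma lam_mem {n : ℕ} {p : ℝ[X]} (hr : RealRooted p) (hn : p.natDegree = n) {k : ℕ} (hk : k < n) :
    lam p k ∈ p.roots := by
  have hl := sroots_length hr hn
  unfold lam
  rw [List.getD_eq_getElem _ _ (by omega)]
  rw [← Multiset.mem_sort (r := (· ≤ ·))]
  exact List.getElem_mem _

lemma repr_of {n : ℕ} {p : ℝ[X]} (hr : RealRooted p) (hn : p.natDegree = n) :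
    (p = C p.leadingCoeff * ∏ k ∈ range n, (X - C (lam p k))) ∧
    (∀ k, k + 1 < n → lam p k ≤ lam p (k+1)) ∧ (∀ k, n ≤ k → lam p k = 0) := by
  have hl := sroots_length hr hn
  refine ⟨?_, ?_, ?_⟩
  · have h := (splits_iff_card_roots.mpr hr).eq_prod_roots
    conv_lhs => rw [h]
    congr 1
    have : p.roots = (range n).val.map (lam p) := by
      rw [← Multiset.sort_eq p.roots (· ≤ ·)]
      change ((sroots p : List ℝ) : Multiset ℝ) = ((List.range n).map (lam p) : List ℝ)
      congr 1
      apply List.ext_getElem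
      · simp [hl]
      · intro i h1 h2
        simp [lam, h1]
    rw [this]
    simp
    rfl
  · intro k hk
    unfold lam
    rw [List.getD_eq_getElem _ _ (by omega), List.getD_eq_getElem _ _ (by omega)]
    have := Multiset.pairwise_sort p.roots (· ≤ ·)
    exact List.pairwise_iff_getElem.mp this k (k+1) (by change k < (sroots p).length; omega) (by change k+1 < (sroots p).length; omega) (by omega)
  · intro k hk
    unfold lam
    exact List.getD_eq_default _ _ (by omega)

lemma lam_C_mul {c : ℝ} (hc : c ≠ 0) (p : ℝ[X]) : lam (C c * p) = lam p := by
  unfold lam sroots; rw [roots_C_mul _ hc]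

lemma realRooted_C_mul {c : ℝ} (hc : c ≠ 0) {p : ℝ[X]} (h : RealRooted (C c * p)) : RealRooted p := by
  unfold RealRooted at *; rwa [roots_C_mul _ hc, natDegree_C_mul hc] at h

open Filter Topology in
/-- limit lemma -/
lemma limit_pair {n : ℕ} (S : Set ((ℕ → ℝ) × (ℕ → ℝ))) (hS : IsClosed S)
    {q r : ℝ[X]} (Q R : ℕ → ℝ[X])
    (hq : q.natDegree = n) (hr : r.natDegree = n) (hq0 : q ≠ 0) (hr0 : r ≠ 0)
    (hQ : ∀ N, RealRooted (Q N) ∧ (Q N).natDegree = n)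
    (hR : ∀ N, RealRooted (R N) ∧ (R N).natDegree = n)
    (hQc : Tendsto (fun N => (Q N).leadingCoeff) atTop (𝓝 q.leadingCoeff))
    (hRc : Tendsto (fun N => (R N).leadingCoeff) atTop (𝓝 r.leadingCoeff))
    (hQe : ∀ z : ℂ, Tendsto (fun N => aeval z (Q N)) atTop (𝓝 (aeval z q)))
    (hRe : ∀ z : ℂ, Tendsto (fun N => aeval z (R N)) atTop (𝓝 (aeval z r)))
    (hQR : ∀ N, (lam (Q N), lam (R N)) ∈ S) :
    RealRooted q ∧ RealRooted r ∧ ∃ vw ∈ S, (∀ k < n, lam q k = vw.1 k) ∧ (∀ k < n, lam r k = vw.2 k) := by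
  -- boundedness
  have bound : ∀ (q : ℝ[X]) (Q : ℕ → ℝ[X]), q ≠ 0 → (∀ N, RealRooted (Q N) ∧ (Q N).natDegree = n) →
      Tendsto (fun N => (Q N).leadingCoeff) atTop (𝓝 q.leadingCoeff) →
      (∀ z : ℂ, Tendsto (fun N => aeval z (Q N)) atTop (𝓝 (aeval z q))) →
      ∃ M, ∀ᶠ N in atTop, ∀ k, lam (Q N) k ∈ Set.Icc (-M) M := by
    intro q Q hq0 hQ hQc hQe
    have hlc : q.leadingCoeff ≠ 0 := leadingCoeff_ne_zero.mpr hq0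
    have h1 : Tendsto (fun N => ‖aeval Complex.I (Q N)‖ / |(Q N).leadingCoeff|) atTop
        (𝓝 (‖aeval Complex.I q‖ / |q.leadingCoeff|)) :=
      (hQe Complex.I).norm.div hQc.abs (by simpa using hlc)
    set M := ‖aeval Complex.I q‖ / |q.leadingCoeff| + 1 with hM
    refine ⟨M, ?_⟩
    have h2 := h1.eventually (gt_mem_nhds (show _ < M by rw [hM]; linarith))
    have h3 := hQc.eventually_ne hlc
    filter_upwards [h2, h3] with N hN hN3 k
    obtain ⟨hrep, -, hz⟩ := repr_of (hQ N).1 (hQ N).2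
    have hM0 : 0 ≤ M := by positivity
    by_cases hk : n ≤ k
    · rw [hz k hk]; exact ⟨by linarith, hM0⟩
    have hnorm : ‖aeval Complex.I (Q N)‖ / |(Q N).leadingCoeff| = ∏ k ∈ range n, ‖Complex.I - (lam (Q N) k : ℂ)‖ := by
      have hh : aeval Complex.I (Q N) = ((Q N).leadingCoeff : ℂ) * ∏ k ∈ range n, (Complex.I - (lam (Q N) k : ℂ)) := by
        conv_lhs => rw [hrep]
        simp [map_prod]
      rw [hh, norm_mul, norm_prod]
      simp
      field_simp
    have hge1 : ∀ x : ℝ, 1 ≤ ‖Complex.I - (x : ℂ)‖ := by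
      intro x
      have := Complex.abs_im_le_norm (Complex.I - (x : ℂ))
      simpa using this
    have hge : ∀ x : ℝ, |x| ≤ ‖Complex.I - (x : ℂ)‖ := by
      intro x
      have := Complex.abs_re_le_norm (Complex.I - (x : ℂ))
      simpa using this
    have : |lam (Q N) k| ≤ M := by
      refine (hge _).trans (le_trans ?_ hN.le)
      rw [hnorm]
      have hmem : k ∈ range n := by simp; omega
      rw [← Finset.mul_prod_erase _ _ hmem]
      have : (1:ℝ) ≤ ∏ x ∈ (range n).erase k, ‖Complex.I - (lam (Q N) x : ℂ)‖ :=
        Finset.prod_induction _ (fun x => (1:ℝ) ≤ x) (fun a b => one_le_mul_of_one_le_of_one_le) le_rfl fun i _ => hge1 _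
      nlinarith [norm_nonneg (Complex.I - (lam (Q N) k : ℂ))]
    exact abs_le.mp this
  obtain ⟨M1, hM1⟩ := bound q Q hq0 hQ hQc hQe
  obtain ⟨M2, hM2⟩ := bound r R hr0 hR hRc hRe
  obtain ⟨N0, hN0⟩ := eventually_atTop.mp (hM1.and hM2)
  have hK : IsCompact ((Set.pi Set.univ (fun _ : ℕ => Set.Icc (-M1) M1)) ×ˢ (Set.pi Set.univ (fun _ : ℕ => Set.Icc (-M2) M2))) :=
    (isCompact_univ_pi fun _ => isCompact_Icc).prod (isCompact_univ_pi fun _ => isCompact_Icc)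
  obtain ⟨⟨v, w⟩, -, φ, hφ, hlim⟩ := hK.tendsto_subseq (x := fun N => (lam (Q (N + N0)), lam (R (N + N0))))
    (fun N => ⟨fun k _ => (hN0 (N+N0) (by omega)).1 k, fun k _ => (hN0 (N+N0) (by omega)).2 k⟩)
  have hsub : Tendsto (fun N => φ N + N0) atTop atTop :=
    tendsto_atTop_mono (fun N => Nat.le_add_right _ _) hφ.tendsto_atTop
  have hlim1 := (continuous_fst.tendsto _).comp hlim
  have hlim2 := (continuous_snd.tendsto _).comp hlim
  have fin : ∀ (q : ℝ[X]) (Q : ℕ → ℝ[X]) (v : ℕ → ℝ), q ≠ 0 → (∀ N, RealRooted (Q N) ∧ (Q N).natDegree = n) →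
      Tendsto (fun N => (Q N).leadingCoeff) atTop (𝓝 q.leadingCoeff) →
      (∀ z : ℂ, Tendsto (fun N => aeval z (Q N)) atTop (𝓝 (aeval z q))) →
      (∀ k, Tendsto (fun N => lam (Q (φ N + N0)) k) atTop (𝓝 (v k))) →
      RealRooted q ∧ ∀ k < n, lam q k = v k := by
    intro q Q v hq0 hQ hQc hQe hv
    have hlc : q.leadingCoeff ≠ 0 := leadingCoeff_ne_zero.mpr hq0
    have hmono : ∀ k, k + 1 < n → v k ≤ v (k+1) := fun k hk =>
      le_of_tendsto_of_tendsto' (hv k) (hv (k+1)) fun N => (repr_of (hQ _).1 (hQ _).2).2.1 k hk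
    have hp : q = C q.leadingCoeff * ∏ k ∈ range n, (X - C (v k)) := by
      apply Polynomial.funext
      intro x
      have e1 := (hQe x).comp hsub
      have e2 : Tendsto (fun N => ((Q (φ N + N0)).leadingCoeff * ∏ k ∈ range n, (x - lam (Q (φ N + N0)) k) : ℝ)) atTop
          (𝓝 (q.leadingCoeff * ∏ k ∈ range n, (x - v k))) :=
        (hQc.comp hsub).mul (tendsto_finsetProd _ fun k _ => (hv k).const_sub x)
      have e3 : Tendsto (fun N => (Q (φ N + N0)).eval x) atTop (𝓝 (q.eval x)) := by
        have := (Complex.continuous_re.tendsto _).comp e1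
        have hx : ∀ p : ℝ[X], (aeval (x : ℂ) p).re = p.eval x := by
          intro p
          have := aeval_algebraMap_apply_eq_algebraMap_eval (A := ℂ) x p
          rw [Complex.coe_algebraMap] at this
          rw [this, Complex.ofReal_re]
        simpa [Function.comp_def, hx] using this
      have e4 : (fun N => (Q (φ N + N0)).eval x) = (fun N => ((Q (φ N + N0)).leadingCoeff * ∏ k ∈ range n, (x - lam (Q (φ N + N0)) k) : ℝ)) := by
        funext N
        conv_lhs => rw [(repr_of (hQ (φ N + N0)).1 (hQ _).2).1]
        simp [eval_prod]
      rw [e4] at e3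
      rw [tendsto_nhds_unique e3 e2]
      simp [eval_prod]
    have := repr_lam hlc v hmono hp
    exact ⟨this.1, this.2.2⟩
  have f1 := fin q Q v hq0 hQ hQc hQe (fun k => (tendsto_pi_nhds.mp hlim1) k)
  have f2 := fin r R w hr0 hR hRc hRe (fun k => (tendsto_pi_nhds.mp hlim2) k)
  refine ⟨f1.1, f2.1, (v, w), ?_, f1.2, f2.2⟩
  exact hS.mem_of_tendsto hlim (Eventually.of_forall fun N => hQR _)
end

section
open Finset
lemma norm_prod_lt (z : ℂ) (hz : z.im < 0) (s : Multiset ℂ) (hs : ∀ a ∈ s, 0 < a.im) :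
    ‖(s.map (fun a => (starRingEnd ℂ) z - a)).prod‖ ≤ ‖(s.map (fun a => z - a)).prod‖ ∧
    (s ≠ 0 → ‖(s.map (fun a => (starRingEnd ℂ) z - a)).prod‖ < ‖(s.map (fun a => z - a)).prod‖) := by
  have key : ∀ a : ℂ, 0 < a.im → ‖(starRingEnd ℂ) z - a‖ < ‖z - a‖ := by
    intro a ha
    rw [← sq_lt_sq₀ (norm_nonneg _) (norm_nonneg _), ← Complex.normSq_eq_norm_sq, ← Complex.normSq_eq_norm_sq,
      Complex.normSq_apply, Complex.normSq_apply]
    simp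
    nlinarith
  induction s using Multiset.induction with
  | empty => simp
  | cons a s ih =>
    have h1 := ih (fun b hb => hs b (Multiset.mem_cons_of_mem hb))
    have h2 := key a (hs a (Multiset.mem_cons_self a s))
    have hpos : 0 < ‖(s.map (fun a => z - a)).prod‖ := by
      rw [norm_pos_iff]
      refine Multiset.prod_ne_zero ?_
      intro h
      obtain ⟨b, hb, hb2⟩ := Multiset.mem_map.mp h
      have := hs b (Multiset.mem_cons_of_mem hb)
      have h3 : z = b := sub_eq_zero.mp hb2
      rw [h3] at hz; linarith
    have : ‖((a ::ₘ s).map (fun a => (starRingEnd ℂ) z - a)).prod‖ < ‖((a ::ₘ s).map (fun a => z - a)).prod‖ := by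
      simp only [Multiset.map_cons, Multiset.prod_cons, norm_mul]
      exact mul_lt_mul_of_lt_of_le_of_nonneg_of_pos h2 h1.1 (norm_nonneg _) hpos
    exact ⟨this.le, fun _ => this⟩

lemma eval_splits (f : ℂ[X]) (z : ℂ) : f.eval z = f.leadingCoeff * (f.roots.map (fun a => z - a)).prod := by
  conv_lhs => rw [(IsAlgClosed.splits f).eq_prod_roots]
  rw [eval_mul, eval_C, eval_multiset_prod, Multiset.map_map]
  simp [Function.comp_def]

lemma im_sum_nonneg (s : Multiset ℂ) (g : ℂ → ℂ) (h : ∀ a ∈ s, 0 ≤ (g a).im) : 0 ≤ (s.map g).sum.im := by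
  induction s using Multiset.induction with
  | empty => simp
  | cons a s ih =>
    simp only [Multiset.map_cons, Multiset.sum_cons, Complex.add_im]
    exact add_nonneg (h a (Multiset.mem_cons_self a s)) (ih fun b hb => h b (Multiset.mem_cons_of_mem hb))

lemma im_sum_pos (s : Multiset ℂ) (hs : s ≠ 0) (g : ℂ → ℂ) (h : ∀ a ∈ s, 0 < (g a).im) : 0 < (s.map g).sum.im := by
  obtain ⟨a, ha⟩ := Multiset.exists_mem_of_ne_zero hs
  obtain ⟨t, rfl⟩ := Multiset.exists_cons_of_mem ha
  simp only [Multiset.map_cons, Multiset.sum_cons, Complex.add_im]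
  exact add_pos_of_pos_of_nonneg (h a ha) (im_sum_nonneg _ _ fun b hb => (h b (Multiset.mem_cons_of_mem hb)).le)

lemma aeval_cj (p : ℝ[X]) (z : ℂ) : aeval ((starRingEnd ℂ) z) p = (starRingEnd ℂ) (aeval z p) := by
  rw [Polynomial.aeval_conj]

lemma realRooted_of {p : ℝ[X]} (h : ∀ z : ℂ, z.im < 0 → aeval z p ≠ 0) (hp : p ≠ 0) : RealRooted p := by
  refine splits_iff_card_roots.mp (Splits.of_splits_map (algebraMap ℝ ℂ) (IsAlgClosed.splits _) ?_)
  intro a ha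
  have h1 : aeval a p = 0 := by
    have := (mem_roots'.mp ha).2
    rwa [IsRoot, eval_map_algebraMap] at this
  have h2 : a.im = 0 := by
    rcases lt_trichotomy a.im 0 with h3 | h3 | h3
    · exact absurd h1 (h a h3)
    · exact h3
    · refine absurd ?_ (h ((starRingEnd ℂ) a) (by simpa using h3))
      rw [aeval_cj, h1, map_zero]
  exact ⟨a.re, Complex.ext (by simp) (by simp [h2])⟩

lemma aeval_real (p : ℝ[X]) (x : ℝ) : aeval (x : ℂ) p = ((p.eval x : ℝ) : ℂ) :=
  aeval_algebraMap_apply_eq_algebraMap_eval (A := ℂ) x p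

open Filter Topology in
lemma HBstrict {n : ℕ} (hn : 0 < n) {q r : ℝ[X]} (hq : q.natDegree = n) (hr : r.natDegree = n)
    (hlc : 0 < q.leadingCoeff * r.leadingCoeff)
    (hf : ∀ z : ℂ, z.im ≤ 0 → aeval z q + Complex.I * aeval z r ≠ 0) : Interlaces n q r := by
  have hq0 : q ≠ 0 := by rintro rfl; simp at hlc
  have hr0 : r ≠ 0 := by rintro rfl; simp at hlc
  set f : ℂ[X] := q.map (algebraMap ℝ ℂ) + C Complex.I * r.map (algebraMap ℝ ℂ) with hfdef
  have fev : ∀ z, f.eval z = aeval z q + Complex.I * aeval z r := by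
    intro z; simp [hfdef, eval_map_algebraMap]
  have hroots : ∀ a ∈ f.roots, 0 < a.im := by
    intro a ha
    by_contra h
    have := (mem_roots'.mp ha).2
    rw [IsRoot, fev] at this
    exact hf a (not_lt.mp h) this
  have hne : f.roots ≠ 0 := by
    intro h
    have h1 := (IsAlgClosed.splits f).natDegree_eq_card_roots
    rw [h] at h1
    have h2 : f.coeff n = 0 := coeff_eq_zero_of_natDegree_lt (by rw [h1]; simpa using hn)
    have h3 : (f.coeff n).re = q.leadingCoeff := by
      simp [hfdef, leadingCoeff, hq]
    rw [h2] at h3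
    rw [← h3] at hlc; simp at hlc
  -- real-rootedness
  have hqr : RealRooted q := by
    apply realRooted_of _ hq0
    intro z hz h0
    have h1 := (norm_prod_lt z hz f.roots hroots).2 hne
    have hlf : 0 < ‖f.leadingCoeff‖ := by
      rw [norm_pos_iff, leadingCoeff_ne_zero]; rintro h; rw [h] at hne; simp at hne
    have h2 : ‖f.eval ((starRingEnd ℂ) z)‖ < ‖f.eval z‖ := by
      rw [eval_splits, eval_splits f z, norm_mul, norm_mul]
      exact mul_lt_mul_of_pos_left h1 hlf
    rw [fev, fev, aeval_cj, aeval_cj, h0] at h2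
    simp at h2
  -- Wronskian
  have hW : ∀ x : ℝ, 0 < q.eval x * r.derivative.eval x - q.derivative.eval x * r.eval x := by
    intro x
    have hx : f.eval (x:ℂ) ≠ 0 := by rw [fev]; exact hf _ (by simp)
    have h1 := (IsAlgClosed.splits f).eval_derivative_div_eval_of_ne_zero hx
    have h2 := im_sum_pos f.roots hne (fun a => 1 / ((x:ℂ) - a)) (by
      intro a ha
      have := hroots a ha
      rw [one_div, Complex.inv_im]
      have h3 : (x:ℂ) - a ≠ 0 := by
        intro h; have := congrArg Complex.im h; simp at this; linarith
      have := Complex.normSq_pos.mpr h3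
      simp
      positivity)
    rw [← h1] at h2
    have h3 : f.eval (x:ℂ) = ((q.eval x : ℝ) : ℂ) + Complex.I * ((r.eval x : ℝ) : ℂ) := by
      rw [fev, aeval_real, aeval_real]
    have h4 : f.derivative.eval (x:ℂ) = ((q.derivative.eval x : ℝ) : ℂ) + Complex.I * ((r.derivative.eval x : ℝ) : ℂ) := by
      simp only [hfdef, derivative_add, derivative_C_mul, derivative_map, eval_add, eval_mul, eval_C, eval_map_algebraMap, aeval_real]
    have h5 := Complex.normSq_pos.mpr hx
    rw [h3] at h5 h2
    rw [h4, Complex.div_im, ← sub_div, div_pos_iff_of_pos_right h5] at h2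
    simp at h2
    linarith
  obtain ⟨hrep, hmono, -⟩ := repr_of hqr hq
  have hroot : ∀ k < n, q.eval (lam q k) = 0 := fun k hk => (mem_roots'.mp (lam_mem hqr hq hk)).2
  have hnodup : q.roots.Nodup := by
    rw [Multiset.nodup_iff_count_le_one]
    intro a
    rw [count_roots]
    by_contra h
    have := (one_lt_rootMultiplicity_iff_isRoot hq0).mp (not_le.mp h)
    have h2 := hW a
    rw [this.1, this.2] at h2
    simp at h2
  have hstrict : ∀ k, k + 1 < n → lam q k < lam q (k+1) := by
    intro k hk
    refine lt_of_le_of_ne (hmono k hk) ?_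
    have hl := sroots_length hqr hq
    have hnd : (sroots q).Nodup := by
      rw [← Multiset.coe_nodup]; unfold sroots; rwa [Multiset.sort_eq]
    unfold lam
    rw [List.getD_eq_getElem _ _ (by omega), List.getD_eq_getElem _ _ (by omega)]
    intro h
    have := (List.Nodup.getElem_inj_iff hnd).mp h
    omega
  have hder : ∀ x, r.eval x ≠ 0 → HasDerivAt (fun x => q.eval x / r.eval x)
      ((q.derivative.eval x * r.eval x - q.eval x * r.derivative.eval x) / (r.eval x)^2) x :=
    fun x hx => (q.hasDerivAt x).div (r.hasDerivAt x) hx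
  have hex1 : ∀ k, k + 1 < n → ∃ y, lam q k < y ∧ y < lam q (k+1) ∧ r.eval y = 0 := by
    intro k hk
    by_contra! hcon
    have hr1 : ∀ x ∈ Set.Icc (lam q k) (lam q (k+1)), r.eval x ≠ 0 := by
      rintro x ⟨h1, h2⟩ h0
      rcases h1.eq_or_lt with h1 | h1
      · have := hW x; rw [h0, ← h1, hroot k (by omega)] at this; simp at this
      rcases h2.eq_or_lt with h2 | h2
      · have := hW x; rw [h0, h2, hroot (k+1) (by omega)] at this; simp at this
      exact hcon x h1 h2 h0
    obtain ⟨c, hc, hc2⟩ := exists_hasDerivAt_eq_zero (hstrict k hk) (f := fun x => q.eval x / r.eval x)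
      (f' := fun x => ((q.derivative.eval x * r.eval x - q.eval x * r.derivative.eval x) / (r.eval x)^2))
      (q.continuous.continuousOn.div r.continuous.continuousOn hr1)
      (by simp [hroot k (by omega), hroot (k+1) (by omega)])
      (fun x hx => hder x (hr1 x (Set.Ioo_subset_Icc_self hx)))
    have hne := hr1 c (Set.Ioo_subset_Icc_self hc)
    have := hW c
    rw [div_eq_zero_iff] at hc2
    rcases hc2 with h | h
    · linarith
    · exact hne (by simpa using h)
  have hex2 : ∃ y, lam q (n-1) < y ∧ r.eval y = 0 := by
    by_contra! hcon
    have h0 := hroot (n-1) (by omega)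
    have hr1 : ∀ x ∈ Set.Ici (lam q (n-1)), r.eval x ≠ 0 := by
      intro x h1 h0'
      rcases (Set.mem_Ici.mp h1).eq_or_lt with h1 | h1
      · have := hW x; rw [h0', ← h1, h0] at this; simp at this
      exact hcon x h1 h0'
    have hanti : AntitoneOn (fun x => q.eval x / r.eval x) (Set.Ici (lam q (n-1))) := by
      apply antitoneOn_of_deriv_nonpos (convex_Ici _)
      · exact q.continuous.continuousOn.div r.continuous.continuousOn hr1
      · intro x hx
        exact (hder x (hr1 x (interior_subset hx))).differentiableAt.differentiableWithinAt
      · intro x hx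
        rw [(hder x (hr1 x (interior_subset hx))).deriv]
        apply div_nonpos_of_nonpos_of_nonneg _ (sq_nonneg _)
        linarith [hW x]
    have hlim := div_tendsto_atTop_leadingCoeff_div_of_degree_eq q r (by
      rw [degree_eq_natDegree hq0, degree_eq_natDegree hr0, hq, hr])
    have hpos : 0 < q.leadingCoeff / r.leadingCoeff := by
      rw [div_pos_iff]; rw [mul_pos_iff] at hlc; exact hlc
    have h1 : q.leadingCoeff / r.leadingCoeff ≤ 0 := by
      apply le_of_tendsto hlim
      filter_upwards [eventually_ge_atTop (lam q (n-1))] with x hx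
      have := hanti (Set.mem_Ici.mpr le_rfl) (Set.mem_Ici.mpr hx) hx
      simpa [h0] using this
    linarith
  have hex : ∀ k, ∃ y, k < n → lam q k < y ∧ (k + 1 < n → y < lam q (k+1)) ∧ r.eval y = 0 := by
    intro k
    by_cases h1 : k + 1 < n
    · obtain ⟨y, a, b, c⟩ := hex1 k h1
      exact ⟨y, fun _ => ⟨a, fun _ => b, c⟩⟩
    · obtain ⟨y, a, b⟩ := hex2
      refine ⟨y, fun hk => ?_⟩
      have : k = n - 1 := by omega
      subst this
      exact ⟨a, fun h => absurd h h1, b⟩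
  choose w hw using hex
  have hwstep : ∀ k, k + 1 < n → w k < w (k+1) := fun k hk =>
    ((hw k (by omega)).2.1 hk).trans (hw (k+1) hk).1
  have hwmono : ∀ a b, a < b → b < n → w a < w b := by
    intro a b hab
    induction b, hab using Nat.le_induction with
    | base => intro h; exact hwstep a h
    | succ b hab ih => intro h; exact (ih (by omega)).trans (hwstep b h)
  have hrroots : r.roots = (range n).val.map w := by
    symm
    apply Multiset.eq_of_le_of_card_le
    · rw [Multiset.le_iff_subset]
      · intro y hy
        obtain ⟨k, hk, rfl⟩ := Multiset.mem_map.mp hy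
        exact mem_roots'.mpr ⟨hr0, (hw k (by simpa using hk)).2.2⟩
      · refine Multiset.Nodup.map_on ?_ (range n).nodup
        intro a ha b hb hab
        simp at ha hb
        rcases lt_trichotomy a b with h | h | h
        · exact absurd hab (hwmono a b h hb).ne
        · exact h
        · exact absurd hab (hwmono b a h ha).ne'
    · simpa [hr] using card_roots' r
  have hrr : RealRooted r := by
    unfold RealRooted; rw [hrroots, hr]; simp
  have hrrep : r = C r.leadingCoeff * ∏ k ∈ range n, (X - C (w k)) := by
    conv_lhs => rw [(splits_iff_card_roots.mpr hrr).eq_prod_roots]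
    rw [hrroots, Multiset.map_map]
    rfl
  obtain ⟨-, -, hlam⟩ := repr_lam (leadingCoeff_ne_zero.mpr hr0) w (fun k hk => (hwstep k hk).le) hrrep
  refine ⟨hqr, hrr, hq, hr, ?_, ?_⟩
  · intro k hk
    change lam q k ≤ lam r k
    rw [hlam k hk]; exact (hw k hk).1.le
  · intro k hk
    change lam r k ≤ lam q (k+1)
    rw [hlam k (by omega)]; exact ((hw k (by omega)).2.1 hk).le

noncomputable def reP (n : ℕ) (f : ℂ[X]) : ℝ[X] := ∑ k ∈ range (n+1), C (f.coeff k).re * X ^ k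
noncomputable def imP (n : ℕ) (f : ℂ[X]) : ℝ[X] := ∑ k ∈ range (n+1), C (f.coeff k).im * X ^ k

lemma sum_coeff' {R : Type*} [Semiring R] (n : ℕ) (g : ℕ → R) (m : ℕ) :
    (∑ k ∈ range (n+1), C (g k) * X ^ k : R[X]).coeff m = if m ≤ n then g m else 0 := by
  rw [finsetSum_coeff]
  simp only [coeff_C_mul_X_pow]
  rw [Finset.sum_ite_eq]
  simp [Nat.lt_succ_iff]

lemma sum_natDegree' {R : Type*} [Semiring R] (n : ℕ) (g : ℕ → R) (h : g n ≠ 0) :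
    (∑ k ∈ range (n+1), C (g k) * X ^ k : R[X]).natDegree = n := by
  apply natDegree_eq_of_le_of_coeff_ne_zero
  · rw [natDegree_le_iff_coeff_eq_zero]
    intro m hm
    rw [sum_coeff', if_neg (by omega)]
  · rw [sum_coeff', if_pos le_rfl]; exact h

lemma sum_leadingCoeff' {R : Type*} [Semiring R] (n : ℕ) (g : ℕ → R) (h : g n ≠ 0) :
    (∑ k ∈ range (n+1), C (g k) * X ^ k : R[X]).leadingCoeff = g n := by
  rw [leadingCoeff, sum_natDegree' n g h, sum_coeff', if_pos le_rfl]

lemma conj_eval {n : ℕ} {f : ℂ[X]} (hf : f.natDegree ≤ n) (z : ℂ) :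
    (starRingEnd ℂ) (f.eval ((starRingEnd ℂ) z)) = ∑ k ∈ range (n+1), (starRingEnd ℂ) (f.coeff k) * z ^ k := by
  rw [eval_eq_sum_range' (n := n+1) (by omega), map_sum]
  simp

lemma reP_aeval {n : ℕ} {f : ℂ[X]} (hf : f.natDegree ≤ n) (z : ℂ) :
    aeval z (reP n f) = (f.eval z + (starRingEnd ℂ) (f.eval ((starRingEnd ℂ) z))) / 2 := by
  rw [conj_eval hf, eval_eq_sum_range' (n := n+1) (by omega), ← Finset.sum_add_distrib, Finset.sum_div, reP, map_sum]
  apply Finset.sum_congr rfl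
  intro k _
  rw [← add_mul, Complex.add_conj]
  simp; ring

lemma imP_aeval {n : ℕ} {f : ℂ[X]} (hf : f.natDegree ≤ n) (z : ℂ) :
    aeval z (imP n f) = (f.eval z - (starRingEnd ℂ) (f.eval ((starRingEnd ℂ) z))) / (2 * Complex.I) := by
  rw [conj_eval hf, eval_eq_sum_range' (n := n+1) (by omega), ← Finset.sum_sub_distrib, Finset.sum_div, imP, map_sum]
  apply Finset.sum_congr rfl
  intro k _
  rw [← sub_mul, Complex.sub_conj]
  have : Complex.I ≠ 0 := Complex.I_ne_zero
  simp; field_simp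

open Filter Topology in
lemma HBweak {n : ℕ} (hn : 0 < n) {q r : ℝ[X]} (hq : q.natDegree = n) (hr : r.natDegree = n)
    (hlc : 0 < q.leadingCoeff * r.leadingCoeff)
    (hf : ∀ z : ℂ, z.im < 0 → aeval z q + Complex.I * aeval z r ≠ 0) : Interlaces n q r := by
  have hq0 : q ≠ 0 := by rintro rfl; simp at hlc
  have hr0 : r ≠ 0 := by rintro rfl; simp at hlc
  set f : ℂ[X] := q.map (algebraMap ℝ ℂ) + C Complex.I * r.map (algebraMap ℝ ℂ) with hfdef
  have fev : ∀ z, f.eval z = aeval z q + Complex.I * aeval z r := by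
    intro z; simp [hfdef, eval_map_algebraMap]
  have hre : (f.coeff n).re = q.leadingCoeff := by
      simp [hfdef, leadingCoeff, hq]
  have him : (f.coeff n).im = r.leadingCoeff := by
      simp [hfdef, leadingCoeff, hr]
  have hfn : f.natDegree = n := by
    apply natDegree_eq_of_le_of_coeff_ne_zero
    · refine (natDegree_add_le _ _).trans (max_le ?_ ?_)
      · exact natDegree_map_le.trans hq.le
      · exact (natDegree_C_mul_le _ _).trans (natDegree_map_le.trans hr.le)
    · intro h; rw [h] at hre; rw [← hre] at hlc; simp at hlc
  let e : ℕ → ℝ := fun N => 1 / ((N : ℝ) + 1)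
  have he : ∀ N, 0 < e N := fun N => by positivity
  have het : Tendsto e atTop (𝓝 0) := tendsto_one_div_add_atTop_nhds_zero_nat
  let F : ℕ → ℂ[X] := fun N => f.comp (X - C (Complex.I * (e N : ℂ)))
  have hFd : ∀ N, (F N).natDegree = n := fun N => by
    simp only [F]
    rw [natDegree_comp, hfn, natDegree_X_sub_C, mul_one]
  have hFc : ∀ N, (F N).coeff n = f.coeff n := by
    intro N
    have h1 : (F N).leadingCoeff = f.leadingCoeff := by
      simp only [F]
      rw [leadingCoeff_comp (by rw [natDegree_X_sub_C]; exact one_ne_zero), leadingCoeff_X_sub_C, one_pow, mul_one]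
    rw [leadingCoeff, leadingCoeff, hFd, hfn] at h1
    exact h1
  have hFe : ∀ N z, (F N).eval z = f.eval (z - Complex.I * (e N : ℂ)) := fun N z => by simp [F]
  let Q : ℕ → ℝ[X] := fun N => reP n (F N)
  let R : ℕ → ℝ[X] := fun N => imP n (F N)
  have hqne := leadingCoeff_ne_zero.mpr hq0
  have hrne := leadingCoeff_ne_zero.mpr hr0
  have hQn : ∀ N, (Q N).natDegree = n := fun N => sum_natDegree' n _ (by simpa only [hFc, hre] using hqne)
  have hRn : ∀ N, (R N).natDegree = n := fun N => sum_natDegree' n _ (by simpa only [hFc, him] using hrne)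
  have hQl : ∀ N, (Q N).leadingCoeff = q.leadingCoeff := fun N => by
    rw [← hre, ← hFc N]
    exact sum_leadingCoeff' n _ (by simpa only [hFc, hre] using hqne)
  have hRl : ∀ N, (R N).leadingCoeff = r.leadingCoeff := fun N => by
    rw [← him, ← hFc N]
    exact sum_leadingCoeff' n _ (by simpa only [hFc, him] using hrne)
  have hint : ∀ N, Interlaces n (Q N) (R N) := by
    intro N
    apply HBstrict hn (hQn N) (hRn N)
    · rw [hQl, hRl]; exact hlc
    · intro z hz
      have h1 : aeval z (Q N) + Complex.I * aeval z (R N) = (F N).eval z := by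
        simp only [Q, R]
        rw [reP_aeval (hFd N).le, imP_aeval (hFd N).le]
        have : Complex.I ≠ 0 := Complex.I_ne_zero
        field_simp; ring
      rw [h1, hFe, fev]
      apply hf
      simp
      linarith [he N]
  have htend : ∀ z : ℂ, Tendsto (fun N => (F N).eval z) atTop (𝓝 (f.eval z)) := by
    intro z
    simp only [hFe]
    have h1 : Tendsto (fun N => z - Complex.I * (e N : ℂ)) atTop (𝓝 z) := by
      have := ((Complex.continuous_ofReal.tendsto 0).comp het).const_mul Complex.I |>.const_sub z
      simpa using this
    exact (f.continuous.tendsto z).comp h1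
  have htc : ∀ z : ℂ, Tendsto (fun N => (starRingEnd ℂ) ((F N).eval ((starRingEnd ℂ) z))) atTop (𝓝 ((starRingEnd ℂ) (f.eval ((starRingEnd ℂ) z)))) :=
    fun z => (Complex.continuous_conj.tendsto _).comp (htend _)
  have hcj : ∀ z, (starRingEnd ℂ) (f.eval ((starRingEnd ℂ) z)) = aeval z q - Complex.I * aeval z r := by
    intro z
    rw [fev, aeval_cj, aeval_cj]
    simp
    ring
  have hIn : Complex.I ≠ 0 := Complex.I_ne_zero
  let S : Set ((ℕ → ℝ) × (ℕ → ℝ)) := {vw | (∀ k, k < n → vw.1 k ≤ vw.2 k) ∧ (∀ k, k + 1 < n → vw.2 k ≤ vw.1 (k+1))}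
  have hS : IsClosed S := by
    refine IsClosed.and ?_ ?_
    · simp only [Set.ofPred_forall]
      exact isClosed_iInter fun k => isClosed_iInter fun _ => isClosed_le (by fun_prop) (by fun_prop)
    · simp only [Set.ofPred_forall]
      exact isClosed_iInter fun k => isClosed_iInter fun _ => isClosed_le (by fun_prop) (by fun_prop)
  obtain ⟨h1, h2, vw, hvw, h3, h4⟩ := limit_pair S hS Q R hq hr hq0 hr0 (fun N => ⟨(hint N).1, hQn N⟩)
    (fun N => ⟨(hint N).2.1, hRn N⟩)
    (by simp only [hQl]; exact tendsto_const_nhds) (by simp only [hRl]; exact tendsto_const_nhds)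
    (by
      intro z
      have h := ((htend z).add (htc z)).div_const 2
      have h2 : aeval z q = (f.eval z + (starRingEnd ℂ) (f.eval ((starRingEnd ℂ) z))) / 2 := by
        rw [hcj, fev]; ring
      rw [h2]
      refine h.congr fun N => ?_
      exact (reP_aeval (hFd N).le z).symm)
    (by
      intro z
      have h := ((htend z).sub (htc z)).div_const (2 * Complex.I)
      have h2 : aeval z r = (f.eval z - (starRingEnd ℂ) (f.eval ((starRingEnd ℂ) z))) / (2 * Complex.I) := by
        rw [hcj, fev]; field_simp; ring
      rw [h2]
      refine h.congr fun N => ?_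
      exact (imP_aeval (hFd N).le z).symm)
    (fun N => ⟨(hint N).2.2.2.2.1, (hint N).2.2.2.2.2⟩)
  refine ⟨h1, h2, hq, hr, ?_, ?_⟩
  · intro k hk
    change lam q k ≤ lam r k
    rw [h3 k hk, h4 k hk]; exact hvw.1 k hk
  · intro k hk
    change lam r k ≤ lam q (k+1)
    rw [h3 (k+1) hk, h4 k (by omega)]; exact hvw.2 k hk
end

section
open Finset
noncomputable def EE (n : ℕ) (ω : ℕ → ℂ) : ℂ[X] := ∑ k ∈ range (n+1), C (ω k * ((-1)^k * (n.choose k : ℂ))) * X ^ k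
noncomputable def PR (n : ℕ) (w : ℕ → ℝ) : ℝ[X] := ∑ k ∈ range (n+1), C (w k * ((-1)^k * (n.choose k : ℝ))) * X ^ k

def Stab (n : ℕ) (ω : ℕ → ℂ) : Prop := ω 0 ≠ 0 ∧ ω n ≠ 0 ∧ ∀ z : ℂ, z.im < 0 → (EE n ω).eval z ≠ 0

lemma EE_eval (n : ℕ) (ω : ℕ → ℂ) (z : ℂ) :
    (EE n ω).eval z = ∑ k ∈ range (n+1), ω k * ((-1)^k * (n.choose k : ℂ)) * z ^ k := by
  simp [EE, eval_finsetSum]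

lemma PR_eval (n : ℕ) (w : ℕ → ℝ) (x : ℝ) :
    (PR n w).eval x = ∑ k ∈ range (n+1), w k * ((-1)^k * (n.choose k : ℝ)) * x ^ k := by
  simp [PR, eval_finsetSum]

lemma PR_aeval (n : ℕ) (w : ℕ → ℝ) (z : ℂ) :
    aeval z (PR n w) = (EE n (fun k => (w k : ℂ))).eval z := by
  simp [PR, EE_eval]

lemma EE_natDegree {n : ℕ} {ω : ℕ → ℂ} (h : ω n ≠ 0) : (EE n ω).natDegree = n := by
  apply sum_natDegree' n (fun k => ω k * ((-1)^k * (n.choose k : ℂ)))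
  simp [h]

lemma EE_lc {n : ℕ} {ω : ℕ → ℂ} (h : ω n ≠ 0) : (EE n ω).leadingCoeff = ω n * (-1)^n := by
  have := sum_leadingCoeff' n (fun k => ω k * ((-1)^k * (n.choose k : ℂ))) (by simp [h])
  rw [EE, this]; simp

lemma PR_natDegree {n : ℕ} {w : ℕ → ℝ} (h : w n ≠ 0) : (PR n w).natDegree = n := by
  apply sum_natDegree' n (fun k => w k * ((-1)^k * (n.choose k : ℝ)))
  simp [h]

lemma PR_lc {n : ℕ} {w : ℕ → ℝ} (h : w n ≠ 0) : (PR n w).leadingCoeff = w n * (-1)^n := by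
  have := sum_leadingCoeff' n (fun k => w k * ((-1)^k * (n.choose k : ℝ))) (by simp [h])
  rw [PR, this]; simp

lemma PR_ne {n : ℕ} {w : ℕ → ℝ} (h : w n ≠ 0) : PR n w ≠ 0 := by
  rw [← leadingCoeff_ne_zero, PR_lc h]; simp [h]

lemma EE_congr {n : ℕ} {ω ω' : ℕ → ℂ} (h : ∀ k ≤ n, ω k = ω' k) : EE n ω = EE n ω' := by
  apply Finset.sum_congr rfl
  intro k hk
  rw [h k (by simp at hk; omega)]

lemma PR_congr {n : ℕ} {w w' : ℕ → ℝ} (h : ∀ k ≤ n, w k = w' k) : PR n w = PR n w' := by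
  apply Finset.sum_congr rfl
  intro k hk
  rw [h k (by simp at hk; omega)]

lemma PR_const (n : ℕ) (c : ℝ) (w : ℕ → ℝ) : PR n (fun k => c * w k) = C c * PR n w := by
  simp only [PR, Finset.mul_sum, ← mul_assoc, C_mul]

lemma Stab.congr {n : ℕ} {ω ω' : ℕ → ℂ} (hs : Stab n ω) (h : ∀ k ≤ n, ω k = ω' k) : Stab n ω' := by
  refine ⟨?_, ?_, ?_⟩
  · rw [← h 0 (by omega)]; exact hs.1
  · rw [← h n le_rfl]; exact hs.2.1
  · rw [← EE_congr h]; exact hs.2.2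

lemma Stab.const {n : ℕ} {ω : ℕ → ℂ} (hs : Stab n ω) {c : ℂ} (hc : c ≠ 0) : Stab n (fun k => c * ω k) := by
  refine ⟨mul_ne_zero hc hs.1, mul_ne_zero hc hs.2.1, fun z hz => ?_⟩
  have : (EE n (fun k => c * ω k)).eval z = c * (EE n ω).eval z := by
    rw [EE_eval, EE_eval, Finset.mul_sum]
    exact Finset.sum_congr rfl fun k _ => by ring
  rw [this]; exact mul_ne_zero hc (hs.2.2 z hz)

lemma Stab.dilate {n : ℕ} {ω : ℕ → ℂ} (hs : Stab n ω) {t : ℝ} (ht : 0 < t) :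
    Stab n (fun k => ((t ^ k : ℝ) : ℂ) * ω k) := by
  have htc : (t : ℂ) ≠ 0 := by exact_mod_cast ht.ne'
  refine ⟨by simpa using hs.1, mul_ne_zero (by simpa using fun h => absurd h ht.ne') hs.2.1, fun z hz => ?_⟩
  have : (EE n (fun k => ((t ^ k : ℝ) : ℂ) * ω k)).eval z = (EE n ω).eval (t * z) := by
    rw [EE_eval, EE_eval]
    exact Finset.sum_congr rfl fun k _ => by push_cast; rw [mul_pow]; ring
  rw [this]; apply hs.2.2; simp; nlinarith

lemma coeff_X_mul_derivative' (f : ℂ[X]) (k : ℕ) : (X * derivative f).coeff k = k * f.coeff k := by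
  cases k with
  | zero => simp
  | succ k => rw [coeff_X_mul, coeff_derivative]; push_cast; ring

lemma EE_op1 (n : ℕ) (ω : ℕ → ℂ) (c : ℂ) :
    EE n (fun k => (c + k) * ω k) = C c * EE n ω + X * derivative (EE n ω) := by
  ext k
  rw [coeff_add, coeff_X_mul_derivative', coeff_C_mul, EE, EE,
    sum_coeff' n (fun k => (c + k) * ω k * ((-1)^k * (n.choose k : ℂ))),
    sum_coeff' n (fun k => ω k * ((-1)^k * (n.choose k : ℂ)))]
  split_ifs <;> ring

lemma inv_im_pos {z : ℂ} (hz : z.im < 0) : 0 < (1 / z).im := by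
  rw [one_div, Complex.inv_im]
  have h3 : z ≠ 0 := by rintro rfl; simp at hz
  have := Complex.normSq_pos.mpr h3
  exact div_pos (by linarith) this

lemma Stab.roots_im {n : ℕ} {ω : ℕ → ℂ} (hs : Stab n ω) : ∀ a ∈ (EE n ω).roots, 0 ≤ a.im := by
  intro a ha
  by_contra h
  exact hs.2.2 a (not_le.mp h) (mem_roots'.mp ha).2

lemma Stab.op1 {n : ℕ} {ω : ℕ → ℂ} (hs : Stab n ω) {c : ℝ} (hc : 0 < c) :
    Stab n (fun k => ((c + k : ℝ) : ℂ) * ω k) := by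
  have hne : ∀ k : ℕ, ((c + k : ℝ) : ℂ) ≠ 0 := fun k => by
    have : (0:ℝ) < c + k := by positivity
    exact_mod_cast this.ne'
  refine ⟨mul_ne_zero (hne 0) hs.1, mul_ne_zero (hne n) hs.2.1, fun z hz h => ?_⟩
  have h1 := EE_op1 n ω c
  have h2 : EE n (fun k => ((c + k : ℝ) : ℂ) * ω k) = EE n (fun k => ((c:ℂ) + k) * ω k) := by push_cast; rfl
  rw [h2, h1, eval_add, eval_mul, eval_mul, eval_C, eval_X] at h
  have hf := hs.2.2 z hz
  have h3 := (IsAlgClosed.splits (EE n ω)).eval_derivative_div_eval_of_ne_zero hf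
  have h4 := im_sum_nonneg (EE n ω).roots (fun a => 1 / (z - a)) (by
    intro a ha
    refine (inv_im_pos ?_).le
    have := hs.roots_im a ha
    simp; linarith)
  rw [← h3] at h4
  have hz0 : z ≠ 0 := by rintro rfl; simp at hz
  have h5 : (derivative (EE n ω)).eval z / (EE n ω).eval z = - ((c:ℂ) * (1 / z)) := by
    field_simp
    linear_combination h
  have h6 := inv_im_pos hz
  rw [h5, Complex.neg_im, Complex.im_ofReal_mul] at h4
  nlinarith

open Filter Topology in
lemma EE_tendsto {n : ℕ} {W : ℕ → ℕ → ℂ} {ω : ℕ → ℂ}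
    (h : ∀ k ≤ n, Tendsto (fun N => W N k) atTop (𝓝 (ω k))) (z : ℂ) :
    Tendsto (fun N => (EE n (W N)).eval z) atTop (𝓝 ((EE n ω).eval z)) := by
  simp only [EE_eval]
  refine tendsto_finsetSum _ fun k hk => ?_
  exact ((h k (by simp at hk; omega)).mul_const _).mul_const _

lemma Stab.lower {n : ℕ} {ω : ℕ → ℂ} (hs : Stab n ω) {z : ℂ} (hz : z.im < 0) :
    ‖ω n‖ * (-z.im) ^ n ≤ ‖(EE n ω).eval z‖ := by
  rw [eval_splits, norm_mul, EE_lc hs.2.1]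
  have hcard : (EE n ω).roots.card = n := by
    rw [← (IsAlgClosed.splits (EE n ω)).natDegree_eq_card_roots, EE_natDegree hs.2.1]
  have key : ∀ s : Multiset ℂ, (∀ a ∈ s, 0 ≤ a.im) → (-z.im) ^ s.card ≤ ‖(s.map (fun a => z - a)).prod‖ := by
    intro s
    induction s using Multiset.induction with
    | empty => simp
    | cons a s ih =>
      intro h
      have h1 := ih (fun b hb => h b (Multiset.mem_cons_of_mem hb))
      have h2 := h a (Multiset.mem_cons_self a s)
      have h3 : -z.im ≤ ‖z - a‖ := by
        have := Complex.abs_im_le_norm (z - a)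
        have := neg_abs_le (z - a).im
        simp at this
        have h5 : -(z-a).im ≤ |(z-a).im| := neg_le_abs _
        simp at h5 
        have := Complex.abs_im_le_norm (z - a)
        simp at this
        linarith
      simp only [Multiset.map_cons, Multiset.prod_cons, norm_mul, Multiset.card_cons, pow_succ']
      exact mul_le_mul h3 h1 (pow_nonneg (by linarith) _) (norm_nonneg _)
  have h := key _ hs.roots_im
  rw [hcard] at h
  simp
  exact mul_le_mul_of_nonneg_left h (norm_nonneg _)

open Filter Topology in
lemma Stab.limit {n : ℕ} {W : ℕ → ℕ → ℂ} {ω : ℕ → ℂ} (hs : ∀ N, Stab n (W N))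
    (h : ∀ k ≤ n, Tendsto (fun N => W N k) atTop (𝓝 (ω k))) (h0 : ω 0 ≠ 0) (hn : ω n ≠ 0) : Stab n ω := by
  refine ⟨h0, hn, fun z hz => ?_⟩
  have h1 := (EE_tendsto h z).norm
  have h2 := ((h n le_rfl).norm).mul_const ((-z.im)^n)
  have h3 := le_of_tendsto_of_tendsto' h2 h1 (fun N => (hs N).lower hz)
  rw [← norm_pos_iff]
  refine lt_of_lt_of_le ?_ h3
  have : 0 < -z.im := by linarith
  have := norm_pos_iff.mpr hn
  positivity

lemma EE_rev (n : ℕ) (ω : ℕ → ℂ) {z : ℂ} (hz : z ≠ 0) :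
    (EE n (fun k => ω (n - k))).eval z = (-z) ^ n * (EE n ω).eval (1 / z) := by
  rw [EE_eval, EE_eval, ← Finset.sum_range_reflect, Finset.mul_sum]
  refine Finset.sum_congr rfl fun k hk => ?_
  have hk : k ≤ n := by simp at hk; omega
  obtain ⟨m, rfl⟩ := Nat.exists_eq_add_of_le hk
  have e1 : k + m + 1 - 1 - k = m := by omega
  have e2 : k + m - m = k := by omega
  have e3 : (k+m).choose m = (k+m).choose k := Nat.choose_symm_add.symm
  rw [e1, e2, e3]
  have e4 : ((-1:ℂ))^k * (-1)^k = 1 := by rw [← mul_pow]; simp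
  rw [neg_pow z, one_div, inv_pow, pow_add, pow_add]
  field_simp
  linear_combination (-(ω k * ((k + m).choose k))) * e4

lemma Stab.conjrev {n : ℕ} {ω : ℕ → ℂ} (hs : Stab n ω) : Stab n (fun k => (starRingEnd ℂ) (ω (n - k))) := by
  refine ⟨by simpa using hs.2.1, by simpa using hs.1, fun z hz => ?_⟩
  have hz0 : z ≠ 0 := by rintro rfl; simp at hz
  rw [EE_rev n (fun k => (starRingEnd ℂ) (ω k)) hz0]
  refine mul_ne_zero (pow_ne_zero _ (neg_ne_zero.mpr hz0)) ?_
  have h1 : (EE n (fun k => (starRingEnd ℂ) (ω k))).eval (1/z) = (starRingEnd ℂ) ((EE n ω).eval ((starRingEnd ℂ) (1/z))) := by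
    rw [EE_eval, EE_eval, map_sum]
    simp
  rw [h1, _root_.map_ne_zero]
  apply hs.2.2
  have := inv_im_pos hz
  rw [Complex.conj_im]; linarith

lemma EE_one (n : ℕ) : EE n (fun _ => 1) = (1 - X) ^ n := by
  rw [sub_eq_neg_add, add_pow]
  refine Finset.sum_congr rfl fun k _ => ?_
  rw [neg_pow]
  simp
  ring

lemma Stab.one (n : ℕ) : Stab n (fun _ => 1) := by
  refine ⟨one_ne_zero, one_ne_zero, fun z hz => ?_⟩
  rw [EE_one]
  simp only [eval_pow, eval_sub, eval_one, eval_X]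
  apply pow_ne_zero
  intro h
  rw [← sub_eq_zero.mp h] at hz; simp at hz

lemma Stab.base1 {n : ℕ} (hn : 0 < n) {c c' : ℝ} (hc : 0 < c) (hcc : c < c') :
    Stab n (fun k => ((c + k : ℝ) : ℂ) + Complex.I * ((c' + k : ℝ) : ℂ)) := by
  have hne : ∀ k : ℕ, ((c + k : ℝ) : ℂ) + Complex.I * ((c' + k : ℝ) : ℂ) ≠ 0 := by
    intro k h
    have := congrArg Complex.re h
    simp at this
    have h2 : (0:ℝ) ≤ k := by positivity
    linarith
  refine ⟨hne 0, hne n, fun z hz h => ?_⟩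
  have h1 : (EE n (fun k => ((c + k : ℝ) : ℂ) + Complex.I * ((c' + k : ℝ) : ℂ))).eval z
      = (EE n (fun k => ((c:ℂ) + k) * 1)).eval z + Complex.I * (EE n (fun k => ((c':ℂ) + k) * 1)).eval z := by
    simp only [EE_eval, Finset.mul_sum, ← Finset.sum_add_distrib]
    refine Finset.sum_congr rfl fun k _ => ?_
    push_cast; ring
  rw [h1, EE_op1 n (fun _ => 1), EE_op1 n (fun _ => 1), EE_one] at h
  obtain ⟨m, rfl⟩ : ∃ m, n = m + 1 := ⟨n - 1, by omega⟩
  simp [derivative_pow] at h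
  have hz1 : (1 - z) ≠ 0 := by
    intro h
    rw [← sub_eq_zero.mp h] at hz; simp at hz
  have h2 : (1 - z) ^ m * ((1 - z) * (c + Complex.I * c') - (1 + Complex.I) * (m+1) * z) = 0 := by
    rw [← h]; ring
  have h3 := (mul_eq_zero.mp h2).resolve_left (pow_ne_zero _ hz1)
  have hre := congrArg Complex.re h3
  have him := congrArg Complex.im h3
  simp at hre him
  have h4 : z.im * ((c + m + 1)^2 + (c' + m + 1)^2) = (m+1) * (c' - c) := by
    linear_combination (c' + m + 1) * hre - (c + m + 1) * him
  have h5 : 0 < (m+1:ℝ) * (c' - c) := mul_pos (by positivity) (by linarith)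
  have h6 : 0 ≤ ((c + m + 1)^2 + (c' + m + 1)^2) := by positivity
  nlinarith
end

section
open Finset
def Good (n : ℕ) (w : ℕ → ℝ) : Prop :=
  (∀ k ≤ n, 0 < w k) ∧ ∀ ω, Stab n ω → Stab n (fun k => (w k : ℂ) * ω k)

lemma Good.congr {n : ℕ} {w w' : ℕ → ℝ} (h : Good n w) (hw : ∀ k ≤ n, w k = w' k) : Good n w' := by
  refine ⟨fun k hk => hw k hk ▸ h.1 k hk, fun ω hω => (h.2 ω hω).congr fun k hk => ?_⟩
  rw [hw k hk]

lemma Good.one (n : ℕ) : Good n (fun _ => 1) :=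
  ⟨fun _ _ => one_pos, fun ω hω => by simpa using hω⟩

lemma Good.mul {n : ℕ} {w w' : ℕ → ℝ} (h : Good n w) (h' : Good n w') : Good n (fun k => w k * w' k) := by
  refine ⟨fun k hk => mul_pos (h.1 k hk) (h'.1 k hk), fun ω hω => ?_⟩
  refine (h.2 _ (h'.2 _ hω)).congr fun k _ => ?_
  push_cast; ring

lemma Good.lin {n : ℕ} {c : ℝ} (hc : 0 < c) : Good n (fun k => c + k) :=
  ⟨fun k _ => by positivity, fun ω hω => hω.op1 hc⟩

lemma Good.dil {n : ℕ} {t : ℝ} (ht : 0 < t) : Good n (fun k => t ^ k) :=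
  ⟨fun k _ => by positivity, fun ω hω => hω.dilate ht⟩

lemma Good.const {n : ℕ} {t : ℝ} (ht : 0 < t) : Good n (fun _ => t) :=
  ⟨fun k _ => ht, fun ω hω => hω.const (by exact_mod_cast ht.ne')⟩

open Filter Topology in
lemma Good.limit {n : ℕ} {W : ℕ → ℕ → ℝ} {w : ℕ → ℝ} (hW : ∀ N, Good n (W N))
    (h : ∀ k ≤ n, Tendsto (fun N => W N k) atTop (𝓝 (w k))) (hw : ∀ k ≤ n, 0 < w k) : Good n w := by
  refine ⟨hw, fun ω hω => ?_⟩
  have hne : ∀ k ≤ n, (w k : ℂ) ≠ 0 := fun k hk => by exact_mod_cast (hw k hk).ne'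
  refine Stab.limit (fun N => (hW N).2 ω hω) (fun k hk => ?_) (mul_ne_zero (hne 0 (by omega)) hω.1)
    (mul_ne_zero (hne n le_rfl) hω.2.1)
  exact ((Complex.continuous_ofReal.tendsto _).comp (h k hk)).mul_const _

lemma Good.rev {n : ℕ} {w : ℕ → ℝ} (h : Good n w) : Good n (fun k => w (n - k)) := by
  refine ⟨fun k hk => h.1 _ (by omega), fun ω hω => ?_⟩
  refine (h.2 _ hω.conjrev).conjrev.congr fun k hk => ?_
  have : n - (n - k) = k := by omega
  simp [this]

lemma Good.prod {n : ℕ} {ι : Type*} (s : Finset ι) (w : ι → ℕ → ℝ) (h : ∀ x ∈ s, Good n (w x)) :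
    Good n (fun k => ∏ x ∈ s, w x k) := by
  classical
  induction s using Finset.induction with
  | empty => simpa using Good.one n
  | insert a s ha ih =>
    simp only [Finset.prod_insert ha]
    exact (h a (Finset.mem_insert_self a s)).mul (ih fun x hx => h x (Finset.mem_insert_of_mem hx))

noncomputable def PP (b : ℝ) (k : ℕ) : ℝ := (ascPochhammer ℝ k).eval b
noncomputable def LL (n : ℕ) (b : ℝ) (k : ℕ) : ℝ := (ascPochhammer ℝ (n - k)).eval (b + k)

lemma PP_zero (b : ℝ) : PP b 0 = 1 := by simp [PP]
lemma PP_succ (b : ℝ) (k : ℕ) : PP b (k+1) = PP b k * (b + k) := ascPochhammer_succ_eval k b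
lemma PP_pos {b : ℝ} (hb : 0 < b) (k : ℕ) : 0 < PP b k := ascPochhammer_pos k b hb
lemma PP_add (b : ℝ) (k m : ℕ) : PP b k * PP (b + k) m = PP b (k + m) := by
  induction m with
  | zero => simp [PP_zero]
  | succ m ih => rw [PP_succ, ← add_assoc, PP_succ, ← ih]; push_cast; ring

lemma LL_pos {n : ℕ} {b : ℝ} (hb : 0 < b) (k : ℕ) : 0 < LL n b k := PP_pos (by positivity) _

lemma LL_mul {n k : ℕ} (b : ℝ) (hk : k ≤ n) : PP b k * LL n b k = PP b n := by
  have := PP_add b k (n - k)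
  rwa [Nat.add_sub_cancel' hk] at this

lemma Good.PP {n : ℕ} {b : ℝ} (hb : 0 < b) (N : ℕ) : Good n (fun k => PP (b + k) N) := by
  induction N with
  | zero => simpa [PP_zero] using Good.one n
  | succ N ih =>
    refine (ih.mul (Good.lin (c := b + N) (by positivity))).congr fun k _ => ?_
    rw [PP_succ]; ring

open Filter Topology in
lemma tendsto_aux (b : ℝ) (k : ℕ) :
    Tendsto (fun N : ℕ => PP (b + N) k * (1 / ((N:ℝ) + 1)) ^ k) atTop (𝓝 1) := by
  induction k with
  | zero => simp [PP_zero]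
  | succ k ih =>
    have h1 : Tendsto (fun N : ℕ => 1 + (b + k - 1) * (1 / ((N:ℝ) + 1))) atTop (𝓝 (1 + (b + k - 1) * 0)) :=
      (tendsto_one_div_add_atTop_nhds_zero_nat.const_mul _).const_add _
    have h2 := ih.mul h1
    simp only [mul_zero, add_zero, mul_one] at h2
    refine h2.congr fun N => ?_
    have : (N:ℝ) + 1 ≠ 0 := by positivity
    rw [PP_succ, pow_succ]
    have e : 1 + (b + k - 1) * (1 / ((N:ℝ) + 1)) = (b + N + k) * (1 / ((N:ℝ) + 1)) := by
      field_simp; ring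
    rw [e]; ring

open Filter Topology in
lemma tendsto_LL {n k : ℕ} {b : ℝ} (hb : 0 < b) (hk : k ≤ n) :
    Tendsto (fun N : ℕ => (PP b n / PP b N) * ((1 / ((N:ℝ) + 1)) ^ k * PP (b + k) N)) atTop (𝓝 (LL n b k)) := by
  have h := (tendsto_aux b k).const_mul (LL n b k)
  rw [mul_one] at h
  refine h.congr fun N => ?_
  have h1 := LL_mul b hk
  have h2 : PP b k * PP (b + k) N = PP b N * PP (b + N) k := by
    rw [PP_add, PP_add, add_comm]
  have h3 := (PP_pos hb k).ne'
  have h4 := (PP_pos hb N).ne'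
  rw [← h1]
  have h5 : PP (b + N) k = PP b k * PP (b + k) N / PP b N := by rw [h2]; field_simp
  rw [h5]; ring

lemma Good.LL {n : ℕ} {b : ℝ} (hb : 0 < b) : Good n (LL n b) := by
  refine Good.limit (W := fun N k => (_root_.PP b n / _root_.PP b N) * ((1 / ((N:ℝ) + 1)) ^ k * _root_.PP (b + k) N))
    (fun N => ?_) (fun k hk => tendsto_LL hb hk) (fun k _ => LL_pos hb k)
  exact (Good.const (div_pos (PP_pos hb _) (PP_pos hb _))).mul
    ((Good.dil (by positivity)).mul (Good.PP hb N))

lemma Good.realRooted {n : ℕ} {w : ℕ → ℝ} (h : Good n w) : RealRooted (PR n w) := by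
  have hs := h.2 _ (Stab.one n)
  refine realRooted_of (fun z hz => ?_) (PR_ne (h.1 n le_rfl).ne')
  rw [PR_aeval]
  simpa using hs.2.2 z hz

lemma PR_pos {n : ℕ} {w : ℕ → ℝ} (h : ∀ k ≤ n, 0 < w k) {x : ℝ} (hx : x ≤ 0) : 0 < (PR n w).eval x := by
  rw [PR_eval, Finset.sum_range_succ']
  have h1 : 0 ≤ ∑ k ∈ range n, w (k+1) * ((-1)^(k+1) * (n.choose (k+1) : ℝ)) * x ^ (k+1) := by
    refine Finset.sum_nonneg fun k hk => ?_
    have := h (k+1) (by simp at hk; omega)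
    have e : w (k+1) * ((-1)^(k+1) * (n.choose (k+1) : ℝ)) * x ^ (k+1) =
      w (k+1) * (n.choose (k+1) : ℝ) * (-x)^(k+1) := by rw [neg_pow x]; ring
    rw [e]
    have : 0 ≤ -x := by linarith
    positivity
  have := h 0 (by omega)
  simp; linarith

lemma PR_roots_pos {n : ℕ} {w : ℕ → ℝ} (h : ∀ k ≤ n, 0 < w k) : ∀ x ∈ (PR n w).roots, 0 < x := by
  intro x hx
  by_contra hh
  have := PR_pos h (not_lt.mp hh)
  have h2 := (mem_roots'.mp hx).2
  rw [IsRoot] at h2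
  linarith

lemma Inter_of_stab {n : ℕ} (hn : 0 < n) {w w' : ℕ → ℝ} (hw : 0 < w n) (hw' : 0 < w' n)
    (hs : Stab n (fun k => (w k : ℂ) + Complex.I * (w' k : ℂ))) : Interlaces n (PR n w) (PR n w') := by
  refine HBweak hn (PR_natDegree hw.ne') (PR_natDegree hw'.ne') ?_ fun z hz h => hs.2.2 z hz ?_
  · rw [PR_lc hw.ne', PR_lc hw'.ne']
    have : ((-1:ℝ))^n * (-1)^n = 1 := by rw [← mul_pow]; simp
    have e : w n * (-1)^n * (w' n * (-1)^n) = w n * w' n * (((-1:ℝ))^n * (-1)^n) := by ring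
    rw [e, this]; positivity
  · rw [PR_aeval, PR_aeval] at h
    rw [← h]
    simp only [EE_eval, Finset.mul_sum, ← Finset.sum_add_distrib]
    exact Finset.sum_congr rfl fun k _ => by ring

lemma Inter_mul {n : ℕ} (hn : 0 < n) {w u u' : ℕ → ℝ} (hw : Good n w) (hu : 0 < u n) (hu' : 0 < u' n)
    (hs : Stab n (fun k => (u k : ℂ) + Complex.I * (u' k : ℂ))) :
    Interlaces n (PR n (fun k => w k * u k)) (PR n (fun k => w k * u' k)) := by
  refine Inter_of_stab hn (mul_pos (hw.1 n le_rfl) hu) (mul_pos (hw.1 n le_rfl) hu') ?_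
  refine (hw.2 _ hs).congr fun k _ => ?_
  push_cast; ring

lemma step_lin {n : ℕ} (hn : 0 < n) {w : ℕ → ℝ} (hw : Good n w) {c c' : ℝ} (hc : 0 < c) (hcc : c ≤ c')
    (k : ℕ) (hk : k < n) :
    lam (PR n (fun k => w k * (c + k))) k ≤ lam (PR n (fun k => w k * (c' + k))) k := by
  rcases hcc.eq_or_lt with rfl | h
  · exact le_rfl
  · have hc' : 0 < c' := hc.trans h
    exact (Inter_mul hn (u := fun k => c + k) (u' := fun k => c' + k) hw (by positivity) (by positivity)
      (Stab.base1 hn hc h)).2.2.2.2.1 k hk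

lemma step_PP {n : ℕ} (hn : 0 < n) {b t : ℝ} (hb : 0 < b) (ht : 0 ≤ t) (N : ℕ) : ∀ {w : ℕ → ℝ}, Good n w →
    ∀ k, k < n → lam (PR n (fun k => w k * PP (b + k) N)) k ≤ lam (PR n (fun k => w k * PP (b + t + k) N)) k := by
  induction N with
  | zero => intro w _ k _; simp [PP_zero]
  | succ N ih =>
    intro w hw k hk
    have h1 := step_lin hn (hw.mul (Good.PP hb N)) (c := b + N) (c' := b + t + N) (by positivity) (by linarith) k hk
    have h2 := ih (hw.mul (Good.lin (c := b + t + N) (by positivity))) k hk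
    refine le_trans (le_trans (le_of_eq ?_) h1) (le_trans (le_of_eq ?_) (h2.trans (le_of_eq ?_)))
    all_goals
      congr 1
      apply PR_congr
      intro k _
      try simp only [PP_succ]
      ring

open Filter Topology in
lemma mono_LL {n : ℕ} (hn : 0 < n) {b t : ℝ} (hb : 0 < b) (ht : 0 ≤ t) {w : ℕ → ℝ} (hw : Good n w) (k : ℕ) (hk : k < n) :
    lam (PR n (fun k => w k * LL n b k)) k ≤ lam (PR n (fun k => w k * LL n (b + t) k)) k := by
  have hbt : 0 < b + t := by linarith
  set W : ℝ → ℕ → ℕ → ℝ := fun b N k => w k * ((PP b n / PP b N) * ((1 / ((N:ℝ) + 1)) ^ k * PP (b + k) N)) with hW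
  have hWg : ∀ b, 0 < b → ∀ N, Good n (W b N) := fun b hb N =>
    hw.mul ((Good.const (div_pos (PP_pos hb _) (PP_pos hb _))).mul
    ((Good.dil (by positivity)).mul (Good.PP hb N)))
  have hg : ∀ b, 0 < b → Good n (fun k => w k * LL n b k) := fun b hb => hw.mul (Good.LL hb)
  have hWt : ∀ b, 0 < b → ∀ k ≤ n, Tendsto (fun N => W b N k) atTop (𝓝 (w k * LL n b k)) := fun b hb k hk =>
    (tendsto_LL hb hk).const_mul _
  have hnz : ∀ {w}, Good n w → w n ≠ 0 := fun h => (h.1 n le_rfl).ne'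
  have hlc : ∀ b, 0 < b → Tendsto (fun N => (PR n (W b N)).leadingCoeff) atTop (𝓝 (PR n (fun k => w k * LL n b k)).leadingCoeff) := by
    intro b hb
    rw [PR_lc (hnz (hg b hb))]
    simp only [fun N => PR_lc (hnz (hWg b hb N))]
    exact (hWt b hb n le_rfl).mul_const _
  have hev : ∀ b, 0 < b → ∀ z : ℂ, Tendsto (fun N => aeval z (PR n (W b N))) atTop (𝓝 (aeval z (PR n (fun k => w k * LL n b k)))) := by
    intro b hb z
    simp only [PR_aeval]
    exact EE_tendsto (fun k hk => (Complex.continuous_ofReal.tendsto _).comp (hWt b hb k hk)) z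
  have hlam : ∀ b, 0 < b → ∀ N, lam (PR n (W b N)) = lam (PR n (fun k => (w k * (1 / ((N:ℝ) + 1)) ^ k) * PP (b + k) N)) := by
    intro b hb N
    rw [← lam_C_mul (div_pos (PP_pos hb n) (PP_pos hb N)).ne' (PR n (fun k => (w k * (1 / ((N:ℝ) + 1)) ^ k) * PP (b + k) N)), ← PR_const]
    congr 1
    apply PR_congr
    intro k _
    simp only [hW]; ring
  obtain ⟨_, _, vw, hvw, h1, h2⟩ := limit_pair (n := n) {vw : (ℕ → ℝ) × (ℕ → ℝ) | ∀ k, k < n → vw.1 k ≤ vw.2 k} (by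
      simp only [Set.ofPred_forall]
      refine isClosed_iInter fun k => isClosed_iInter fun _ => isClosed_le (by fun_prop) (by fun_prop))
    (fun N => PR n (W b N)) (fun N => PR n (W (b+t) N)) (q := PR n (fun k => w k * LL n b k))
    (r := PR n (fun k => w k * LL n (b + t) k))
    (PR_natDegree (hnz (hg b hb))) (PR_natDegree (hnz (hg _ hbt))) (PR_ne (hnz (hg b hb))) (PR_ne (hnz (hg _ hbt)))
    (fun N => ⟨(hWg b hb N).realRooted, PR_natDegree (hnz (hWg b hb N))⟩)
    (fun N => ⟨(hWg _ hbt N).realRooted, PR_natDegree (hnz (hWg _ hbt N))⟩)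
    (hlc b hb) (hlc _ hbt) (hev b hb) (hev _ hbt) (by
      intro N k hk
      simp only [hlam b hb N, hlam _ hbt N]
      exact step_PP hn hb ht N (hw.mul (Good.dil (by positivity))) k hk)
  rw [h1 k hk, h2 k hk]
  exact hvw k hk
end

section
open Finset
lemma LL_shift {n k : ℕ} (b : ℝ) (hk : k ≤ n) :
    (b + n) * (b + n + 1) * LL n b k = (b + k) * (b + k + 1) * LL n (b + 2) k := by
  obtain ⟨m, rfl⟩ := Nat.exists_eq_add_of_le hk
  have e : k + m - k = m := by omega
  change _ * PP (b + k) (k + m - k) = _ * PP (b + 2 + k) (k + m - k)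
  rw [e]
  have h1 := PP_add (b + k) 2 m
  have h2 : PP (b + k) (m + 2) = PP (b + k) m * (b + k + m) * (b + k + m + 1) := by
    rw [PP_succ, PP_succ]; push_cast; ring
  have h3 : PP (b + k) 2 = (b + k) * (b + k + 1) := by
    rw [PP_succ, PP_succ, PP_zero]; push_cast; ring
  rw [add_comm 2 m, h2, h3] at h1
  have e2 : b + 2 + (k:ℝ) = b + k + (2:ℕ) := by push_cast; ring
  rw [e2, h1]; push_cast; ring

lemma LL_pred {n k : ℕ} (b : ℝ) (hk : k < n) : LL n b k = (b + k) * LL n b (k + 1) := by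
  obtain ⟨m, rfl⟩ := Nat.exists_eq_add_of_lt hk
  change PP (b + k) (k + m + 1 - k) = _ * PP (b + (k + 1 : ℕ)) (k + m + 1 - (k + 1))
  have e : k + m + 1 - k = 1 + m := by omega
  have e' : k + m + 1 - (k + 1) = m := by omega
  rw [e, e', ← PP_add, PP_succ, PP_zero]; push_cast; ring_nf

lemma EE_coeff (n : ℕ) (ω : ℕ → ℂ) (k : ℕ) :
    (EE n ω).coeff k = if k ≤ n then ω k * ((-1)^k * (n.choose k : ℂ)) else 0 := by
  rw [EE, sum_coeff' n (fun k => ω k * ((-1)^k * (n.choose k : ℂ)))]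

lemma lag_ident (n : ℕ) (b : ℝ) :
    C (((b + n) * (b + n + 1) : ℝ) : ℂ) * EE n (fun k => (LL n b k : ℂ)) =
      X * (X * derivative (EE n (fun k => (LL n (b+2) k : ℂ))))
      + C (b : ℂ) * (X * derivative (EE n (fun k => (LL n (b+2) k : ℂ))))
      + C ((b * (b + 1) : ℝ) : ℂ) * EE n (fun k => (LL n (b+2) k : ℂ))
      - C (n : ℂ) * (X * EE n (fun k => (LL n (b+2) k : ℂ))) := by
  have hs : ∀ k ≤ n, (((b + n) * (b + n + 1) : ℝ) : ℂ) * (LL n b k : ℂ) = ((b:ℂ) + k) * (b + k + 1) * LL n (b + 2) k := by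
    intro k hk
    exact_mod_cast congrArg (fun x : ℝ => (x : ℂ)) (LL_shift b hk)
  ext k
  rw [coeff_sub, coeff_add, coeff_add, coeff_C_mul, coeff_C_mul, coeff_C_mul, coeff_C_mul, coeff_X_mul_derivative']
  cases k with
  | zero =>
    simp only [mul_coeff_zero, coeff_X_zero, zero_mul, EE_coeff, Nat.zero_le, if_true]
    have := hs 0 (by omega)
    push_cast at this ⊢
    simp at this ⊢
    linear_combination this
  | succ k =>
    rw [coeff_X_mul, coeff_X_mul, coeff_X_mul_derivative']
    simp only [EE_coeff]
    rcases lt_trichotomy k n with h | h | h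
    · rw [if_pos (by omega), if_pos (by omega), if_pos (by omega)]
      have h1 := hs (k+1) (by omega)
      have h2 : (LL n (b+2) k : ℂ) = ((b:ℂ) + 2 + k) * LL n (b+2) (k+1) := by
        exact_mod_cast congrArg (fun x : ℝ => (x : ℂ)) (LL_pred (b+2) h)
      have h3 : (n.choose (k+1) : ℂ) * (k + 1) = n.choose k * (n - k) := by
        have := Nat.choose_succ_right_eq n k
        have h4 := congrArg (fun x : ℕ => (x : ℂ)) this
        push_cast [Nat.cast_sub h.le] at h4
        exact h4
      rw [h2, pow_succ]
      push_cast at h1 ⊢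
      linear_combination (-(-1)^k * (n.choose (k+1) : ℂ)) * h1 - (-1)^k * (b + 2 + k) * (LL n (b+2) (k+1) : ℂ) * h3
    · subst h
      simp
    · rw [if_neg (by omega), if_neg (by omega), if_neg (by omega)]
      simp

lemma Good.roots_real {n : ℕ} {w : ℕ → ℝ} (h : Good n w) :
    ∀ a ∈ (EE n (fun k => (w k : ℂ))).roots, ∃ x : ℝ, 0 < x ∧ a = x := by
  intro a ha
  have hs : Stab n (fun k => (w k : ℂ)) := by simpa using h.2 _ (Stab.one n)
  have h1 := hs.roots_im a ha
  have h0 : (EE n (fun k => (w k : ℂ))).eval a = 0 := (mem_roots'.mp ha).2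
  have h2 : a.im ≤ 0 := by
    by_contra hh
    apply hs.2.2 ((starRingEnd ℂ) a) (by rw [Complex.conj_im]; linarith)
    have : (EE n (fun k => (w k : ℂ))).eval ((starRingEnd ℂ) a) = (starRingEnd ℂ) ((EE n (fun k => (w k : ℂ))).eval a) := by
      rw [EE_eval, EE_eval, map_sum]
      simp
    rw [this, h0, map_zero]
  have h3 : a = (a.re : ℂ) := Complex.ext (by simp) (by simp; linarith)
  refine ⟨a.re, ?_, h3⟩
  by_contra hh
  have h4 := PR_pos h.1 (not_lt.mp hh)
  rw [h3, ← PR_aeval] at h0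
  have h5 : aeval (a.re : ℂ) (PR n w) = (((PR n w).eval a.re : ℝ) : ℂ) := by
    have := aeval_algebraMap_apply_eq_algebraMap_eval (A := ℂ) a.re (PR n w)
    simpa using this
  rw [h5] at h0
  have : (PR n w).eval a.re = 0 := by exact_mod_cast h0
  linarith

lemma Stab.lag {n : ℕ} {b : ℝ} (hb : 0 < b) :
    Stab n (fun k => (LL n b k : ℂ) + Complex.I * (LL n (b+2) k : ℂ)) := by
  have hne : ∀ k : ℕ, (LL n b k : ℂ) + Complex.I * (LL n (b+2) k : ℂ) ≠ 0 := by
    intro k h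
    have := congrArg Complex.re h
    simp at this
    exact (LL_pos hb k).ne' this
  refine ⟨hne 0, hne n, fun z hz h => ?_⟩
  have h1 : (EE n (fun k => (LL n b k : ℂ) + Complex.I * (LL n (b+2) k : ℂ))).eval z
      = (EE n (fun k => (LL n b k : ℂ))).eval z + Complex.I * (EE n (fun k => (LL n (b+2) k : ℂ))).eval z := by
    simp only [EE_eval, Finset.mul_sum, ← Finset.sum_add_distrib]
    exact Finset.sum_congr rfl fun k _ => by ring
  rw [h1] at h
  have hg : Good n (LL n (b+2)) := Good.LL (by linarith)
  have hs : Stab n (fun k => (LL n (b+2) k : ℂ)) := by simpa using hg.2 _ (Stab.one n)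
  have hid := congrArg (Polynomial.eval z) (lag_ident n b)
  simp only [eval_sub, eval_add, eval_mul, eval_C, eval_X] at hid
  have hroots := hg.roots_real
  have hcard : (EE n (fun k => (LL n (b+2) k : ℂ))).roots.card = n := by
    rw [← (IsAlgClosed.splits _).natDegree_eq_card_roots, EE_natDegree hs.2.1]
  have hf := hs.2.2 z hz
  have h3 := (IsAlgClosed.splits (EE n (fun k => (LL n (b+2) k : ℂ)))).eval_derivative_div_eval_of_ne_zero hf
  set r := EE n (fun k => (LL n (b+2) k : ℂ)) with hr
  have h4 := im_sum_nonneg r.roots (fun a => z * (z + b) * (1 / (z - a)) - z) (by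
    intro a ha
    obtain ⟨x, hx, rfl⟩ := hroots a ha
    have hzx : (z - x).im < 0 := by simpa using hz
    have hzx0 : z - x ≠ 0 := by intro h; rw [h] at hzx; simp at hzx
    have e : z * (z + b) * (1 / (z - x)) - z = ((b + x : ℝ) : ℂ) + ((x * (x + b) : ℝ) : ℂ) * (1 / (z - x)) := by
      push_cast; field_simp; ring
    show 0 ≤ (z * (z + b) * (1 / (z - x)) - z).im
    rw [e, Complex.add_im, Complex.im_ofReal_mul, Complex.ofReal_im]
    have := inv_im_pos hzx
    positivity)
  rw [Multiset.sum_map_sub, Multiset.sum_map_mul_left, ← h3, Multiset.map_const', Multiset.sum_replicate, hcard] at h4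
  have h5 : z * (z + b) * (r.derivative.eval z / r.eval z) - n • z =
      (-((b + n) * (b + n + 1)) : ℝ) * Complex.I - ((b * (b + 1) : ℝ) : ℂ) := by
    rw [nsmul_eq_mul]
    field_simp
    push_cast at hid ⊢
    linear_combination (-1) * hid + ((b:ℂ) + n) * (b + n + 1) * h
  rw [h5, Complex.sub_im, Complex.im_ofReal_mul, Complex.ofReal_im, Complex.I_im] at h4
  have : 0 < (b + n) * (b + n + 1) := by positivity
  linarith

lemma inter_b {n : ℕ} (hn : 0 < n) {b t : ℝ} (hb : 0 < b) (ht : 0 ≤ t) (ht2 : t ≤ 2) {w : ℕ → ℝ} (hw : Good n w) :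
    Interlaces n (PR n (fun k => w k * LL n b k)) (PR n (fun k => w k * LL n (b + t) k)) := by
  have hbt : 0 < b + t := by linarith
  have h2 := Inter_mul hn hw (LL_pos hb n) (LL_pos (by linarith : 0 < b + 2) n) (Stab.lag hb)
  have g1 := hw.mul (Good.LL hb)
  have g2 := hw.mul (Good.LL hbt)
  refine ⟨g1.realRooted, g2.realRooted, PR_natDegree (g1.1 n le_rfl).ne', PR_natDegree (g2.1 n le_rfl).ne', ?_, ?_⟩
  · exact fun k hk => mono_LL hn hb ht hw k hk
  · intro k hk
    have h3 := mono_LL hn hbt (by linarith : 0 ≤ 2 - t) hw k (by omega)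
    have e : b + t + (2 - t) = b + 2 := by ring
    rw [e] at h3
    exact h3.trans (h2.2.2.2.2.2 k hk)

lemma anti_inter {n : ℕ} {p q p' q' : ℝ[X]} (f : ℝ → ℝ) (D : Set ℝ) (hf : AntitoneOn f D)
    (h : Interlaces n p q) (hp : ∀ x ∈ p.roots, x ∈ D) (hq : ∀ x ∈ q.roots, x ∈ D)
    (hp' : RealRooted p' ∧ p'.natDegree = n ∧ ∀ k < n, lam p' k = f (lam p (n - 1 - k)))
    (hq' : RealRooted q' ∧ q'.natDegree = n ∧ ∀ k < n, lam q' k = f (lam q (n - 1 - k))) :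
    Interlaces n q' p' := by
  obtain ⟨h1, h2, h3, h4, h5, h6⟩ := h
  refine ⟨hq'.1, hp'.1, hq'.2.1, hp'.2.1, fun k hk => ?_, fun k hk => ?_⟩
  · change lam q' k ≤ lam p' k
    rw [hp'.2.2 k hk, hq'.2.2 k hk]
    exact hf (hp _ (lam_mem h1 h3 (by omega))) (hq _ (lam_mem h2 h4 (by omega))) (h5 _ (by omega))
  · change lam p' k ≤ lam q' (k+1)
    rw [hp'.2.2 k (by omega), hq'.2.2 (k+1) hk]
    have e : n - 1 - k = n - 1 - (k + 1) + 1 := by omega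
    rw [e]
    exact hf (hq _ (lam_mem h2 h4 (by omega))) (hp _ (lam_mem h1 h3 (by omega))) (h6 _ (by omega))

lemma neg_lam {n : ℕ} {p : ℝ[X]} (h0 : p ≠ 0) (hr : RealRooted p) (hd : p.natDegree = n) :
    RealRooted (p.comp (-X)) ∧ (p.comp (-X)).natDegree = n ∧
      ∀ k < n, lam (p.comp (-X)) k = - lam p (n - 1 - k) := by
  obtain ⟨h1, h2, _⟩ := repr_of hr hd
  refine repr_lam (c := p.leadingCoeff * (-1)^n) (by simpa using h0) (fun k => - lam p (n - 1 - k)) ?_ ?_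
  · intro k hk
    have := h2 (n - 1 - (k+1)) (by omega)
    have e : n - 1 - k = n - 1 - (k + 1) + 1 := by omega
    rw [← e] at this
    exact neg_le_neg this
  · conv_lhs => rw [h1]
    rw [Finset.prod_range_reflect (fun k => X - C (- lam p k)) n, C_mul, mul_assoc, mul_comp, C_comp]
    congr 1
    rw [Polynomial.prod_comp]
    have : ∀ k, (X - C (lam p k)).comp (-X) = C (-1) * (X - C (-lam p k)) := by
      intro k; simp; ring
    simp only [this, Finset.prod_mul_distrib, Finset.prod_const, Finset.card_range, C_pow]

lemma neg_inter {n : ℕ} {p q : ℝ[X]} (hp0 : p ≠ 0) (hq0 : q ≠ 0) (h : Interlaces n p q) :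
    Interlaces n (q.comp (-X)) (p.comp (-X)) :=
  anti_inter (fun x => -x) Set.univ (fun _ _ _ _ h => neg_le_neg h) h (fun _ _ => trivial) (fun _ _ => trivial)
    (neg_lam hp0 h.1 h.2.2.1) (neg_lam hq0 h.2.1 h.2.2.2.1)

lemma PR_rev (n : ℕ) (w : ℕ → ℝ) {z : ℝ} (hz : z ≠ 0) :
    (PR n (fun k => w (n - k))).eval z = (-z) ^ n * (PR n w).eval (1 / z) := by
  rw [PR_eval, PR_eval, ← Finset.sum_range_reflect, Finset.mul_sum]
  refine Finset.sum_congr rfl fun k hk => ?_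
  have hk : k ≤ n := by simp at hk; omega
  obtain ⟨m, rfl⟩ := Nat.exists_eq_add_of_le hk
  have e1 : k + m + 1 - 1 - k = m := by omega
  have e2 : k + m - m = k := by omega
  have e3 : (k+m).choose m = (k+m).choose k := Nat.choose_symm_add.symm
  rw [e1, e2, e3]
  have e4 : ((-1:ℝ))^k * (-1)^k = 1 := by rw [← mul_pow]; simp
  rw [neg_pow z, one_div, inv_pow, pow_add, pow_add]
  field_simp
  linear_combination (-(w k * ((k + m).choose k))) * e4

lemma rev_lam {n : ℕ} {w : ℕ → ℝ} (hw : ∀ k ≤ n, 0 < w k) (hr : RealRooted (PR n w)) :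
    RealRooted (PR n (fun k => w (n - k))) ∧ (PR n (fun k => w (n - k))).natDegree = n ∧
      ∀ k < n, lam (PR n (fun k => w (n - k))) k = (lam (PR n w) (n - 1 - k))⁻¹ := by
  have hd := PR_natDegree (hw n le_rfl).ne'
  have h0 := PR_ne (hw n le_rfl).ne'
  have hpos : ∀ k < n, 0 < lam (PR n w) k := fun k hk => PR_roots_pos hw _ (lam_mem hr hd hk)
  obtain ⟨h1, h2, _⟩ := repr_of hr hd
  have hprod : (∏ k ∈ range n, lam (PR n w) k) ≠ 0 :=
    Finset.prod_ne_zero_iff.mpr fun k hk => (hpos k (by simpa using hk)).ne'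
  refine repr_lam (c := (PR n w).leadingCoeff * ∏ k ∈ range n, lam (PR n w) k)
    (mul_ne_zero (by simpa using h0) hprod) (fun k => (lam (PR n w) (n - 1 - k))⁻¹) ?_ ?_
  · intro k hk
    have := h2 (n - 1 - (k+1)) (by omega)
    have e : n - 1 - k = n - 1 - (k + 1) + 1 := by omega
    rw [← e] at this
    exact inv_anti₀ (hpos _ (by omega)) this
  · rw [Finset.prod_range_reflect (fun k => X - C ((lam (PR n w) k)⁻¹)) n]
    apply Polynomial.eq_of_infinite_eval_eq
    refine Set.Infinite.mono (s := {x : ℝ | x ≠ 0}) ?_ ?_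
    · intro x hx
      have hx : x ≠ 0 := hx
      show eval x _ = eval x _
      rw [PR_rev n w hx]
      have e1 : (PR n w).eval (1/x) = (PR n w).leadingCoeff * ∏ k ∈ range n, (1/x - lam (PR n w) k) := by
        conv_lhs => rw [h1]
        simp [eval_prod]
      rw [e1]
      simp only [eval_mul, eval_C, eval_prod, eval_sub, eval_X]
      rw [mul_assoc, ← Finset.prod_mul_distrib, mul_left_comm]
      congr 1
      rw [← Finset.card_range n, ← Finset.prod_const, Finset.card_range, ← Finset.prod_mul_distrib]
      refine Finset.prod_congr rfl fun k hk => ?_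
      have := (hpos k (by simpa using hk)).ne'
      field_simp
      ring
    · exact (Set.finite_singleton (0:ℝ)).infinite_compl

lemma rev_inter {n : ℕ} {w w' : ℕ → ℝ} (hw : ∀ k ≤ n, 0 < w k) (hw' : ∀ k ≤ n, 0 < w' k)
    (h : Interlaces n (PR n w) (PR n w')) :
    Interlaces n (PR n (fun k => w' (n - k))) (PR n (fun k => w (n - k))) :=
  anti_inter (fun x => x⁻¹) (Set.Ioi 0) (fun _ hx _ _ h => inv_anti₀ hx h) h (PR_roots_pos hw) (PR_roots_pos hw')
    (rev_lam hw h.1) (rev_lam hw' h.2.1)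
end

section
open Finset
noncomputable def WW (n : ℕ) {i j : ℕ} (a : Fin i → ℝ) (b : Fin j → ℝ) (k : ℕ) : ℝ :=
  (∏ s, LL n (-a s - n + 1) (n - k)) * ∏ s, LL n (b s) k

lemma hyp_coeff_aux (n : ℕ) {i j : ℕ} (a : Fin i → ℝ) (b : Fin j → ℝ) {k : ℕ} (hk : k ≤ n) :
    ((ascPochhammer ℝ k).eval (-(n : ℝ)) * (∏ s, (ascPochhammer ℝ k).eval (a s)) *
        (∏ s, (ascPochhammer ℝ (n - k)).eval (b s + (k : ℝ)))) / (Nat.factorial k : ℝ)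
      = ((-1)^k)^i * (WW n a b k * ((-1)^k * (n.choose k : ℝ))) := by
  have h1 : (ascPochhammer ℝ k).eval (-(n : ℝ)) = (-1)^k * (k.factorial * n.choose k) := by
    rw [ascPochhammer_eval_neg_eq_descPochhammer, descPochhammer_eval_eq_descFactorial,
      Nat.descFactorial_eq_factorial_mul_choose]
    push_cast; ring
  have h2 : ∀ s, (ascPochhammer ℝ k).eval (a s) = (-1)^k * LL n (-a s - n + 1) (n - k) := by
    intro s
    have e := ascPochhammer_eval_neg_eq_descPochhammer ℝ (-a s) k
    rw [neg_neg] at e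
    rw [e, descPochhammer_eval_eq_ascPochhammer, LL]
    have e1 : n - (n - k) = k := by omega
    rw [e1]
    push_cast [Nat.cast_sub hk]
    congr 2; ring
  simp only [h1, h2, Finset.prod_mul_distrib, Finset.prod_const, Finset.card_univ, Fintype.card_fin, WW]
  have : (k.factorial : ℝ) ≠ 0 := by positivity
  simp only [LL]
  field_simp

lemma hyp_even (n : ℕ) {i j : ℕ} (a : Fin i → ℝ) (b : Fin j → ℝ) (hi : Even i) :
    hyp n a b = PR n (WW n a b) := by
  rw [hyp, PR]
  refine Finset.sum_congr rfl fun k hk => ?_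
  rw [hyp_coeff_aux n a b (by simp at hk; omega), ← pow_mul, mul_comm k i, pow_mul, hi.neg_one_pow]
  simp

lemma hyp_odd (n : ℕ) {i j : ℕ} (a : Fin i → ℝ) (b : Fin j → ℝ) (hi : Odd i) :
    hyp n a b = (PR n (WW n a b)).comp (-X) := by
  rw [hyp, PR, Polynomial.sum_comp]
  refine Finset.sum_congr rfl fun k hk => ?_
  rw [hyp_coeff_aux n a b (by simp at hk; omega), ← pow_mul, mul_comm k i, pow_mul, hi.neg_one_pow]
  rw [mul_comp, C_comp, pow_comp, X_comp, neg_pow (X : ℝ[X]), C_mul, C_pow]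
  simp
  ring

lemma WW_good {n : ℕ} {i j : ℕ} {a : Fin i → ℝ} {b : Fin j → ℝ}
    (hb : ∀ s, 0 < b s) (ha : ∀ s, a s < -(n : ℝ) + 1) : Good n (WW n a b) := by
  refine Good.mul (w := fun k => ∏ s, LL n (-a s - n + 1) (n - k)) (w' := fun k => ∏ s, LL n (b s) k) ?_ ?_
  · exact (Good.prod univ (fun s => LL n (-a s - n + 1)) (fun s _ => Good.LL (by have := ha s; linarith))).rev
  · exact Good.prod univ (fun s => LL n (b s)) (fun s _ => Good.LL (hb s))

lemma prod_upd {j : ℕ} (f : ℝ → ℝ) (b : Fin j → ℝ) (s₀ : Fin j) (x : ℝ) :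
    ∏ s, f (Function.update b s₀ x s) = (∏ s ∈ univ.erase s₀, f (b s)) * f x := by
  rw [← Finset.prod_erase_mul univ _ (Finset.mem_univ s₀)]
  simp only [Function.update_self]
  congr 1
  refine Finset.prod_congr rfl fun s hs => ?_
  rw [Function.update_of_ne (Finset.ne_of_mem_erase hs)]

lemma WW_b {n : ℕ} (hn : 0 < n) {i j : ℕ} {a : Fin i → ℝ} {b : Fin j → ℝ}
    (hb : ∀ s, 0 < b s) (ha : ∀ s, a s < -(n : ℝ) + 1) (s₀ : Fin j) {t : ℝ} (ht : 0 ≤ t) (ht2 : t ≤ 2) :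
    Interlaces n (PR n (WW n a b)) (PR n (WW n a (Function.update b s₀ (b s₀ + t)))) := by
  have hg : Good n (fun k => (∏ s, LL n (-a s - n + 1) (n - k)) * ∏ s ∈ univ.erase s₀, LL n (b s) k) :=
    Good.mul (w := fun k => ∏ s, LL n (-a s - n + 1) (n - k)) (w' := fun k => ∏ s ∈ univ.erase s₀, LL n (b s) k)
      (Good.prod univ (fun s => LL n (-a s - n + 1)) (fun s _ => Good.LL (by have := ha s; linarith))).rev
      (Good.prod _ (fun s => LL n (b s)) (fun s _ => Good.LL (hb s)))
  have h := inter_b hn (hb s₀) ht ht2 hg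
  have e : ∀ x, PR n (WW n a (Function.update b s₀ x)) =
      PR n (fun k => (∏ s, LL n (-a s - n + 1) (n - k)) * (∏ s ∈ univ.erase s₀, LL n (b s) k) * LL n x k) := by
    intro x
    refine PR_congr fun k _ => ?_
    rw [WW, prod_upd (fun y => LL n y k), mul_assoc]
  have e0 := e (b s₀)
  rw [Function.update_eq_self] at e0
  rw [e0, e]; exact h

lemma WW_a {n : ℕ} (hn : 0 < n) {i j : ℕ} {a : Fin i → ℝ} {b : Fin j → ℝ}
    (hb : ∀ s, 0 < b s) (ha : ∀ s, a s < -(n : ℝ) + 1) (s₀ : Fin i) {t : ℝ} (ht : 0 ≤ t) (ht2 : t ≤ 2) :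
    Interlaces n (PR n (WW n (Function.update a s₀ (a s₀ - t)) b)) (PR n (WW n a b)) := by
  have hg : Good n (fun k => (∏ s, LL n (b s) (n - k)) * ∏ s ∈ univ.erase s₀, LL n (-a s - n + 1) k) :=
    Good.mul (w := fun k => ∏ s, LL n (b s) (n - k)) (w' := fun k => ∏ s ∈ univ.erase s₀, LL n (-a s - n + 1) k)
      (Good.prod univ (fun s => LL n (b s)) (fun s _ => Good.LL (hb s))).rev
      (Good.prod _ (fun s => LL n (-a s - n + 1)) (fun s _ => Good.LL (by have := ha s; linarith)))
  have h0 : 0 < -a s₀ - n + 1 := by have := ha s₀; linarith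
  have h := inter_b hn h0 ht ht2 hg
  have h' := rev_inter (hg.mul (Good.LL h0)).1 (hg.mul (Good.LL (by linarith : 0 < -a s₀ - n + 1 + t))).1 h
  have e : ∀ x, PR n (WW n (Function.update a s₀ x) b) =
      PR n (fun k => (∏ s, LL n (b s) (n - (n - k))) * (∏ s ∈ univ.erase s₀, LL n (-a s - n + 1) (n - k)) *
        LL n (-x - n + 1) (n - k)) := by
    intro x
    refine PR_congr fun k hk => ?_
    have e1 : n - (n - k) = k := by omega
    rw [WW, prod_upd (fun y => LL n (-y - n + 1) (n - k)), e1]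
    ring
  have e0 := e (a s₀)
  rw [Function.update_eq_self] at e0
  have e2 : -(a s₀ - t) - (n:ℝ) + 1 = -a s₀ - n + 1 + t := by ring
  rw [e0, e, e2]; exact h'
end

/-- for `b_s > 0` and `a_s < -n+1`, the hypergeometric polynomial is real-rooted
with all roots of the same sign (positive for even `i`, negative for odd `i`), together with the
interlacing monotonicity in the parameters. -/
theorem hyp_same_sign (n : ℕ) (hn : 0 < n) {i j : ℕ} (a : Fin i → ℝ) (b : Fin j → ℝ)
    (hb : ∀ s, 0 < b s) (ha : ∀ s, a s < -(n : ℝ) + 1) :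
    (RealRooted (hyp n a b) ∧
      (Even i → ∀ x ∈ (hyp n a b).roots, 0 < x) ∧
      (Odd i → ∀ x ∈ (hyp n a b).roots, x < 0)) ∧
    (∀ t : ℝ, 0 ≤ t → t ≤ 2 →
      (Even i →
        (∀ hj : 0 < j,
          Interlaces n (hyp n a b)
            (hyp n a (Function.update b ⟨0, hj⟩ (b ⟨0, hj⟩ + t)))) ∧
        (∀ hi : 0 < i,
          Interlaces n (hyp n (Function.update a ⟨0, hi⟩ (a ⟨0, hi⟩ - t)) b)
            (hyp n a b))) ∧
      (Odd i →
        (∀ hj : 0 < j,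
          Interlaces n (hyp n a (Function.update b ⟨0, hj⟩ (b ⟨0, hj⟩ + t)))
            (hyp n a b)) ∧
        (∀ hi : 0 < i,
          Interlaces n (hyp n a b)
            (hyp n (Function.update a ⟨0, hi⟩ (a ⟨0, hi⟩ - t)) b)))) := by
  have hg := WW_good hb ha
  have hne : ∀ {w : ℕ → ℝ}, Good n w → PR n w ≠ 0 := fun h => PR_ne (h.1 n le_rfl).ne'
  have hd := PR_natDegree (hg.1 n le_rfl).ne'
  refine ⟨⟨?_, ?_, ?_⟩, fun t ht ht2 => ⟨fun hi => ⟨fun hj => ?_, fun hi' => ?_⟩, fun hi => ⟨fun hj => ?_, fun hi' => ?_⟩⟩⟩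
  · rcases Nat.even_or_odd i with hi | hi
    · rw [hyp_even n a b hi]; exact hg.realRooted
    · rw [hyp_odd n a b hi]; exact (neg_lam (hne hg) hg.realRooted hd).1
  · intro hi
    rw [hyp_even n a b hi]; exact PR_roots_pos hg.1
  · intro hi x hx
    rw [hyp_odd n a b hi] at hx
    by_contra hh
    have h1 := (mem_roots'.mp hx).2
    rw [IsRoot, eval_comp, eval_neg, eval_X] at h1
    have := PR_pos hg.1 (x := -x) (by linarith)
    linarith
  · rw [hyp_even n a _ hi, hyp_even n a _ hi]
    exact WW_b hn hb ha _ ht ht2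
  · rw [hyp_even n _ b hi, hyp_even n _ b hi]
    exact WW_a hn hb ha _ ht ht2
  · rw [hyp_odd n a _ hi, hyp_odd n a _ hi]
    have h := WW_b hn hb ha ⟨0, hj⟩ ht ht2
    refine neg_inter (hne hg) (hne (WW_good (fun s => ?_) ha)) h
    by_cases hs : s = ⟨0, hj⟩
    · subst hs; simp; have := hb ⟨0, hj⟩; linarith
    · rw [Function.update_of_ne hs]; exact hb s
  · rw [hyp_odd n _ b hi, hyp_odd n _ b hi]
    have h := WW_a hn hb ha ⟨0, hi'⟩ ht ht2
    refine neg_inter (hne (WW_good hb (fun s => ?_))) (hne hg) h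
    by_cases hs : s = ⟨0, hi'⟩
    · subst hs; simp; have := ha ⟨0, hi'⟩; linarith
    · rw [Function.update_of_ne hs]; exact ha s
end

section
/- Let n be a positive integer, j ≥ i ≥ 0, and let a = (a_1,…,a_i), b = (b_1,…,b_j) be tuples of real parameters with b_1,…,b_j > 0 and a_s ≥ n - 1 + b_s for every s = 1,…,i. Then all roots of the hypergeometric polynomial ₍i+1₎𝓕_j(-n, a; b; x) are real and strictly positive. -/
open Polynomial

/-- All complex roots are positive reals. -/
def PRoot (p : Polynomial ℝ) : Prop :=
  p ≠ 0 ∧ ∀ z : ℂ, aeval z p = 0 → z.im = 0 ∧ 0 < z.re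

/-- Auxiliary half-plane functional. -/
noncomputable def phi (z w : ℂ) : ℝ := if z.im = 0 then w.re else z.im * w.im

lemma phi_add (z w v : ℂ) : phi z (w + v) = phi z w + phi z v := by
  unfold phi; split_ifs <;> simp; ring

lemma phi_smul (z w : ℂ) (r : ℝ) : phi z (r * w) = r * phi z w := by
  unfold phi; split_ifs <;> simp; ring

lemma phi_zero (z : ℂ) : phi z 0 = 0 := by
  unfold phi; split_ifs <;> simp

lemma phi_real (z : ℂ) (r : ℝ) (hr : 0 ≤ r) : 0 ≤ phi z r := by
  unfold phi; split_ifs <;> simp [hr]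

lemma phi_inv (z : ℂ) (hz : ¬ (z.im = 0 ∧ 0 ≤ z.re)) (t : ℝ) (ht : 0 ≤ t) :
    phi z (1 / (z - t)) < 0 := by
  have hne : z - t ≠ 0 := by
    intro h
    have h' : z = t := by linear_combination h
    apply hz
    rw [h']; simp [ht]
  have hp : 0 < Complex.normSq (z - t) := Complex.normSq_pos.2 hne
  unfold phi
  split_ifs with h
  · have hre : z.re < 0 := by
      by_contra hc
      exact hz ⟨h, not_lt.1 hc⟩
    rw [one_div, Complex.inv_re]
    apply div_neg_of_neg_of_pos _ hp
    simp; linarith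
  · rw [one_div, Complex.inv_im]
    have : z.im * (-(z - t).im / Complex.normSq (z - t)) =
      -(z.im ^ 2 / Complex.normSq (z - t)) := by
      rw [Complex.sub_im, Complex.ofReal_im]; ring
    rw [this]
    have := pow_pos (abs_pos.2 h) 2
    rw [sq_abs] at this
    have := div_pos this hp
    linarith

lemma logder (u : Polynomial ℝ) (hu : PRoot u) (z : ℂ) (hz : ¬ (z.im = 0 ∧ 0 ≤ z.re)) :
    ∃ L : ℂ, aeval z (derivative u) = aeval z u * L ∧ phi z L ≤ 0 := by
  have hne : aeval z u ≠ 0 := fun h => hz ⟨(hu.2 z h).1, (hu.2 z h).2.le⟩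
  set U := u.map (algebraMap ℝ ℂ) with hU
  have e1 : aeval z u = U.eval z := by rw [hU, eval_map_algebraMap]
  have e2 : aeval z (derivative u) = (derivative U).eval z := by
    rw [hU, derivative_map, eval_map_algebraMap]
  have hne' : U.eval z ≠ 0 := by rwa [← e1]
  refine ⟨(U.roots.map fun w ↦ 1 / (z - w)).sum, ?_, ?_⟩
  · rw [e1, e2]
    exact (IsAlgClosed.splits U).eval_derivative_eq_eval_mul_sum hne'
  · have : ∀ s : Multiset ℂ, (∀ w ∈ s, w.im = 0 ∧ 0 < w.re) →
        phi z (s.map fun w ↦ 1 / (z - w)).sum ≤ 0 := by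
      intro s
      induction s using Multiset.induction_on with
      | empty => intro _; simp [phi_zero]
      | cons w s ih =>
        intro h
        rw [Multiset.map_cons, Multiset.sum_cons, phi_add]
        have h1 := ih (fun v hv => h v (Multiset.mem_cons_of_mem hv))
        have h2 := h w (Multiset.mem_cons_self _ _)
        have h3 : w = ((w.re : ℝ) : ℂ) := by
          apply Complex.ext <;> simp [h2.1]
        have h4 := phi_inv z hz w.re h2.2.le
        rw [← h3] at h4
        linarith
    apply this
    intro w hw
    apply hu.2
    have := (mem_roots'.1 hw).2
    rwa [IsRoot.def, hU, eval_map_algebraMap] at this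

/-- Coefficientwise multiplier. -/
noncomputable def cMul (f : ℕ → ℝ) (p : Polynomial ℝ) : Polynomial ℝ :=
  ∑ k ∈ Finset.range (p.natDegree + 1), C (f k * p.coeff k) * X ^ k

lemma cMul_coeff (f : ℕ → ℝ) (p : Polynomial ℝ) (k : ℕ) :
    (cMul f p).coeff k = f k * p.coeff k := by
  unfold cMul
  simp only [finsetSum_coeff, coeff_C_mul_X_pow]
  rw [Finset.sum_ite_eq]
  split_ifs with h
  · rfl
  · rw [coeff_eq_zero_of_natDegree_lt, mul_zero]
    simp at h; omega

lemma cMul_deg (f : ℕ → ℝ) (p : Polynomial ℝ) (hf : f p.natDegree ≠ 0) (hp : p ≠ 0) :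
    (cMul f p).natDegree = p.natDegree ∧ cMul f p ≠ 0 := by
  have hc : (cMul f p).coeff p.natDegree ≠ 0 := by
    rw [cMul_coeff]
    exact mul_ne_zero hf (leadingCoeff_ne_zero.2 hp)
  refine ⟨natDegree_eq_of_le_of_coeff_ne_zero ?_ hc, fun h => hc (by simp [h])⟩
  rw [natDegree_le_iff_coeff_eq_zero]
  intro N hN
  rw [cMul_coeff, coeff_eq_zero_of_natDegree_lt hN, mul_zero]

lemma PRoot.factor {p : Polynomial ℝ} (hp : PRoot p) {n : ℕ} (hn : p.natDegree = n + 1) :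
    ∃ r > 0, ∃ q, p = (X - C r) * q ∧ q.natDegree = n ∧ PRoot q := by
  obtain ⟨z, hz⟩ := IsAlgClosed.exists_aeval_eq_zero ℂ p
    (by intro h; rw [natDegree_eq_zero_iff_degree_le_zero.2 h.le] at hn; omega)
  obtain ⟨h1, h2⟩ := hp.2 z hz
  have h3 : z = ((z.re : ℝ) : ℂ) := by
    apply Complex.ext <;> simp [h1]
  have hr : p.IsRoot z.re := by
    rw [h3] at hz
    have : aeval (algebraMap ℝ ℂ z.re) p = 0 := hz
    rw [aeval_algebraMap_apply] at this
    simpa using this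
  obtain ⟨q, hq⟩ := dvd_iff_isRoot.2 hr
  have hq0 : q ≠ 0 := by
    rintro rfl
    exact hp.1 (by simpa using hq)
  refine ⟨z.re, h2, q, hq, ?_, hq0, ?_⟩
  · rw [hq, natDegree_mul (X_sub_C_ne_zero _) hq0, natDegree_X_sub_C] at hn
    omega
  · intro w hw
    apply hp.2
    rw [hq, map_mul, hw, mul_zero]

lemma PRoot.final : ∀ (n : ℕ) (p : Polynomial ℝ), p.natDegree = n → PRoot p →
    p.roots.card = p.natDegree ∧ ∀ x ∈ p.roots, 0 < x := by
  intro n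
  induction n with
  | zero =>
    intro p hn hp
    rw [natDegree_eq_zero] at hn
    obtain ⟨c, rfl⟩ := hn
    simp
  | succ n ih =>
    intro p hn hp
    obtain ⟨r, hr, q, rfl, hq, hQ⟩ := hp.factor hn
    obtain ⟨h1, h2⟩ := ih q hq hQ
    rw [roots_mul hp.1, roots_X_sub_C, hn]
    simp only [Multiset.card_add, Multiset.card_singleton, Multiset.mem_add,
      Multiset.mem_singleton]
    refine ⟨by omega, ?_⟩
    rintro x (rfl | h)
    · exact hr
    · exact h2 x h

/-- The multiplier `(b+k)_{n-k}`. -/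
noncomputable def gL (n : ℕ) (b : ℝ) (k : ℕ) : ℝ := (ascPochhammer ℝ (n - k)).eval (b + (k : ℝ))

/-- The multiplier `(a)_k (b+k)_{n-k}`. -/
noncomputable def gJ (n : ℕ) (a b : ℝ) (k : ℕ) : ℝ := (ascPochhammer ℝ k).eval a * gL n b k

lemma gL_pos (n : ℕ) (b : ℝ) (hb : 0 < b) (k : ℕ) : 0 < gL n b k :=
  ascPochhammer_pos _ _ (by positivity)

lemma gJ_pos (n : ℕ) (a b : ℝ) (ha : 0 < a) (hb : 0 < b) (k : ℕ) : 0 < gJ n a b k :=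
  mul_pos (ascPochhammer_pos _ _ ha) (gL_pos n b hb k)

lemma gL_succ (n : ℕ) (b : ℝ) (k : ℕ) : gL (n + 1) b (k + 1) = gL n (b + 1) k := by
  unfold gL
  rw [Nat.add_sub_add_right]
  congr 1
  push_cast; ring

lemma gL_le (n : ℕ) (b : ℝ) (k : ℕ) (h : k ≤ n) :
    gL (n + 1) b k = (b + k) * gL n (b + 1) k := by
  unfold gL
  rw [Nat.sub_add_comm h, ascPochhammer_succ_left]
  simp only [eval_mul, eval_X, eval_comp, eval_add, eval_one]
  congr 2
  ring

lemma gJ_succ (n : ℕ) (a b : ℝ) (k : ℕ) :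
    gJ (n + 1) a b (k + 1) = (a + k) * gJ n a (b + 1) k := by
  unfold gJ
  rw [gL_succ, ascPochhammer_succ_eval]; ring

lemma gJ_le (n : ℕ) (a b : ℝ) (k : ℕ) (h : k ≤ n) :
    gJ (n + 1) a b k = (b + k) * gJ n a (b + 1) k := by
  unfold gJ
  rw [gL_le _ _ _ h]; ring

lemma coeff_theta (u : Polynomial ℝ) (k : ℕ) :
    (X * derivative u).coeff k = k * u.coeff k := by
  cases k with
  | zero => simp
  | succ k => rw [coeff_X_mul, coeff_derivative]; push_cast; ring

lemma step_L (n : ℕ) (b r : ℝ) (q : Polynomial ℝ) (hq : q.natDegree = n) :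
    cMul (gL (n + 1) b) ((X - C r) * q) = X * cMul (gL n (b + 1)) q -
      C r * (X * derivative (cMul (gL n (b + 1)) q) + C b * cMul (gL n (b + 1)) q) := by
  have key : ∀ k, gL (n + 1) b k * q.coeff k = (b + k) * gL n (b + 1) k * q.coeff k := by
    intro k
    by_cases h : k ≤ n
    · rw [gL_le _ _ _ h]
    · rw [coeff_eq_zero_of_natDegree_lt (by omega)]; simp
  ext k
  rw [cMul_coeff, sub_mul, coeff_sub, coeff_sub, coeff_C_mul, coeff_C_mul, coeff_add,
    coeff_theta, coeff_C_mul, cMul_coeff]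
  have := key k
  cases k with
  | zero =>
    rw [coeff_X_mul_zero, coeff_X_mul_zero]
    linear_combination (-r) * this
  | succ k =>
    rw [coeff_X_mul, coeff_X_mul, cMul_coeff, ← gL_succ n b k]
    linear_combination (-r) * this

lemma step_J (n : ℕ) (a b r : ℝ) (q : Polynomial ℝ) (hq : q.natDegree = n) :
    cMul (gJ (n + 1) a b) ((X - C r) * q) =
      X * (X * derivative (cMul (gJ n a (b + 1)) q) + C a * cMul (gJ n a (b + 1)) q) -
      C r * (X * derivative (cMul (gJ n a (b + 1)) q) + C b * cMul (gJ n a (b + 1)) q) := by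
  have key : ∀ k, gJ (n + 1) a b k * q.coeff k = (b + k) * gJ n a (b + 1) k * q.coeff k := by
    intro k
    by_cases h : k ≤ n
    · rw [gJ_le _ _ _ _ h]
    · rw [coeff_eq_zero_of_natDegree_lt (by omega)]; simp
  ext k
  rw [cMul_coeff, sub_mul, coeff_sub, coeff_sub, coeff_C_mul, coeff_C_mul, coeff_add,
    coeff_theta, coeff_C_mul, cMul_coeff]
  have := key k
  cases k with
  | zero =>
    rw [coeff_X_mul_zero, coeff_X_mul_zero]
    linear_combination (-r) * this
  | succ k =>
    rw [coeff_X_mul, coeff_X_mul, coeff_add, coeff_theta, coeff_C_mul, cMul_coeff]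
    have h2 := gJ_succ n a b k
    linear_combination (-r) * this + q.coeff k * h2

lemma PRoot.const {p : Polynomial ℝ} (hp : p ≠ 0) (h : p.natDegree = 0) : PRoot p := by
  rw [natDegree_eq_zero] at h
  obtain ⟨c, rfl⟩ := h
  refine ⟨hp, fun z hz => ?_⟩
  exfalso
  apply hp
  simpa using hz

/-- The multiplier preserves positive-rootedness in degree `n`. -/
def Pres (n : ℕ) (f : ℕ → ℝ) : Prop :=
  ∀ p : Polynomial ℝ, p.natDegree = n → PRoot p → (cMul f p).natDegree = n ∧ PRoot (cMul f p)

lemma case_zero {z : ℂ} (h : ¬ (z.im = 0 ∧ 0 < z.re)) (hz : z ≠ 0) :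
    ¬ (z.im = 0 ∧ 0 ≤ z.re) := by
  rintro ⟨h1, h2⟩
  rcases h2.lt_or_eq with h3 | h3
  · exact h ⟨h1, h3⟩
  · exact hz (Complex.ext h3.symm h1)

lemma Pres_L (n : ℕ) : ∀ b : ℝ, 0 < b → Pres n (gL n b) := by
  induction n with
  | zero =>
    intro b hb p hp hP
    have := cMul_deg (gL 0 b) p (gL_pos _ _ hb _).ne' hP.1
    exact ⟨by rw [this.1, hp], PRoot.const this.2 (by rw [this.1, hp])⟩
  | succ n ih =>
    intro b hb p hp hP
    have hd := cMul_deg (gL (n + 1) b) p (gL_pos _ _ hb _).ne' hP.1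
    refine ⟨by rw [hd.1, hp], hd.2, ?_⟩
    obtain ⟨r, hr, q, rfl, hq, hQ⟩ := hP.factor hp
    obtain ⟨-, hu⟩ := ih (b + 1) (by linarith) q hq hQ
    rw [step_L _ _ _ _ hq]
    set u := cMul (gL n (b + 1)) q
    intro z hz
    by_contra hcon
    have hne : aeval z u ≠ 0 := fun h => hcon (hu.2 z h)
    have hr' : (r : ℂ) ≠ 0 := by exact_mod_cast hr.ne'
    have hb' : (b : ℂ) ≠ 0 := by exact_mod_cast hb.ne'
    simp only [map_sub, map_add, map_mul, aeval_X, aeval_C, Complex.coe_algebraMap] at hz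
    have hz0 : z ≠ 0 := by
      rintro rfl
      have : (r : ℂ) * b * aeval (0 : ℂ) u = 0 := by linear_combination -hz
      exact mul_ne_zero (mul_ne_zero hr' hb') hne this
    have hz' := case_zero hcon hz0
    obtain ⟨L, hL, hphi⟩ := logder u hu z hz'
    rw [hL] at hz
    have h1 : z - r * (z * L + b) = 0 := by
      have : aeval z u * (z - r * (z * L + b)) = 0 := by linear_combination hz
      exact (mul_eq_zero.1 this).resolve_left hne
    have h2 : L + b * (1 / (z - (0 : ℝ))) = ((1 / r : ℝ) : ℂ) := by
      push_cast
      rw [sub_zero]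
      field_simp
      linear_combination -h1
    have h3 := phi_inv z hz' 0 le_rfl
    have h4 := phi_real z (1 / r) (by positivity)
    rw [← h2, phi_add, phi_smul] at h4
    nlinarith

lemma Pres_J (n : ℕ) : ∀ a b : ℝ, 0 < b → 0 < a → (n : ℝ) - 1 + b ≤ a → Pres n (gJ n a b) := by
  induction n with
  | zero =>
    intro a b hb ha hab p hp hP
    have := cMul_deg (gJ 0 a b) p (gJ_pos _ _ _ ha hb _).ne' hP.1
    exact ⟨by rw [this.1, hp], PRoot.const this.2 (by rw [this.1, hp])⟩
  | succ n ih =>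
    intro a b hb ha hab p hp hP
    push_cast at hab
    have hd := cMul_deg (gJ (n + 1) a b) p (gJ_pos _ _ _ ha hb _).ne' hP.1
    refine ⟨by rw [hd.1, hp], hd.2, ?_⟩
    obtain ⟨r, hr, q, rfl, hq, hQ⟩ := hP.factor hp
    obtain ⟨-, hu⟩ := ih a (b + 1) (by linarith) ha (by linarith) q hq hQ
    rw [step_J _ _ _ _ _ hq]
    set u := cMul (gJ n a (b + 1)) q
    intro z hz
    by_contra hcon
    have hne : aeval z u ≠ 0 := fun h => hcon (hu.2 z h)
    have hr' : (r : ℂ) ≠ 0 := by exact_mod_cast hr.ne'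
    have hb' : (b : ℂ) ≠ 0 := by exact_mod_cast hb.ne'
    simp only [map_sub, map_add, map_mul, aeval_X, aeval_C, Complex.coe_algebraMap] at hz
    have hz0 : z ≠ 0 := by
      rintro rfl
      have : (r : ℂ) * b * aeval (0 : ℂ) u = 0 := by linear_combination -hz
      exact mul_ne_zero (mul_ne_zero hr' hb') hne this
    have hzr : z - r ≠ 0 := by
      intro h
      have h' : z = r := by linear_combination h
      apply hcon
      rw [h']; simp [hr]
    have hz' := case_zero hcon hz0
    obtain ⟨L, hL, hphi⟩ := logder u hu z hz'
    rw [hL] at hz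
    have h1 : z * (z * L + a) - r * (z * L + b) = 0 := by
      have : aeval z u * (z * (z * L + a) - r * (z * L + b)) = 0 := by linear_combination hz
      exact (mul_eq_zero.1 this).resolve_left hne
    have h2 : L + b * (1 / (z - (0 : ℝ))) + ((a - b : ℝ) : ℂ) * (1 / (z - r)) = 0 := by
      push_cast
      rw [sub_zero]
      field_simp
      linear_combination h1
    have h3 := phi_inv z hz' 0 le_rfl
    have h4 := phi_inv z hz' r hr.le
    have h5 := congrArg (phi z) h2
    rw [phi_add, phi_add, phi_smul, phi_smul, phi_zero] at h5
    have h6 : 0 ≤ a - b := by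
      have : (0 : ℝ) ≤ n := Nat.cast_nonneg n
      linarith
    nlinarith [mul_nonneg h6 (neg_nonneg.2 h4.le), mul_pos hb (neg_pos.2 h3)]

lemma Pres_mul {n : ℕ} {f g : ℕ → ℝ} (hf : Pres n f) (hg : Pres n g) : Pres n (f * g) := by
  intro p hp hP
  obtain ⟨h1, h2⟩ := hg p hp hP
  have := hf _ h1 h2
  have e : cMul (f * g) p = cMul f (cMul g p) := by
    ext k; simp only [cMul_coeff, Pi.mul_apply]; ring
  rwa [e]

lemma Pres_one {n : ℕ} : Pres n 1 := by
  intro p hp hP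
  have e : cMul 1 p = p := by
    ext k; simp [cMul_coeff]
  rw [e]; exact ⟨hp, hP⟩

lemma Pres_prod {n m : ℕ} (f : Fin m → ℕ → ℝ) (hf : ∀ s, Pres n (f s)) :
    Pres n (∏ s, f s) :=
  Finset.prod_induction _ (Pres n) (fun _ _ => Pres_mul) Pres_one (fun s _ => hf s)

lemma base_PRoot (n : ℕ) : ((1 - X : Polynomial ℝ) ^ n).natDegree = n ∧
    PRoot ((1 - X : Polynomial ℝ) ^ n) := by
  have e : (1 - X : Polynomial ℝ) = -(X - C 1) := by simp
  have hd : (1 - X : Polynomial ℝ).natDegree = 1 := by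
    rw [e, natDegree_neg, natDegree_X_sub_C]
  have h0 : (1 - X : Polynomial ℝ) ≠ 0 := by
    intro h; rw [h] at hd; simp at hd
  refine ⟨by rw [natDegree_pow, hd, mul_one], pow_ne_zero _ h0, ?_⟩
  intro z hz
  rw [map_pow] at hz
  have h := eq_zero_of_pow_eq_zero hz
  simp only [map_sub, map_one, aeval_X] at h
  have : z = 1 := by linear_combination -h
  simp [this]

lemma coeff_base (n k : ℕ) :
    ((1 - X : Polynomial ℝ) ^ n).coeff k = (-1) ^ k * (n.choose k : ℝ) := by
  have e : (1 - X : Polynomial ℝ) ^ n = ((1 + X) ^ n).comp (C (-1) * X) := by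
    simp [sub_eq_add_neg]
  rw [e, comp_C_mul_X_coeff, coeff_one_add_X_pow]; ring

lemma asc_neg (n k : ℕ) :
    (ascPochhammer ℝ k).eval (-(n : ℝ)) / (k.factorial : ℝ) = (-1) ^ k * (n.choose k : ℝ) := by
  rw [ascPochhammer_eval_neg_eq_descPochhammer, descPochhammer_eval_eq_descFactorial,
    Nat.descFactorial_eq_factorial_mul_choose]
  have : (k.factorial : ℝ) ≠ 0 := by exact_mod_cast k.factorial_ne_zero
  push_cast
  field_simp

lemma hyp_eq (n i m : ℕ) (a : Fin i → ℝ) (b : Fin (i + m) → ℝ) :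
    hyp n a b = cMul ((∏ s, gJ n (a s) (b (Fin.castAdd m s))) *
      ∏ s, gL n (b (Fin.natAdd i s))) ((1 - X) ^ n) := by
  unfold hyp cMul
  rw [(base_PRoot n).1]
  apply Finset.sum_congr rfl
  intro k hk
  congr 2
  rw [coeff_base, ← asc_neg, Fin.prod_univ_add]
  simp only [Pi.mul_apply, Finset.prod_apply, gJ, gL, Finset.prod_mul_distrib]
  ring

/-- if `j ≥ i`, all `b_s > 0` and `a_s ≥ n - 1 + b_s` for `s = 1,…,i`, then the
hypergeometric polynomial has all roots real and strictly positive. -/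
theorem hyp_positive_roots (n : ℕ) (hn : 0 < n) {i j : ℕ} (hij : i ≤ j)
    (a : Fin i → ℝ) (b : Fin j → ℝ)
    (hb : ∀ s, 0 < b s)
    (ha : ∀ s : Fin i, (n : ℝ) - 1 + b (Fin.castLE hij s) ≤ a s) :
    RealRooted (hyp n a b) ∧ ∀ x ∈ (hyp n a b).roots, 0 < x := by
  obtain ⟨m, rfl⟩ := Nat.exists_eq_add_of_le hij
  have hP : Pres n ((∏ s, gJ n (a s) (b (Fin.castAdd m s))) * ∏ s, gL n (b (Fin.natAdd i s))) := by
    apply Pres_mul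
    · apply Pres_prod
      intro s
      have h1 := ha s
      have h2 := hb (Fin.castAdd m s)
      have h3 : (1 : ℝ) ≤ n := by exact_mod_cast hn
      have h4 : (n : ℝ) - 1 + b (Fin.castAdd m s) ≤ a s := h1
      exact Pres_J n _ _ h2 (by linarith) h4
    · exact Pres_prod _ (fun s => Pres_L n _ (hb _))
  obtain ⟨h1, h2⟩ := hP _ (base_PRoot n).1 (base_PRoot n).2
  rw [← hyp_eq] at h1 h2
  exact PRoot.final n _ h1 h2
end

section
/- For every integer n ≥ 4, the hypergeometric polynomials ₃𝓕₂(-n, 1/2, -n+1/2; 1, 1; x) and ₃𝓕₂(-n, 1/2, -n-1/2; 1, 1; x) have all of their roots real and strictly negative. -/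
open Polynomial

lemma hz_splits_of (f : ℝ[X]) (h : ∀ z : ℂ, aeval z f = 0 → z.im = 0) : f.Splits := by
  apply Splits.of_splits_map (algebraMap ℝ ℂ) (IsAlgClosed.splits _)
  intro z hz
  have h1 := (mem_roots'.1 hz).2
  rw [IsRoot.def, eval_map_algebraMap] at h1
  refine ⟨z.re, ?_⟩
  apply Complex.ext <;> simp [h z h1]

lemma hz_im_of (f : ℝ[X]) (hf : f.Splits) (h0 : f ≠ 0) (z : ℂ) (hz : aeval z f = 0) :
    z.im = 0 := by
  rw [(hf.map (algebraMap ℝ ℂ)).aeval_eq_prod_aroots, mul_eq_zero] at hz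
  rcases hz with hz | hz
  · simp at hz; exact absurd hz h0
  · rw [Multiset.prod_eq_zero_iff, Multiset.mem_map] at hz
    obtain ⟨a, ha, e⟩ := hz
    rw [aroots_def, hf.roots_map] at ha
    obtain ⟨b, hb, rfl⟩ := Multiset.mem_map.1 ha
    rw [sub_eq_zero] at e
    simp [e]

lemma hz_sum_im (z : ℂ) (hz : z.im ≠ 0) (s : Multiset ℝ) :
    ((s.map (fun x : ℝ => 1 / (z - (x : ℂ)))).sum).im * z.im ≤ 0 ∧
    (s ≠ 0 → ((s.map (fun x : ℝ => 1 / (z - (x : ℂ)))).sum).im * z.im < 0) := by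
  induction s using Multiset.induction with
  | empty => simp
  | cons a s ih =>
    have h1 : (1 / (z - (a : ℂ))).im * z.im < 0 := by
      have : 0 < Complex.normSq (z - (a : ℂ)) := by
        rw [Complex.normSq_pos]
        intro h
        apply hz
        have := congrArg Complex.im h
        simpa using this
      rw [one_div, Complex.inv_im]
      have h2 : 0 < z.im ^ 2 := by positivity
      have h3 : 0 < z.im ^ 2 / Complex.normSq (z - (a : ℂ)) := by positivity
      simp only [Complex.sub_im, Complex.ofReal_im, sub_zero]
      have h4 : -z.im / Complex.normSq (z - (a : ℂ)) * z.im =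
        - (z.im ^ 2 / Complex.normSq (z - (a : ℂ))) := by ring
      rw [h4]; linarith
    have h2 : (((a ::ₘ s).map (fun x : ℝ => 1 / (z - (x : ℂ)))).sum).im * z.im < 0 := by
      rw [Multiset.map_cons, Multiset.sum_cons, Complex.add_im, add_mul]
      linarith [ih.1]
    exact ⟨h2.le, fun _ => h2⟩

lemma hz_step (f : ℝ[X]) (hf : f.Splits) (r : ℝ) : (derivative f - C r * f).Splits := by
  by_cases h0 : f.natDegree = 0
  · apply Splits.of_natDegree_eq_zero
    rw [eq_C_of_natDegree_eq_zero h0, derivative_C, zero_sub, ← C_mul, ← C_neg, natDegree_C]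
  have hne : f ≠ 0 := by rintro rfl; simp at h0
  apply hz_splits_of
  intro z hz
  by_contra him
  have hfz : aeval z f ≠ 0 := fun h => him (hz_im_of f hf hne z h)
  have hfz' : (f.map (algebraMap ℝ ℂ)).eval z ≠ 0 := by rwa [eval_map_algebraMap]
  have key := (hf.map (algebraMap ℝ ℂ)).eval_derivative_div_eval_of_ne_zero hfz'
  rw [hf.roots_map, Multiset.map_map, derivative_map, eval_map_algebraMap, eval_map_algebraMap] at key
  have h2 : aeval z (derivative f) / aeval z f = (r : ℂ) := by
    rw [div_eq_iff hfz]
    simp only [map_sub, map_mul, aeval_C] at hz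
    exact sub_eq_zero.1 hz
  rw [h2] at key
  have h3 := (hz_sum_im z him f.roots).2 (hf.roots_ne_zero h0)
  have h4 : ((f.roots.map (fun x : ℝ => 1 / (z - (x : ℂ)))).sum) = (r : ℂ) := by
    rw [key]; rfl
  rw [h4] at h3
  simp at h3

lemma hz_lower (f : ℝ[X]) (hf : f.Splits) (z : ℂ) :
    |f.leadingCoeff| * |z.im| ^ f.natDegree ≤ ‖aeval z f‖ := by
  rw [(hf.map (algebraMap ℝ ℂ)).aeval_eq_prod_aroots, norm_mul, aroots_def, hf.roots_map, Multiset.map_map,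
    hf.natDegree_eq_card_roots]
  have : ‖(algebraMap ℝ ℂ) f.leadingCoeff‖ = |f.leadingCoeff| := by simp
  rw [this]
  gcongr
  induction f.roots using Multiset.induction with
  | empty => simp
  | cons a s ih =>
    rw [Multiset.card_cons, Multiset.map_cons, Multiset.prod_cons, norm_mul, pow_succ']
    gcongr
    have := Complex.abs_im_le_norm (z - (a : ℂ))
    simpa using this

noncomputable def hzL (N : ℕ) : ℝ[X] :=
  ∑ k ∈ Finset.range (N + 1), C ((N.choose k : ℝ) * (-1) ^ k / (k.factorial : ℝ)) * X ^ k

lemma hzL_eq (N : ℕ) : (((derivative : Module.End ℝ ℝ[X]) - 1) ^ N) (X ^ N) =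
    C (N.factorial : ℝ) * hzL N := by
  rw [sub_eq_add_neg, (Commute.neg_right (Commute.one_right (derivative : Module.End ℝ ℝ[X]))).add_pow, hzL, Finset.mul_sum,
    ← Finset.sum_range_reflect, LinearMap.sum_apply]
  apply Finset.sum_congr rfl
  intro k hk
  have hk : k ≤ N := by simpa [Nat.lt_succ_iff] using hk
  have e1 : N + 1 - 1 - k = N - k := by omega
  have e2 : N - (N - k) = k := by omega
  rw [e1, e2, Nat.choose_symm hk]
  have e3 : (((derivative : Module.End ℝ ℝ[X]) ^ (N - k)) * (-1) ^ k * ((N.choose k : ℕ) : Module.End ℝ ℝ[X])) (X ^ N)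
     = C (((-1) ^ k * (N.choose k : ℝ)) ) * (derivative^[N - k] (X ^ N)) := by
    have : ((-1 : Module.End ℝ ℝ[X]) ^ k * ((N.choose k : ℕ) : Module.End ℝ ℝ[X]))
       = ((-1) ^ k * (N.choose k : ℝ)) • (1 : Module.End ℝ ℝ[X]) := by
      rw [← Algebra.algebraMap_eq_smul_one]; simp
    rw [mul_assoc, this, Module.End.mul_apply, LinearMap.smul_apply, map_smul,
      Module.End.one_apply, Module.End.pow_apply, smul_eq_C_mul]
  rw [e3, iterate_derivative_X_pow_eq_C_mul, e2, ← mul_assoc, ← mul_assoc, ← C_mul, ← C_mul]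
  congr 2
  have h5 := Nat.factorial_mul_descFactorial (Nat.sub_le N k)
  rw [e2] at h5
  have h6 : (k.factorial : ℝ) ≠ 0 := by positivity
  rw [← h5]
  push_cast
  field_simp

lemma hz_pow (N : ℕ) (f : ℝ[X]) (hf : f.Splits) :
    ((((derivative : Module.End ℝ ℝ[X]) - 1) ^ N) f).Splits := by
  induction N with
  | zero => simpa using hf
  | succ N ih =>
    rw [pow_succ', Module.End.mul_apply]
    have := hz_step _ ih 1
    simpa using this

lemma hzL_splits (N : ℕ) : (hzL N).Splits := by
  have h := hz_pow N (X ^ N) (Splits.X_pow N)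
  rw [hzL_eq] at h
  have h1 : (N.factorial : ℝ) ≠ 0 := by positivity
  exact (splits_mul_iff_right (C_ne_zero.2 h1) (Splits.C _)).1 h

lemma hzL_pos (N : ℕ) (x : ℝ) (hx : x ≤ 0) : 0 < (hzL N).eval x := by
  rw [hzL, eval_finsetSum, Finset.sum_range_succ']
  have : 0 ≤ ∑ k ∈ Finset.range N, eval x (C ((N.choose (k+1) : ℝ) * (-1) ^ (k+1) / ((k+1).factorial : ℝ)) * X ^ (k+1)) := by
    apply Finset.sum_nonneg
    intro k _
    have : eval x (C ((N.choose (k+1) : ℝ) * (-1) ^ (k+1) / ((k+1).factorial : ℝ)) * X ^ (k+1))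
      = (N.choose (k+1) : ℝ) / ((k+1).factorial : ℝ) * (-x) ^ (k+1) := by
      simp only [eval_mul, eval_C, eval_pow, eval_X]
      rw [neg_pow x]; ring
    rw [this]
    have : 0 ≤ -x := by linarith
    positivity
  simp at this ⊢
  linarith

/-- L(c D^2) f splits -/
lemma hz_apply (c : ℝ) (hc : 0 < c) (s : Multiset ℝ) (hs : ∀ x ∈ s, 0 < x) (f : ℝ[X]) (hf : f.Splits) :
    (aeval (c • (derivative : Module.End ℝ ℝ[X]) ^ 2) ((s.map (fun a => X - C a)).prod) f).Splits := by
  induction s using Multiset.induction with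
  | empty => simpa using hf
  | cons a s ih =>
    have ih := ih (fun x hx => hs x (Multiset.mem_cons_of_mem hx))
    rw [Multiset.map_cons, Multiset.prod_cons, map_mul, Module.End.mul_apply]
    set g := aeval (c • (derivative : Module.End ℝ ℝ[X]) ^ 2) ((s.map (fun a => X - C a)).prod) f
    have ha : 0 < a := hs a (Multiset.mem_cons_self a s)
    have h1 := hz_step _ (hz_step g ih (√(a / c))) (-√(a / c))
    have h2 : aeval (c • (derivative : Module.End ℝ ℝ[X]) ^ 2) (X - C a) g = C c *
      (derivative (derivative g - C √(a / c) * g) - C (-√(a / c)) * (derivative g - C √(a / c) * g)) := by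
      have h3 : a = c * (√(a / c) * √(a / c)) := by
        rw [Real.mul_self_sqrt (by positivity)]; field_simp
      simp only [map_sub, aeval_X, aeval_C, LinearMap.sub_apply, LinearMap.smul_apply, pow_two,
        Module.End.mul_apply, Module.algebraMap_end_apply, derivative_mul, derivative_C, smul_eq_C_mul]
      conv_lhs => rw [h3]
      simp only [C_mul, C_neg]
      ring
    rw [h2]
    exact (Splits.C c).mul h1

lemma hzL_apply (c : ℝ) (hc : 0 < c) (N : ℕ) (f : ℝ[X]) (hf : f.Splits) :
    (aeval (c • (derivative : Module.End ℝ ℝ[X]) ^ 2) (hzL N) f).Splits := by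
  have h := (hzL_splits N).eq_prod_roots
  rw [h, map_mul, Module.End.mul_apply, aeval_C, Module.algebraMap_end_apply, smul_eq_C_mul]
  refine (Splits.C _).mul (hz_apply c hc _ ?_ f hf)
  intro x hx
  by_contra hx0
  have := hzL_pos N x (not_lt.1 hx0)
  have h1 := (mem_roots'.1 hx).2
  rw [IsRoot.def] at h1
  linarith

lemma hzL_apply_eq (c : ℝ) (N : ℕ) (f : ℝ[X]) :
    aeval (c • (derivative : Module.End ℝ ℝ[X]) ^ 2) (hzL N) f =
    ∑ k ∈ Finset.range (N + 1), C ((N.choose k : ℝ) * c ^ k * ((-1) ^ k / (k.factorial : ℝ))) *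
      derivative^[2 * k] f := by
  rw [hzL, map_sum, LinearMap.sum_apply]
  apply Finset.sum_congr rfl
  intro k _
  rw [map_mul, aeval_C, map_pow, aeval_X, Module.End.mul_apply, Module.algebraMap_end_apply, _root_.smul_pow,
    LinearMap.smul_apply, smul_smul, ← pow_mul, Module.End.pow_apply, smul_eq_C_mul]
  congr 2
  ring


lemma hz_sum_coeff (f : ℝ[X]) (N : ℕ) (a : ℕ → ℝ) (ha : a 0 = 1) :
    (∑ k ∈ Finset.range (N + 1), C (a k) * derivative^[2 * k] f).natDegree = f.natDegree ∧
    (∑ k ∈ Finset.range (N + 1), C (a k) * derivative^[2 * k] f).leadingCoeff = f.leadingCoeff := by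
  by_cases h0 : f = 0
  · subst h0; simp
  have h1 : ∀ d, f.natDegree ≤ d →
      (∑ k ∈ Finset.range (N + 1), C (a k) * derivative^[2 * k] f).coeff d = f.coeff d := by
    intro d hd
    rw [Finset.sum_range_succ', coeff_add, finsetSum_coeff, Finset.sum_eq_zero]
    · simp [ha]
    · intro k _
      rw [coeff_C_mul, coeff_iterate_derivative, coeff_eq_zero_of_natDegree_lt (by omega)]
      simp
  have h2 : (∑ k ∈ Finset.range (N + 1), C (a k) * derivative^[2 * k] f).natDegree = f.natDegree := by
    apply le_antisymm
    · rw [natDegree_le_iff_coeff_eq_zero]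
      intro d hd
      rw [h1 d hd.le, coeff_eq_zero_of_natDegree_lt hd]
    · apply le_natDegree_of_ne_zero
      rw [h1 _ le_rfl]
      simpa using h0
  refine ⟨h2, ?_⟩
  rw [leadingCoeff, h2, h1 _ le_rfl]
  rfl

noncomputable def hzc (k : ℕ) : ℝ := (1 / 16) ^ k / (k.factorial : ℝ) * ((-1) ^ k / (k.factorial : ℝ))

noncomputable def hzT (M : ℕ) : ℝ[X] := ∑ k ∈ Finset.range (M + 1), C (hzc k) * X ^ k

noncomputable def hzJ (M : ℕ) (f : ℝ[X]) : ℝ[X] :=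
  aeval ((derivative : Module.End ℝ ℝ[X]) ^ 2) (hzT M) f

lemma hzJ_eq (M : ℕ) (f : ℝ[X]) : hzJ M f =
    ∑ k ∈ Finset.range (M + 1), C (hzc k) * derivative^[2 * k] f := by
  rw [hzJ, hzT, map_sum, LinearMap.sum_apply]
  apply Finset.sum_congr rfl
  intro k _
  rw [map_mul, aeval_C, map_pow, aeval_X, Module.End.mul_apply, Module.algebraMap_end_apply,
    ← pow_mul, Module.End.pow_apply, smul_eq_C_mul]

open Filter Topology in
lemma hzJ_tendsto (M : ℕ) (f : ℝ[X]) (hM : f.natDegree ≤ M) (z : ℂ) :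
    Tendsto (fun N : ℕ => aeval z (aeval ((1 / (16 * (N : ℝ))) • (derivative : Module.End ℝ ℝ[X]) ^ 2) (hzL N) f))
      atTop (𝓝 (aeval z (hzJ M f))) := by
  have h1 : Tendsto (fun N : ℕ => ∑ k ∈ Finset.range (M + 1),
      ((((N.choose k : ℝ) * (1 / (16 * (N : ℝ))) ^ k * ((-1) ^ k / (k.factorial : ℝ)) : ℝ)) : ℂ) *
        aeval z (derivative^[2 * k] f)) atTop (𝓝 (aeval z (hzJ M f))) := by
    rw [hzJ_eq, map_sum]
    apply tendsto_finsetSum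
    intro k _
    rw [map_mul, aeval_C]
    apply Tendsto.mul_const
    refine (Complex.continuous_ofReal.tendsto _).comp ?_
    rw [hzc]
    apply Tendsto.mul_const
    apply ProbabilityTheory.tendsto_choose_mul_pow_atTop
    apply tendsto_const_nhds.congr'
    filter_upwards [eventually_ge_atTop 1] with n hn
    have : (n : ℝ) ≠ 0 := by positivity
    field_simp
  refine h1.congr' ?_
  filter_upwards [eventually_ge_atTop M] with N hN
  rw [hzL_apply_eq, map_sum]
  have : ∀ k, aeval z (C ((N.choose k : ℝ) * (1 / (16 * (N : ℝ))) ^ k * ((-1) ^ k / (k.factorial : ℝ))) *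
      derivative^[2 * k] f) = ((((N.choose k : ℝ) * (1 / (16 * (N : ℝ))) ^ k * ((-1) ^ k / (k.factorial : ℝ)) : ℝ)) : ℂ) *
        aeval z (derivative^[2 * k] f) := by
    intro k
    rw [map_mul, aeval_C]; rfl
  simp only [this]
  apply Finset.sum_subset
  · intro k hk; simp at hk ⊢; omega
  · intro k _ hk
    rw [iterate_derivative_eq_zero]
    · simp
    · simp at hk; omega

lemma hzJ_splits (M : ℕ) (f : ℝ[X]) (hM : f.natDegree ≤ M) (hf : f.Splits) (h0 : f ≠ 0) :
    (hzJ M f).Splits := by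
  apply hz_splits_of
  intro z hz
  by_contra him
  have h1 := (hzJ_tendsto M f hM z).norm
  rw [hz, norm_zero] at h1
  have h2 : |f.leadingCoeff| * |z.im| ^ f.natDegree ≤ 0 := by
    refine ge_of_tendsto h1 ?_
    filter_upwards [Filter.eventually_ge_atTop 1] with N hN
    have hN' : (0 : ℝ) < N := by exact_mod_cast hN
    have h3 := hz_lower _ (hzL_apply (1 / (16 * (N : ℝ))) (by positivity) N f hf) z
    have h4 := hz_sum_coeff f N (fun k => (N.choose k : ℝ) * (1 / (16 * (N : ℝ))) ^ k * ((-1) ^ k / (k.factorial : ℝ))) (by simp)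
    rw [hzL_apply_eq] at h3 ⊢
    rwa [h4.1, h4.2] at h3
  have h3 : 0 < |f.leadingCoeff| := by simpa using h0
  have h4 : 0 < |z.im| := by simpa using him
  have : 0 < |f.leadingCoeff| * |z.im| ^ f.natDegree := by positivity
  linarith

lemma hzT_coeff (M k : ℕ) : (hzT M).coeff k = if k ≤ M then hzc k else 0 := by
  rw [hzT, finsetSum_coeff]
  simp

lemma hzT_sq (M K : ℕ) (hK : K ≤ M) : (hzT M * hzT M).coeff K =
    (-1 / 16) ^ K * ((2 * K).choose K : ℝ) / (K.factorial : ℝ) ^ 2 := by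
  rw [coeff_mul, ← Nat.sum_range_choose_sq, Finset.Nat.sum_antidiagonal_eq_sum_range_succ_mk]
  push_cast
  rw [Finset.mul_sum, Finset.sum_div]
  apply Finset.sum_congr rfl
  intro i hi
  have hi : i ≤ K := by simpa [Nat.lt_succ_iff] using hi
  rw [hzT_coeff, hzT_coeff, if_pos (by omega), if_pos (by omega), Nat.cast_choose ℝ hi, hzc, hzc]
  obtain ⟨j, rfl⟩ := Nat.exists_eq_add_of_le hi
  simp only [Nat.add_sub_cancel_left]
  have := Nat.factorial_pos i
  have := Nat.factorial_pos j
  have := Nat.factorial_pos (i + j)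
  have e : (-1 / 16 : ℝ) = (1 / 16) * (-1) := by norm_num
  rw [e, mul_pow, pow_add, pow_add]
  field_simp

lemma hzV_eq (n m : ℕ) (h1 : 2 * n ≤ m) (h2 : m ≤ 2 * n + 1) (w : ℂ) :
    aeval w (hzJ m (hzJ m (X ^ m))) = ∑ K ∈ Finset.range (n + 1),
      (((-1 / 16) ^ K * ((2 * K).choose K : ℝ) / (K.factorial : ℝ) ^ 2 * (m.descFactorial (2 * K) : ℝ) : ℝ) : ℂ)
        * w ^ (m - 2 * K) := by
  rw [hzJ, hzJ, ← Module.End.mul_apply, ← map_mul, aeval_eq_sum_range' (p := hzT m * hzT m) (n := n + 1 + (hzT m * hzT m).natDegree) (by omega),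
    LinearMap.sum_apply, map_sum]
  symm
  apply Finset.sum_subset_zero_on_sdiff
  · intro k hk; simp at hk ⊢; omega
  · intro k hk
    rw [LinearMap.smul_apply, ← pow_mul, Module.End.pow_apply, iterate_derivative_eq_zero]
    · simp
    · simp at hk ⊢; omega
  · intro k hk
    have hk : k ≤ n := by simpa [Nat.lt_succ_iff] using hk
    rw [LinearMap.smul_apply, ← pow_mul, Module.End.pow_apply, hzT_sq m k (by omega),
      iterate_derivative_X_pow_eq_C_mul]
    simp
    ring

lemma hz_main (n m : ℕ) (h1 : 2 * n ≤ m) (h2 : m ≤ 2 * n + 1) (A : ℝ) (hA : A ≠ 0) (P : ℝ[X])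
    (hP : P = ∑ K ∈ Finset.range (n + 1), C (A * ((1 / 16) ^ K * ((2 * K).choose K : ℝ) /
      (K.factorial : ℝ) ^ 2 * (m.descFactorial (2 * K) : ℝ))) * X ^ K) :
    RealRooted P ∧ ∀ x ∈ P.roots, x < 0 := by
  have hX : (X ^ m : ℝ[X]) ≠ 0 := pow_ne_zero _ X_ne_zero
  have hd1 := hz_sum_coeff (X ^ m) m hzc (by simp [hzc])
  rw [← hzJ_eq] at hd1
  have hs1 := hzJ_splits m (X ^ m) (by simp) (Splits.X_pow m) hX
  have hn1 : hzJ m (X ^ m) ≠ 0 := by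
    rw [← leadingCoeff_ne_zero, hd1.2]; simp
  have hd2 := hz_sum_coeff (hzJ m (X ^ m)) m hzc (by simp [hzc])
  rw [← hzJ_eq] at hd2
  have hs2 := hzJ_splits m _ (by rw [hd1.1]; simp) hs1 hn1
  have hn2 : hzJ m (hzJ m (X ^ m)) ≠ 0 := by
    rw [← leadingCoeff_ne_zero, hd2.2, hd1.2]; simp
  have key : ∀ z : ℂ, aeval z P = 0 → z.im = 0 ∧ z.re < 0 := by
    intro z hz
    have hz0 : z ≠ 0 := by
      rintro rfl
      rw [hP, map_sum, Finset.sum_range_succ'] at hz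
      simp [hA] at hz
    obtain ⟨w, hw⟩ := IsAlgClosed.exists_pow_nat_eq (-1 / z) (n := 2) (by norm_num)
    have hw0 : w ≠ 0 := by
      rintro rfl
      have : (-1 / z : ℂ) ≠ 0 := by simp [hz0]
      exact this (by rw [← hw]; simp)
    have hzw : z = -1 / w ^ 2 := by rw [hw]; field_simp
    have hV : (A : ℂ) * aeval w (hzJ m (hzJ m (X ^ m))) = w ^ m * aeval z P := by
      rw [hzV_eq n m h1 h2, hP, map_sum, Finset.mul_sum, Finset.mul_sum]
      apply Finset.sum_congr rfl
      intro k hk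
      have hk : k ≤ n := by simpa [Nat.lt_succ_iff] using hk
      obtain ⟨j, rfl⟩ := Nat.exists_eq_add_of_le (show 2 * k ≤ m by omega)
      rw [Nat.add_sub_cancel_left, map_mul, aeval_C, map_pow, aeval_X, hzw]
      have e : (-1 / 16 : ℂ) = (1 / 16) * (-1) := by norm_num
      simp only [Complex.coe_algebraMap]
      push_cast
      rw [e, mul_pow, div_pow (-1 : ℂ), pow_add, pow_mul]
      field_simp
    rw [hz, mul_zero] at hV
    have hV' : aeval w (hzJ m (hzJ m (X ^ m))) = 0 := by
      rcases mul_eq_zero.1 hV with h | h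
      · exact absurd (by exact_mod_cast h) hA
      · exact h
    have him := hz_im_of _ hs2 hn2 w hV'
    have hwr : w = (w.re : ℂ) := by apply Complex.ext <;> simp [him]
    have hr0 : w.re ≠ 0 := by
      intro h; rw [h] at hwr; exact hw0 (by simpa using hwr)
    have hzr : z = ((-1 / w.re ^ 2 : ℝ) : ℂ) := by
      rw [hzw, hwr]; simp
    rw [hzr]
    refine ⟨Complex.ofReal_im _, ?_⟩
    rw [Complex.ofReal_re]
    have : 0 < w.re ^ 2 := by positivity
    exact div_neg_of_neg_of_pos (by norm_num) this
  constructor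
  · exact splits_iff_card_roots.1 (hz_splits_of P fun z hz => (key z hz).1)
  · intro x hx
    have h := (mem_roots'.1 hx).2
    have h3 : aeval (x : ℂ) P = 0 := by
      have := aeval_algebraMap_apply ℂ x P
      rw [Complex.coe_algebraMap] at this
      rw [this, coe_aeval_eq_eval, h.eq_zero]; simp
    simpa using (key x h3).2

lemma hz_half (k : ℕ) : (ascPochhammer ℝ k).eval (1 / 2 : ℝ) =
    ((2 * k).factorial : ℝ) / (4 ^ k * (k.factorial : ℝ)) := by
  induction k with
  | zero => simp
  | succ k ih =>
    rw [ascPochhammer_succ_eval, ih, show 2 * (k + 1) = 2 * k + 1 + 1 by ring,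
      Nat.factorial_succ, Nat.factorial_succ, Nat.factorial_succ k]
    have := Nat.factorial_pos k
    push_cast
    field_simp
    ring

lemma hz_one (k j : ℕ) : (ascPochhammer ℝ j).eval (1 + (k : ℝ)) =
    ((k + j).factorial : ℝ) / (k.factorial : ℝ) := by
  have := Nat.factorial_pos k
  induction j with
  | zero => simp; field_simp
  | succ j ih =>
    rw [ascPochhammer_succ_eval, ih, ← add_assoc, Nat.factorial_succ]
    push_cast
    field_simp
    ring

lemma hz_even (n k : ℕ) (hk : k ≤ n) :
    (ascPochhammer ℝ k).eval (-(n : ℝ)) * (ascPochhammer ℝ k).eval (-(n : ℝ) + 1 / 2) =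
    ((2 * n).descFactorial (2 * k) : ℝ) / 4 ^ k := by
  induction k with
  | zero => simp
  | succ k ih =>
    have ih := ih (by omega)
    rw [ascPochhammer_succ_eval, ascPochhammer_succ_eval, show 2 * (k + 1) = 2 * k + 1 + 1 by ring,
      Nat.descFactorial_succ, Nat.descFactorial_succ, Nat.cast_mul, Nat.cast_mul,
      Nat.cast_sub (by omega), Nat.cast_sub (by omega), pow_succ]
    rw [eq_div_iff (by positivity)] at ih ⊢
    rw [← ih]
    push_cast
    ring

lemma hz_odd (n k : ℕ) (hk : k ≤ n) :
    (ascPochhammer ℝ k).eval (-(n : ℝ)) * (ascPochhammer ℝ k).eval (-(n : ℝ) - 1 / 2) =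
    ((2 * n + 1).descFactorial (2 * k) : ℝ) / 4 ^ k := by
  induction k with
  | zero => simp
  | succ k ih =>
    have ih := ih (by omega)
    rw [ascPochhammer_succ_eval, ascPochhammer_succ_eval, show 2 * (k + 1) = 2 * k + 1 + 1 by ring,
      Nat.descFactorial_succ, Nat.descFactorial_succ, Nat.cast_mul, Nat.cast_mul,
      Nat.cast_sub (by omega), Nat.cast_sub (by omega), pow_succ]
    rw [eq_div_iff (by positivity)] at ih ⊢
    rw [← ih]
    push_cast
    ring

lemma hz_hyp (n m : ℕ) (a : ℝ) (h : ∀ k ≤ n,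
    (ascPochhammer ℝ k).eval (-(n : ℝ)) * (ascPochhammer ℝ k).eval a =
    (m.descFactorial (2 * k) : ℝ) / 4 ^ k) :
    hyp n ![(1 : ℝ) / 2, a] ![(1 : ℝ), 1] =
    ∑ K ∈ Finset.range (n + 1), C ((n.factorial : ℝ) ^ 2 * ((1 / 16) ^ K * ((2 * K).choose K : ℝ) /
      (K.factorial : ℝ) ^ 2 * (m.descFactorial (2 * K) : ℝ))) * X ^ K := by
  rw [hyp]
  apply Finset.sum_congr rfl
  intro k hk
  have hk : k ≤ n := by simpa [Nat.lt_succ_iff] using hk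
  congr 2
  simp only [Fin.prod_univ_two, Matrix.cons_val_zero, Matrix.cons_val_one]
  have e : ∀ x y z t : ℝ, x * (y * z) * t = (x * z) * y * t := by intros; ring
  rw [e, h k hk, hz_half, hz_one, Nat.add_sub_cancel' hk, Nat.cast_choose ℝ (show k ≤ 2 * k by omega),
    show 2 * k - k = k by omega, show (1 / 16 : ℝ) = 1 / 4 * (1 / 4) by norm_num, mul_pow, div_pow, one_pow]
  have := Nat.factorial_pos k
  field_simp

/-- for `n ≥ 4`, the polynomials `₃𝓕₂(-n, 1/2, -n±1/2; 1, 1; x)` have all their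
roots real and strictly negative. -/
theorem hyp_ringeling_zudilin (n : ℕ) (hn : 4 ≤ n) :
    (RealRooted (hyp n ![(1 : ℝ) / 2, -(n : ℝ) + 1 / 2] ![(1 : ℝ), 1]) ∧
      ∀ x ∈ (hyp n ![(1 : ℝ) / 2, -(n : ℝ) + 1 / 2] ![(1 : ℝ), 1]).roots, x < 0) ∧
    (RealRooted (hyp n ![(1 : ℝ) / 2, -(n : ℝ) - 1 / 2] ![(1 : ℝ), 1]) ∧
      ∀ x ∈ (hyp n ![(1 : ℝ) / 2, -(n : ℝ) - 1 / 2] ![(1 : ℝ), 1]).roots, x < 0) := by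
  have hA : (n.factorial : ℝ) ^ 2 ≠ 0 := by positivity
  exact ⟨hz_main n (2 * n) (by omega) (by omega) _ hA _ (hz_hyp n (2 * n) _ (fun k hk => hz_even n k hk)),
    hz_main n (2 * n + 1) (by omega) (by omega) _ hA _ (hz_hyp n (2 * n + 1) _ (fun k hk => hz_odd n k hk))⟩
end
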